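/- arXiv:0811.3225 — 15 statements merged into one kernel-verified Lean document; each statement's English description precedes it below -/
import Mathlib

section
/- For every natural number N ≥ 3, there exists a quadratic map f on ℚ^N such that the point 0 = (0,…,0) is periodic for f with minimal period exactly (N+1)(N+2)/2 + ⌊(N-1)/2⌋. -/
namespace QuadPeriod

/-- homogeneous coordinates normalised to have sum two -/
def hom {N : ℕ} (x : Fin N → ℚ) : Fin (N + 1) → ℚ := Fin.cons (2 - ∑ i, x i) x

lemma hom_tail {N : ℕ} (v : Fin (N + 1) → ℚ) (hv : ∑ i, v i = 2) :
    hom (fun i : Fin N => v i.succ) = v := by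
  rw [Fin.sum_univ_succ] at hv
  funext i
  refine Fin.cases ?_ (fun i => ?_) i
  · simp only [hom, Fin.cons_zero]; linarith
  · simp [hom]

/-- the quadratic form with prescribed values on the lattice points of the simplex -/
def quad {n : ℕ} (G : Sym2 (Fin n) → ℚ) (v : Fin n → ℚ) : ℚ :=
  1 / 2 * (∑ a, ∑ b, G s(a, b) * (v a * v b) - ∑ a, G s(a, a) * v a)

lemma quad_eval {n : ℕ} (G : Sym2 (Fin n) → ℚ) (a b : Fin n) (u w : ℚ) :
    quad G (fun x => (if x = a then u else 0) + (if x = b then w else 0)) =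
      1 / 2 * (u ^ 2 * G s(a, a) + w ^ 2 * G s(b, b) + 2 * u * w * G s(a, b)
        - u * G s(a, a) - w * G s(b, b)) := by
  unfold quad
  have h : G s(b, a) = G s(a, b) := by rw [Sym2.eq_swap]
  simp [add_mul, mul_add, Finset.sum_add_distrib, h]
  ring

/-- polynomial version of `hom` -/
noncomputable def homP (N : ℕ) : Fin (N + 1) → MvPolynomial (Fin N) ℚ :=
  Fin.cons (MvPolynomial.C 2 - ∑ i, MvPolynomial.X i) (fun i => MvPolynomial.X i)

lemma homP_eval {N : ℕ} (x : Fin N → ℚ) (a : Fin (N + 1)) :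
    MvPolynomial.eval x (homP N a) = hom x a := by
  refine Fin.cases ?_ (fun i => ?_) a
  · simp [homP, hom]
  · simp [homP, hom]

lemma homP_deg {N : ℕ} (a : Fin (N + 1)) : (homP N a).totalDegree ≤ 1 := by
  refine Fin.cases ?_ (fun i => ?_) a
  · simp only [homP, Fin.cons_zero]
    refine (MvPolynomial.totalDegree_sub _ _).trans (max_le (by simp) ?_)
    refine MvPolynomial.totalDegree_finsetSum_le (fun i _ => ?_)
    simp
  · simp [homP]

lemma quad_poly {N : ℕ} (G : Sym2 (Fin (N + 1)) → ℚ) :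
    ∃ p : MvPolynomial (Fin N) ℚ,
        p.totalDegree ≤ 2 ∧ ∀ x : Fin N → ℚ, quad G (hom x) = MvPolynomial.eval x p := by
  refine ⟨MvPolynomial.C (1 / 2) * (∑ a, ∑ b, MvPolynomial.C (G s(a, b)) * (homP N a * homP N b)
    - ∑ a, MvPolynomial.C (G s(a, a)) * homP N a), ?_, ?_⟩
  · have hC : ∀ (c : ℚ) (p : MvPolynomial (Fin N) ℚ) (d : ℕ), p.totalDegree ≤ d →
        (MvPolynomial.C c * p).totalDegree ≤ d := by
      intro c p d h
      refine (MvPolynomial.totalDegree_mul _ _).trans ?_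
      simpa using h
    apply hC
    refine (MvPolynomial.totalDegree_sub _ _).trans (max_le ?_ ?_)
    · refine MvPolynomial.totalDegree_finsetSum_le (fun a _ => ?_)
      refine MvPolynomial.totalDegree_finsetSum_le (fun b _ => ?_)
      apply hC
      refine (MvPolynomial.totalDegree_mul _ _).trans ?_
      have := homP_deg a
      have := homP_deg b
      omega
    · refine MvPolynomial.totalDegree_finsetSum_le (fun a _ => ?_)
      apply hC
      have := homP_deg a
      omega
  · intro x
    simp [quad, homP_eval]

/-- even vertices -/
def A (N j : ℕ) : Fin (N + 1) := Fin.ofNat (N + 1) (2 * j)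
/-- odd vertices -/
def B (N j : ℕ) : Fin (N + 1) := Fin.ofNat (N + 1) (2 * j + 1)

lemma A_val {N k : ℕ} (hk : 2 * k + 1 ≤ N) {j : ℕ} (hj : j ≤ k) : (A N j).val = 2 * j := by
  simp only [A, Fin.val_ofNat]; exact Nat.mod_eq_of_lt (by omega)
lemma B_val {N k : ℕ} (hk : 2 * k + 1 ≤ N) {j : ℕ} (hj : j ≤ k) : (B N j).val = 2 * j + 1 := by
  simp only [B, Fin.val_ofNat]; exact Nat.mod_eq_of_lt (by omega)
lemma AA {N k : ℕ} (hk : 2 * k + 1 ≤ N) {i j : ℕ} (hi : i ≤ k) (hj : j ≤ k) : A N i = A N j ↔ i = j := by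
  rw [Fin.ext_iff, A_val hk hi, A_val hk hj]; omega
lemma BB {N k : ℕ} (hk : 2 * k + 1 ≤ N) {i j : ℕ} (hi : i ≤ k) (hj : j ≤ k) : B N i = B N j ↔ i = j := by
  rw [Fin.ext_iff, B_val hk hi, B_val hk hj]; omega
lemma AB {N k : ℕ} (hk : 2 * k + 1 ≤ N) {i j : ℕ} (hi : i ≤ k) (hj : j ≤ k) : A N i = B N j ↔ False := by
  rw [Fin.ext_iff, A_val hk hi, B_val hk hj, iff_false]; omega
lemma BA {N k : ℕ} (hk : 2 * k + 1 ≤ N) {i j : ℕ} (hi : i ≤ k) (hj : j ≤ k) : B N i = A N j ↔ False := by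
  rw [Fin.ext_iff, B_val hk hi, A_val hk hj, iff_false]; omega

/-- the index type of the points of the orbit -/
abbrev I (N k : ℕ) := Sym2 (Fin (N + 1)) ⊕ Fin k

/-- the pair is one of the special lines -/
def IsLine (N k : ℕ) (s : Sym2 (Fin (N + 1))) : Prop := ∃ j < k, s = s(A N j, B N j)

/-- multiplicity of a vertex in a pair -/
def mult {n : ℕ} (s : Sym2 (Fin n)) (v : Fin n) : ℚ :=
  Sym2.lift ⟨fun a b => (if v = a then 1 else 0) + (if v = b then 1 else 0),
    fun a b => by ring⟩ s

@[simp] lemma mult_mk {n : ℕ} (a b v : Fin n) :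
    mult s(a, b) v = (if v = a then 1 else 0) + (if v = b then 1 else 0) := rfl

/-- weight -/
def wt {n : ℕ} (v : Fin n) : ℚ := if v.val % 2 = 0 then 1 / 2 else 3 / 2

open Classical in
/-- the points of the orbit, in homogeneous coordinates -/
noncomputable def P (N k : ℕ) : I N k → Fin (N + 1) → ℚ
  | .inl s => fun v => if IsLine N k s then mult s v * wt v else mult s v
  | .inr j => fun v => mult s(A N j, B N j) v * (2 - wt v)

lemma wt_A {N k : ℕ} (hk : 2 * k + 1 ≤ N) {j : ℕ} (hj : j ≤ k) : wt (A N j) = 1 / 2 := by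
  simp [wt, A_val hk hj]
lemma wt_B {N k : ℕ} (hk : 2 * k + 1 ≤ N) {j : ℕ} (hj : j ≤ k) : wt (B N j) = 3 / 2 := by
  simp only [wt, B_val hk hj]; rw [if_neg (by omega)]

lemma P_nonline {N k : ℕ} {a b : Fin (N + 1)} (h : ¬ IsLine N k s(a, b)) :
    P N k (.inl s(a, b)) = fun v => (if v = a then 1 else 0) + (if v = b then 1 else 0) := by
  funext v; simp [P, h]

lemma P_line {N k : ℕ} (hk : 2 * k + 1 ≤ N) {j : ℕ} (hj : j < k) :
    P N k (.inl s(A N j, B N j)) =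
      fun v => (if v = A N j then 1 / 2 else 0) + (if v = B N j then 3 / 2 else 0) := by
  have h : IsLine N k s(A N j, B N j) := ⟨j, hj, rfl⟩
  funext v
  simp only [P, h, if_true, mult_mk, add_mul, ite_mul, one_mul, zero_mul]
  congr 1
  · split_ifs with h1
    · rw [h1, wt_A hk hj.le]
    · rfl
  · split_ifs with h1
    · rw [h1, wt_B hk hj.le]
    · rfl

lemma P_extra {N k : ℕ} (hk : 2 * k + 1 ≤ N) (j : Fin k) :
    P N k (.inr j) =
      fun v => (if v = A N j then 3 / 2 else 0) + (if v = B N j then 1 / 2 else 0) := by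
  funext v
  simp only [P, mult_mk, add_mul, ite_mul, one_mul, zero_mul]
  congr 1
  · split_ifs with h1
    · rw [h1, wt_A hk j.2.le]; norm_num
    · rfl
  · split_ifs with h1
    · rw [h1, wt_B hk j.2.le]; norm_num
    · rfl

lemma P_sum {N k : ℕ} (hk : 2 * k + 1 ≤ N) (i : I N k) : ∑ v, P N k i v = 2 := by
  rcases i with s | j
  · by_cases h : IsLine N k s
    · obtain ⟨j, hj, rfl⟩ := h
      rw [P_line hk hj]
      simp [Finset.sum_add_distrib]; norm_num
    · induction s using Sym2.ind with
      | _ a b =>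
      rw [P_nonline h]
      simp [Finset.sum_add_distrib]; norm_num
  · rw [P_extra hk]
    simp [Finset.sum_add_distrib]; norm_num

/-- the pair underlying an index -/
def base {N k : ℕ} : I N k → Sym2 (Fin (N + 1))
  | .inl s => s
  | .inr j => s(A N j, B N j)

lemma mult_ne {n : ℕ} (s : Sym2 (Fin n)) (v : Fin n) : mult s v ≠ 0 ↔ v ∈ s := by
  induction s using Sym2.ind with
  | _ a b =>
  rw [mult_mk, Sym2.mem_iff]
  split_ifs <;> simp_all

lemma wt_ne {n : ℕ} (v : Fin n) : wt v ≠ 0 ∧ 2 - wt v ≠ 0 := by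
  unfold wt; split_ifs <;> norm_num

lemma P_ne {N k : ℕ} (i : I N k) (v : Fin (N + 1)) : P N k i v ≠ 0 ↔ v ∈ base i := by
  have := wt_ne v
  rcases i with s | j
  · rw [base, ← mult_ne]
    by_cases h : IsLine N k s <;> simp [P, h, this.1]
  · rw [base, ← mult_ne]
    simp only [P]
    rw [mul_ne_zero_iff]
    exact and_iff_left this.2

lemma P_inj {N k : ℕ} (hk : 2 * k + 1 ≤ N) : Function.Injective (P N k) := by
  intro i i' h
  have hb : base i = base i' := by
    apply Sym2.ext
    intro v
    rw [← P_ne, ← P_ne, h]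
  have key : ∀ (s : Sym2 (Fin (N + 1))) (j : Fin k), s = s(A N j, B N j) →
      P N k (.inl s) ≠ P N k (.inr j) := by
    intro s j hs h
    rw [hs, P_line hk j.2, P_extra hk j] at h
    have := congrFun h (A N j)
    simp [AB hk j.2.le j.2.le] at this
    norm_num at this
  rcases i with s | j <;> rcases i' with s' | j'
  · simp only [base] at hb; rw [hb]
  · exact absurd h (key s j' hb)
  · exact absurd h.symm (key s' j hb.symm)
  · simp only [base, Sym2.eq_iff, AA hk j.2.le j'.2.le, AB hk j.2.le j'.2.le, false_and,
      or_false] at hb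
    rw [Fin.ext hb.1]

/-- the four chains -/
def c (N k : ℕ) (i j : ℕ) : I N k :=
  if i = 0 then .inl s(B N j, B N j)
  else if i = 1 then (if j < k then .inl s(A N j, B N j) else .inl s(B N j, A N 0))
  else if i = 2 then (if h : j < k then .inr ⟨j, h⟩ else .inl s(A N j, A N 0))
  else .inl s(A N j, A N j)

lemma c_inj {N k : ℕ} (hk : 2 * k + 1 ≤ N) (hk1 : 1 ≤ k) {i i' j j' : ℕ} (hi : i < 4) (hi' : i' < 4)
    (hj : j ≤ k) (hj' : j' ≤ k) (h : c N k i j = c N k i' j') : i = i' ∧ j = j' := by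
  have h0 : 0 ≤ k := by omega
  unfold c at h
  interval_cases i <;> interval_cases i' <;>
    simp only [reduceIte, OfNat.ofNat_ne_zero, OfNat.ofNat_ne_one, one_ne_zero,
      Nat.reduceEqDiff] at h <;> (try split_ifs at h) <;>
    simp [Sym2.eq_iff, AA hk hj hj', AB hk hj hj', BA hk hj hj', BB hk hj hj',
      AA hk hj h0, AB hk hj h0, BA hk hj h0, BB hk hj h0,
      AA hk h0 hj', AB hk h0 hj', BA hk h0 hj', BB hk h0 hj'] at h <;>
    omega

lemma not_line_diag {N k : ℕ} (hk : 2 * k + 1 ≤ N) (a : Fin (N + 1)) :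
    ¬ IsLine N k s(a, a) := by
  rintro ⟨j, hj, h⟩
  simp only [Sym2.eq_iff] at h
  have := AB hk hj.le hj.le
  rcases h with h | h
  · exact this.1 (h.1.symm.trans h.2)
  · exact this.1 (h.2.symm.trans h.1)

lemma not_line_B {N k : ℕ} (hk : 2 * k + 1 ≤ N) : ¬ IsLine N k s(B N k, A N 0) := by
  rintro ⟨j, hj, h⟩
  simp [Sym2.eq_iff, BA hk le_rfl hj.le, BB hk le_rfl hj.le] at h
  omega

lemma not_line_A {N k : ℕ} (hk : 2 * k + 1 ≤ N) : ¬ IsLine N k s(A N k, A N 0) := by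
  rintro ⟨j, hj, h⟩
  simp [Sym2.eq_iff, AA hk le_rfl hj.le, AB hk le_rfl hj.le] at h
  omega

lemma chain_rel {N k : ℕ} (hk : 2 * k + 1 ≤ N) {j : ℕ} (hj : j ≤ k) (v : Fin (N + 1)) :
    P N k (c N k 0 j) v - 2 * P N k (c N k 1 j) v + 2 * P N k (c N k 2 j) v
      - P N k (c N k 3 j) v = 0 := by
  by_cases h : j < k
  · have e := P_extra hk ⟨j, h⟩
    simp only [c, reduceIte, h, dite_true, OfNat.ofNat_ne_zero, OfNat.ofNat_ne_one, one_ne_zero,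
      Nat.reduceEqDiff, P_nonline (not_line_diag hk _), P_line hk h, e]
    split_ifs <;> norm_num
  · obtain rfl : j = k := by omega
    simp only [c, reduceIte, h, dite_false, OfNat.ofNat_ne_zero, OfNat.ofNat_ne_one, one_ne_zero,
      Nat.reduceEqDiff, P_nonline (not_line_diag hk _), P_nonline (not_line_A hk),
      P_nonline (not_line_B hk)]
    split_ifs <;> norm_num

/-- interpolation -/
lemma interp {N k : ℕ} (hk : 2 * k + 1 ≤ N) (h : I N k → ℚ)
    (hrel : ∀ j < k, h (c N k 0 j) - 2 * h (c N k 1 j) + 2 * h (c N k 2 j) - h (c N k 3 j) = 0) :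
    ∃ G : Sym2 (Fin (N + 1)) → ℚ, ∀ i, quad G (P N k i) = h i := by
  classical
  have hG : ∀ s : Sym2 (Fin (N + 1)), ∃ g : ℚ, (¬ IsLine N k s → g = h (.inl s)) ∧
      ∀ j < k, s = s(A N j, B N j) → g = (4 * (h (c N k 1 j) + h (c N k 2 j))
        - h (c N k 0 j) - h (c N k 3 j)) / 6 := by
    intro s
    by_cases hs : IsLine N k s
    · obtain ⟨j, hj, rfl⟩ := hs
      refine ⟨(4 * (h (c N k 1 j) + h (c N k 2 j))
        - h (c N k 0 j) - h (c N k 3 j)) / 6, fun hn => absurd ⟨j, hj, rfl⟩ hn, ?_⟩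
      intro j' hj' he
      simp only [Sym2.eq_iff, AA hk hj.le hj'.le, AB hk hj.le hj'.le, false_and, or_false] at he
      rw [he.1]
    · exact ⟨h (.inl s), fun _ => rfl, fun j hj he => absurd ⟨j, hj, he⟩ hs⟩
  choose G hG1 hG2 using hG
  refine ⟨G, ?_⟩
  have hd : ∀ a, G s(a, a) = h (.inl s(a, a)) := fun a => hG1 _ (not_line_diag hk a)
  rintro (s | j)
  · by_cases hs : IsLine N k s
    · obtain ⟨j, hj, rfl⟩ := hs
      have := hrel j hj
      rw [P_line hk hj, quad_eval, hd, hd, hG2 _ j hj rfl]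
      simp only [c, reduceIte, hj, dite_true, OfNat.ofNat_ne_zero, OfNat.ofNat_ne_one, one_ne_zero,
        Nat.reduceEqDiff] at this ⊢
      linarith
    · induction s using Sym2.ind with
      | _ a b =>
      rw [P_nonline hs, quad_eval, hd, hd, hG1 _ hs]
      ring
  · obtain ⟨j, hj⟩ := j
    have := hrel j hj
    rw [P_extra hk, quad_eval, hd, hd, hG2 _ j hj rfl]
    simp only [c, reduceIte, hj, dite_true, OfNat.ofNat_ne_zero, OfNat.ofNat_ne_one, one_ne_zero,
      Nat.reduceEqDiff] at this ⊢
    linarith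

/-- cyclic enumeration of the index set following the chains -/
lemma enum {N k M : ℕ} (hk : 2 * k + 1 ≤ N) (hk1 : 1 ≤ k) (hM : Fintype.card (I N k) = M)
    (hM4 : 4 * (k + 1) ≤ M) :
    ∃ g : Fin M ≃ I N k, ∀ (i j : ℕ) (_ : i < 4) (_ : j ≤ k) (hij : i * (k + 1) + j < M),
      g ⟨i * (k + 1) + j, hij⟩ = c N k i j := by
  classical
  obtain ⟨g, hg⟩ := Finset.exists_equiv_extend_of_card_eq (α := Fin M) (β := I N k)
    (t := Finset.univ) (by simp only [Fintype.card_fin, Finset.card_univ, hM])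
    (s := Finset.univ.filter (fun n : Fin M => n.val < 4 * (k + 1)))
    (f := fun n => c N k (n.val / (k + 1)) (n.val % (k + 1)))
    (Finset.subset_univ _) (by
      intro m hm n hn hmn
      simp only [Finset.coe_filter, Finset.mem_univ, true_and, Set.mem_setOf_eq] at hm hn
      have hpos : 0 < k + 1 := by omega
      have := c_inj hk hk1 ((Nat.div_lt_iff_lt_mul hpos).2 hm) ((Nat.div_lt_iff_lt_mul hpos).2 hn)
        (Nat.lt_succ_iff.1 (Nat.mod_lt _ hpos)) (Nat.lt_succ_iff.1 (Nat.mod_lt _ hpos)) hmn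
      apply Fin.ext
      rw [← Nat.div_add_mod m.val (k + 1), ← Nat.div_add_mod n.val (k + 1), this.1, this.2])
  refine ⟨g.trans (Equiv.subtypeUnivEquiv (fun x => Finset.mem_univ x)), ?_⟩
  intro i j hi hj hij
  have := hg ⟨i * (k + 1) + j, hij⟩ (by
    simp only [Finset.mem_filter, Finset.mem_univ, true_and]
    nlinarith)
  have e1 : (i * (k + 1) + j) / (k + 1) = i := by
    rw [mul_comm, Nat.mul_add_div (by omega), Nat.div_eq_of_lt (by omega), add_zero]
  have e2 : (i * (k + 1) + j) % (k + 1) = j := by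
    rw [mul_comm, Nat.mul_add_mod, Nat.mod_eq_of_lt (by omega)]
  simp only [e1, e2] at this
  simpa using this

lemma period_of_enum {X : Type*} (f : X → X) {M : ℕ} (hM : 0 < M) (E : ℕ → X)
    (hE : ∀ n, f (E n) = E (n + 1)) (hE2 : ∀ m n, E m = E n ↔ m % M = n % M) (m : ℕ) :
    Function.minimalPeriod f (E m) = M := by
  have hit : ∀ n, f^[n] (E m) = E (m + n) := by
    intro n
    induction n with
    | zero => rfl
    | succ n ih => rw [Function.iterate_succ_apply', ih, hE]; rfl
  have hiff : ∀ n, Function.IsPeriodicPt f n (E m) ↔ M ∣ n := by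
    intro n
    rw [Function.IsPeriodicPt, Function.IsFixedPt, hit, hE2]
    constructor
    · intro h
      have : m + n ≡ m + 0 [MOD M] := h
      exact (Nat.modEq_zero_iff_dvd).1 (Nat.ModEq.add_left_cancel' m this)
    · rintro ⟨d, rfl⟩
      simp
  apply Nat.dvd_antisymm
  · exact ((hiff M).2 dvd_rfl).minimalPeriod_dvd
  · exact (hiff _).1 (Function.isPeriodicPt_minimalPeriod f (E m))

end QuadPeriod


/-- For every natural number `N ≥ 3`, there exists a quadratic map `f` on `ℚ^N`
(each coordinate given by a polynomial of total degree at most 2) such that the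
point `0` is periodic for `f` with minimal period exactly
`(N+1)(N+2)/2 + ⌊(N-1)/2⌋`. -/
theorem exists_quadratic_map_with_period (N : ℕ) (hN : 3 ≤ N) :
    ∃ f : (Fin N → ℚ) → (Fin N → ℚ),
      (∀ i : Fin N, ∃ p : MvPolynomial (Fin N) ℚ,
        p.totalDegree ≤ 2 ∧ ∀ x : Fin N → ℚ, f x i = MvPolynomial.eval x p) ∧
      Function.minimalPeriod f (fun _ => 0) = (N + 1) * (N + 2) / 2 + (N - 1) / 2 := by
  classical
  obtain ⟨k, hkdef⟩ : ∃ k, k = (N - 1) / 2 := ⟨_, rfl⟩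
  have hk : 2 * k + 1 ≤ N := by omega
  have hk1 : 1 ≤ k := by omega
  obtain ⟨M, hMdef⟩ : ∃ M, M = (N + 1) * (N + 2) / 2 + (N - 1) / 2 := ⟨_, rfl⟩
  rw [← hMdef]
  have hcard : Fintype.card (QuadPeriod.I N k) = M := by
    rw [Fintype.card_sum, Sym2.card, Fintype.card_fin, Fintype.card_fin, Nat.choose_two_right,
      hMdef, hkdef, mul_comm (N + 1 + 1)]
    rfl
  have hM4 : 4 * (k + 1) ≤ M := by
    have : 2 * N + 2 ≤ (N + 1) * (N + 2) / 2 := by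
      rw [Nat.le_div_iff_mul_le (by norm_num)]
      nlinarith
    omega
  have hM0 : 0 < M := by omega
  obtain ⟨g, hg⟩ := QuadPeriod.enum hk hk1 hcard hM4
  let E : ℕ → QuadPeriod.I N k := fun n => g ⟨n % M, Nat.mod_lt _ hM0⟩
  have hEE : ∀ m n, E m = E n ↔ m % M = n % M := by
    intro m n
    simp [E]
  have hEc : ∀ i j, i < 4 → j ≤ k → E (i * (k + 1) + j) = QuadPeriod.c N k i j := by
    intro i j hi hj
    have hlt : i * (k + 1) + j < M := by nlinarith
    rw [← hg i j hi hj hlt]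
    simp only [E, Nat.mod_eq_of_lt hlt]
  -- the desired values
  let nx : QuadPeriod.I N k → QuadPeriod.I N k := fun i => E ((g.symm i).val + 1)
  have hnx : ∀ n, nx (E n) = E (n + 1) := by
    intro n
    simp only [nx]
    rw [hEE]
    simp [E]
  have hnc : ∀ i j, i < 4 → j < k → nx (QuadPeriod.c N k i j) = QuadPeriod.c N k i (j + 1) := by
    intro i j hi hj
    rw [← hEc i j hi hj.le, hnx, ← hEc i (j + 1) hi hj]
    rfl
  have hquad : ∀ v : Fin (N + 1), ∃ G : Sym2 (Fin (N + 1)) → ℚ,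
      ∀ i, QuadPeriod.quad G (QuadPeriod.P N k i) = QuadPeriod.P N k (nx i) v := by
    intro v
    apply QuadPeriod.interp hk
    intro j hj
    rw [hnc 0 j (by norm_num) hj, hnc 1 j (by norm_num) hj, hnc 2 j (by norm_num) hj,
      hnc 3 j (by norm_num) hj]
    exact QuadPeriod.chain_rel hk hj v
  choose G hG using hquad
  refine ⟨fun x i => QuadPeriod.quad (G i.succ) (QuadPeriod.hom x), fun i => QuadPeriod.quad_poly _, ?_⟩
  let pt : QuadPeriod.I N k → Fin N → ℚ := fun i v => QuadPeriod.P N k i v.succ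
  have hpt : ∀ i, QuadPeriod.hom (pt i) = QuadPeriod.P N k i :=
    fun i => QuadPeriod.hom_tail _ (QuadPeriod.P_sum hk i)
  have hptinj : Function.Injective pt := by
    intro i i' h
    apply QuadPeriod.P_inj hk
    rw [← hpt, ← hpt, h]
  have hzero : (fun _ => 0 : Fin N → ℚ) = pt (.inl s(0, 0)) := by
    funext v
    simp only [pt]
    rw [QuadPeriod.P_nonline (QuadPeriod.not_line_diag hk _)]
    simp [Fin.succ_ne_zero]
  obtain ⟨m, hm⟩ : ∃ m, E m = .inl s(0, 0) := by
    refine ⟨(g.symm (.inl s(0, 0))).val, ?_⟩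
    simp only [E, Nat.mod_eq_of_lt (Fin.is_lt _)]
    simp
  rw [hzero, ← hm]
  refine QuadPeriod.period_of_enum _ hM0 (fun n => pt (E n)) ?_ ?_ m
  · intro n
    funext v
    simp only [hpt, hG, hnx]
    rfl
  · intro m n
    rw [← hEE]
    exact hptinj.eq_iff
end

section
/- There exists a quadratic map f on ℚ^2 such that the point (0,0) is periodic for f with minimal period exactly 7. -/
open MvPolynomial in
/-- There exists a quadratic map `f` on `ℚ^2` such that the point `(0,0)` is
periodic for `f` with minimal period exactly `7`. -/
theorem exists_quadratic_map_on_Q2_with_period_seven :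
    ∃ f : (Fin 2 → ℚ) → (Fin 2 → ℚ),
      (∀ i : Fin 2, ∃ p : MvPolynomial (Fin 2) ℚ,
        p.totalDegree ≤ 2 ∧ ∀ x : Fin 2 → ℚ, f x i = MvPolynomial.eval x p) ∧
      Function.minimalPeriod f (fun _ => 0) = 7 := by
  have h0 : (fun _ => 0 : Fin 2 → ℚ) = ![0, 0] := by
    funext i; fin_cases i <;> rfl
  refine ⟨fun x => ![x 1, 1 - x 0 - 5 / 2 * x 1 + 1 / 2 * x 1 ^ 2], ?_, ?_⟩
  · intro i
    fin_cases i
    · exact ⟨X 1, by simp [totalDegree_X], fun x => by simp⟩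
    · refine ⟨C 1 - X 0 - C (5 / 2) * X 1 + C (1 / 2) * X 1 ^ 2, ?_, fun x => by simp⟩
      have hX : ∀ j : Fin 2, (X j : MvPolynomial (Fin 2) ℚ).totalDegree ≤ 2 := by
        intro j; simp [totalDegree_X]
      have hC : ∀ c : ℚ, (C c : MvPolynomial (Fin 2) ℚ).totalDegree ≤ 2 := by
        intro c; simp
      refine (totalDegree_add _ _).trans (max_le ?_ ?_)
      · refine (totalDegree_sub _ _).trans (max_le ?_ ?_)
        · exact (totalDegree_sub _ _).trans (max_le (hC 1) (hX 0))
        · refine (totalDegree_mul _ _).trans ?_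
          simp [totalDegree_X]
      · refine (totalDegree_mul _ _).trans ?_
        simp [totalDegree_X_pow]
  · rw [h0]
    have : Fact (Nat.Prime 7) := ⟨by norm_num⟩
    refine Function.minimalPeriod_eq_prime ?_ ?_
    rotate_left
    · intro h
      have := congrFun h 1
      norm_num at this
    · simp only [Function.IsPeriodicPt, Function.IsFixedPt, Function.iterate_succ,
        Function.iterate_zero, Function.comp, id]
      funext i
      fin_cases i <;> norm_num
end

section
/- For every natural number N ≥ 3, the set of quadratic maps f on ℚ^N under which the point 0 = (0,…,0) has minimal period exactly (N+1)(N+2)/2 + ⌊(N-1)/2⌋ is infinite. -/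
/-- Explicit quadratic function. -/
def qfun {N : ℕ} (a : ℚ) (l : Fin N → ℚ) (q : Fin N → Fin N → ℚ) (x : Fin N → ℚ) : ℚ :=
  a + ∑ i, l i * x i + ∑ i, ∑ j, q i j * (x i * x j)

lemma qfun_poly {N : ℕ} (a : ℚ) (l : Fin N → ℚ) (q : Fin N → Fin N → ℚ) :
    ∃ p : MvPolynomial (Fin N) ℚ,
      p.totalDegree ≤ 2 ∧ ∀ x : Fin N → ℚ, qfun a l q x = MvPolynomial.eval x p := by
  refine ⟨MvPolynomial.C a + ∑ i, MvPolynomial.C (l i) * MvPolynomial.X i +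
    ∑ i, ∑ j, MvPolynomial.C (q i j) * (MvPolynomial.X i * MvPolynomial.X j), ?_, ?_⟩
  · refine (MvPolynomial.totalDegree_add _ _).trans (max_le ?_ ?_)
    · refine (MvPolynomial.totalDegree_add _ _).trans (max_le (by simp) ?_)
      refine MvPolynomial.totalDegree_finsetSum_le fun i _ => ?_
      refine (MvPolynomial.totalDegree_mul _ _).trans ?_
      simp
    · refine MvPolynomial.totalDegree_finsetSum_le fun i _ => ?_
      refine MvPolynomial.totalDegree_finsetSum_le fun j _ => ?_
      refine (MvPolynomial.totalDegree_mul _ _).trans ?_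
      have := MvPolynomial.totalDegree_mul (MvPolynomial.X i : MvPolynomial (Fin N) ℚ)
        (MvPolynomial.X j)
      simp only [MvPolynomial.totalDegree_X] at this
      simpa using this
  · intro x
    simp [qfun]

lemma qfun_scale {N : ℕ} (a : ℚ) (l : Fin N → ℚ) (q : Fin N → Fin N → ℚ) (t : ℚ) (ht : t ≠ 0)
    (x : Fin N → ℚ) :
    t * qfun a l q (fun i => t⁻¹ * x i) = qfun (t * a) l (fun i j => t⁻¹ * q i j) x := by
  simp only [qfun, mul_add, Finset.mul_sum]
  congr 1
  · congr 1
    refine Finset.sum_congr rfl fun i _ => ?_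
    field_simp
  · refine Finset.sum_congr rfl fun i _ => Finset.sum_congr rfl fun j _ => ?_
    field_simp

/-- Base interpolation points. -/
def bpt {N : ℕ} (c : Fin N → ℚ) : Option (Fin N) → Option (Fin N) → (Fin N → ℚ)
  | none, none => 0
  | none, some i => Pi.single i 1
  | some i, none => Pi.single i 1
  | some i, some j => if i = j then Pi.single i (c i) else Pi.single i 1 + Pi.single j 1

lemma bpt_symm {N : ℕ} (c : Fin N → ℚ) (a b : Option (Fin N)) : bpt c a b = bpt c b a := by
  rcases a with _ | i <;> rcases b with _ | j <;> simp only [bpt]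
  by_cases h : i = j
  · subst h; rfl
  · rw [if_neg h, if_neg (Ne.symm h), add_comm]

lemma qfun_single {N : ℕ} (a : ℚ) (l : Fin N → ℚ) (q : Fin N → Fin N → ℚ) (i : Fin N) (s : ℚ) :
    qfun a l q (Pi.single i s) = a + l i * s + q i i * (s * s) := by
  simp [qfun, Pi.single_apply]

lemma qfun_add {N : ℕ} (a : ℚ) (l : Fin N → ℚ) (q : Fin N → Fin N → ℚ) (i j : Fin N) :
    qfun a l q (Pi.single i 1 + Pi.single j 1) =
      a + (l i + l j) + (q i i + q i j + q j i + q j j) := by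
  simp [qfun, Pi.single_apply, mul_add, Finset.sum_add_distrib]
  ring

/-- Linear coefficients of the interpolant. -/
def cl {N : ℕ} (c : Fin N → ℚ) (g : Option (Fin N) → Option (Fin N) → ℚ) (i : Fin N) : ℚ :=
  (c i ^ 2 * (g none (some i) - g none none) - (g (some i) (some i) - g none none)) /
    (c i * (c i - 1))

/-- Quadratic coefficients of the interpolant. -/
def cq {N : ℕ} (c : Fin N → ℚ) (g : Option (Fin N) → Option (Fin N) → ℚ) (i j : Fin N) : ℚ :=
  if i = j then ((g (some i) (some i) - g none none) - c i * (g none (some i) - g none none)) /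
    (c i * (c i - 1))
  else (g (some i) (some j) - g none (some i) - g none (some j) + g none none) / 2

lemma interp {N : ℕ} (c : Fin N → ℚ) (h0 : ∀ i, c i ≠ 0) (h1 : ∀ i, c i - 1 ≠ 0)
    (g : Option (Fin N) → Option (Fin N) → ℚ) (hg : ∀ a b, g a b = g b a) (a b) :
    qfun (g none none) (cl c g) (cq c g) (bpt c a b) = g a b := by
  have key : ∀ i, cl c g i + cq c g i i = g none (some i) - g none none := by
    intro i
    have := h0 i
    have := h1 i
    simp only [cl, cq, if_true]
    field_simp
    ring
  rcases a with _ | i <;> rcases b with _ | j <;> simp only [bpt]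
  · simp [qfun]
  · rw [qfun_single]; linear_combination key j
  · rw [qfun_single, hg (some i) none]; linear_combination key i
  · by_cases h : i = j
    · subst h
      have := h0 i
      have := h1 i
      rw [if_pos rfl, qfun_single]
      simp only [cl, cq, if_true]
      field_simp
      ring
    · rw [if_neg h, qfun_add]
      have e1 : cq c g i j = (g (some i) (some j) - g none (some i) - g none (some j)
        + g none none) / 2 := by simp [cq, h]
      have e2 : cq c g j i = (g (some i) (some j) - g none (some i) - g none (some j)
        + g none none) / 2 := by
          simp [cq, Ne.symm h, hg (some j) (some i)]; ring
      linear_combination key i + key j + e1 + e2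

lemma extra {N : ℕ} (c : Fin N → ℚ) (g : Option (Fin N) → Option (Fin N) → ℚ) (i : Fin N)
    (hc : c i = 3) :
    qfun (g none none) (cl c g) (cq c g) (Pi.single i 4) =
      g none none + 2 * (g (some i) (some i) - g none (some i)) := by
  rw [qfun_single]
  simp only [cl, cq, if_true, hc]
  ring

lemma cycle_lemma {X K : Type*} [Fintype X] [DecidableEq X] [Fintype K] (n : ℕ) [NeZero n]
    (hX : Fintype.card X = n) (src tgt : K → X) (hinj : Function.Injective (Sum.elim src tgt)) :
    ∃ e : Fin n ≃ X, ∀ k, e (e.symm (src k) + 1) = tgt k := by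
  classical
  have hs : Function.Injective src := hinj.comp Sum.inl_injective
  have ht : Function.Injective tgt := hinj.comp Sum.inr_injective
  have hst : ∀ a b, src a ≠ tgt b := fun a b h => by
    have := @hinj (Sum.inl a) (Sum.inr b) h
    simp at this
  set M := Fintype.card K
  have hM : 2 * M ≤ n := by
    have := Fintype.card_le_of_injective _ hinj
    rw [Fintype.card_sum, hX] at this
    omega
  let E := Fintype.equivFin K
  let x0 : X := (Fintype.equivFinOfCardEq hX).symm 0
  let h : Fin n → X := fun p => if hp : p.1 < 2 * M then
      (if p.1 % 2 = 0 then src (E.symm ⟨p.1 / 2, by omega⟩) else tgt (E.symm ⟨p.1 / 2, by omega⟩))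
    else x0
  obtain ⟨e, he⟩ := Finset.exists_equiv_extend_of_card_eq (α := Fin n) (t := (Finset.univ : Finset X))
    (by simp [hX]) (s := {p : Fin n | p.1 < 2 * M}) (f := h) (by simp) (by
      intro p hp q hq hpq
      simp only [Finset.mem_coe, Finset.mem_filter, Finset.mem_univ, true_and] at hp hq
      simp only [h, hp, hq, dif_pos] at hpq
      ext
      split_ifs at hpq
      · have := E.symm.injective (hs hpq)
        simp at this; omega
      · exact (hst _ _ hpq).elim
      · exact (hst _ _ hpq.symm).elim
      · have := E.symm.injective (ht hpq)
        simp at this; omega)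
  let e' : Fin n ≃ X := e.trans (Equiv.subtypeUnivEquiv (by simp))
  have he' : ∀ p : Fin n, p.1 < 2 * M → e' p = h p := fun p hp => he p (by simpa using hp)
  refine ⟨e', fun k => ?_⟩
  have hk := (E k).2
  change (E k).1 < M at hk
  have e1 : e' ⟨2 * (E k).1, by omega⟩ = src k := by
    rw [he' _ (by simp; omega)]
    simp only [h]
    rw [dif_pos (by omega), if_pos (by omega)]
    congr 1
    rw [Equiv.symm_apply_eq]
    ext; simp
  have e2 : e' ⟨2 * (E k).1 + 1, by omega⟩ = tgt k := by
    rw [he' _ (by simp; omega)]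
    simp only [h]
    rw [dif_pos (by omega), if_neg (by omega)]
    congr 1
    rw [Equiv.symm_apply_eq]
    ext; simp; omega
  rw [← e1, Equiv.symm_apply_apply, ← e2]
  congr 1
  ext
  rw [Fin.val_add, Fin.val_one']
  simp only [Nat.add_mod_mod]
  exact Nat.mod_eq_of_lt (by omega)

open Fin.NatCast Fin.CommRing in
lemma minper {X Y : Type*} (n : ℕ) [NeZero n] (e : Fin n ≃ X) (P : X → Y)
    (hP : Function.Injective P) (f : Y → Y) (hf : ∀ x, f (P x) = P (e (e.symm x + 1))) (x : X) :
    Function.minimalPeriod f (P x) = n := by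
  have it : ∀ (m : ℕ), f^[m] (P x) = P (e (e.symm x + (m : Fin n))) := by
    intro m
    induction m with
    | zero => simp
    | succ m ih => rw [Function.iterate_succ_apply', ih, hf]; simp [add_assoc]
  have per : ∀ m, Function.IsPeriodicPt f m (P x) ↔ n ∣ m := by
    intro m
    rw [Function.IsPeriodicPt, Function.IsFixedPt, it, hP.eq_iff, ← Equiv.eq_symm_apply]
    rw [add_eq_left, Fin.natCast_eq_zero]
  refine Nat.dvd_antisymm ?_ ?_
  · exact ((per n).2 dvd_rfl).minimalPeriod_dvd
  · exact (per _).1 (Function.isPeriodicPt_minimalPeriod f _)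

/-- Index type of the points of the orbit. -/
abbrev Idx (N k : ℕ) : Type := Sym2 (Option (Fin N)) ⊕ Fin k

/-- The points of the orbit. -/
def pt {N k : ℕ} (c : Fin N → ℚ) (A : Fin k → Fin N) : Idx N k → (Fin N → ℚ)
  | Sum.inl z => Sym2.lift ⟨bpt c, bpt_symm c⟩ z
  | Sum.inr i => Pi.single (A i) 4

lemma pt_inl {N k : ℕ} (c : Fin N → ℚ) (A : Fin k → Fin N) (a b) :
    pt c A (Sum.inl s(a, b)) = bpt c a b := rfl

lemma bpt_ne {N : ℕ} (c : Fin N → ℚ) (h4 : ∀ i, c i ≠ 4) (a b) (i : Fin N) :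
    bpt c a b i ≠ 4 := by
  rcases a with _ | u <;> rcases b with _ | v <;> simp only [bpt]
  · simp
  · simp only [Pi.single_apply]; split_ifs <;> norm_num
  · simp only [Pi.single_apply]; split_ifs <;> norm_num
  · by_cases h : u = v
    · rw [if_pos h]
      simp only [Pi.single_apply]
      split_ifs
      · exact h4 u
      · norm_num
    · rw [if_neg h]
      simp only [Pi.add_apply, Pi.single_apply]
      split_ifs <;> norm_num

lemma pt_inj {N k : ℕ} (c : Fin N → ℚ) (A : Fin k → Fin N) (hA : Function.Injective A)
    (h0 : ∀ i, c i ≠ 0) (h1 : ∀ i, c i - 1 ≠ 0) (h4 : ∀ i, c i ≠ 4) :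
    Function.Injective (pt c A) := by
  classical
  rintro (z | i) (w | j) h
  · induction z using Sym2.ind with | _ a b => ?_
    induction w using Sym2.ind with | _ a' b' => ?_
    rw [pt_inl, pt_inl] at h
    let g : Option (Fin N) → Option (Fin N) → ℚ := fun u v => if s(u, v) = s(a, b) then 1 else 0
    have hg : ∀ u v, g u v = g v u := fun u v => by simp only [g, Sym2.eq_swap]
    have e1 := interp c h0 h1 g hg a b
    have e2 := interp c h0 h1 g hg a' b'
    rw [h, e2] at e1
    by_contra hne
    have hne' : s(a', b') ≠ s(a, b) := fun h' => hne (by rw [h'])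
    simp [g, -Sym2.eq, hne'] at e1
  · induction z using Sym2.ind with | _ a b => ?_
    exact (bpt_ne c h4 a b (A j) (by rw [← pt_inl c A, h]; simp [pt])).elim
  · induction w using Sym2.ind with | _ a b => ?_
    exact (bpt_ne c h4 a b (A i) (by rw [← pt_inl c A, ← h]; simp [pt])).elim
  · have := congrFun h (A i)
    simp only [pt, Pi.single_apply] at this
    by_cases hij : A i = A j
    · rw [hA hij]
    · simp [hij] at this

lemma main_constr (N : ℕ) (hN : 3 ≤ N) : ∃ (a : Fin N → ℚ) (l : Fin N → Fin N → ℚ)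
    (q : Fin N → Fin N → Fin N → ℚ), (∃ i, a i ≠ 0) ∧
    ∀ t : ℚ, t ≠ 0 → Function.minimalPeriod
      (fun x i => qfun (t * a i) (l i) (fun u v => t⁻¹ * q i u v) x) (fun _ : Fin N => (0 : ℚ)) =
        (N + 1) * (N + 2) / 2 + (N - 1) / 2 := by
  classical
  obtain ⟨k, hk⟩ : ∃ k, k = (N - 1) / 2 := ⟨_, rfl⟩
  let A : Fin k → Fin N := fun i => ⟨i.1, by omega⟩
  let B : Fin k → Fin N := fun i => ⟨k + i.1, by omega⟩
  let L : Fin N := ⟨N - 1, by omega⟩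
  let c : Fin N → ℚ := fun i => if i.1 < k then 3 else 2
  have hA : Function.Injective A := fun i j h => by simpa [A, Fin.ext_iff] using h
  have hB : Function.Injective B := fun i j h => by simpa [B, Fin.ext_iff] using h
  have hAB : ∀ i j, A i ≠ B j := fun i j h => by simp [A, B, Fin.ext_iff] at h; omega
  have hAL : ∀ i, A i ≠ L := fun i h => by simp [A, L, Fin.ext_iff] at h; omega
  have hBL : ∀ i, B i ≠ L := fun i h => by simp [B, L, Fin.ext_iff] at h; omega
  have cA : ∀ i, c (A i) = 3 := fun i => by simp [c, A]
  have cB : ∀ i, c (B i) = 2 := fun i => by simp [c, B]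
  have cL : c L = 2 := by simp only [c, L]; rw [if_neg (by omega)]
  have h0 : ∀ i, c i ≠ 0 := fun i => by simp only [c]; split_ifs <;> norm_num
  have h1 : ∀ i, c i - 1 ≠ 0 := fun i => by simp only [c]; split_ifs <;> norm_num
  have h4 : ∀ i, c i ≠ 4 := fun i => by simp only [c]; split_ifs <;> norm_num
  let src : Option (Fin k ⊕ (Fin k ⊕ Fin k)) → Idx N k
    | none => Sum.inl s(none, none)
    | some (Sum.inl i) => Sum.inl s(none, some (A i))
    | some (Sum.inr (Sum.inl i)) => Sum.inl s(some (A i), some (A i))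
    | some (Sum.inr (Sum.inr i)) => Sum.inr i
  let tgt : Option (Fin k ⊕ (Fin k ⊕ Fin k)) → Idx N k
    | none => Sum.inl s(some L, some L)
    | some (Sum.inl i) => Sum.inl s(some (A i), some L)
    | some (Sum.inr (Sum.inl i)) => Sum.inl s(some (A i), some (B i))
    | some (Sum.inr (Sum.inr i)) => Sum.inl s(some (B i), some (B i))
  have hinj : Function.Injective (Sum.elim src tgt) := by
    rintro ((_ | i | i | i) | (_ | i | i | i)) ((_ | j | j | j) | (_ | j | j | j)) h <;>
    simp [src, tgt, hA.eq_iff, hB.eq_iff, hAB, hAL, hBL, (hAB _ _).symm, (hAL _).symm,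
      (hBL _).symm] at h ⊢ <;> first | exact h | exact h.1 | skip
  obtain ⟨n, hn⟩ : ∃ n, n = (N + 1) * (N + 2) / 2 + (N - 1) / 2 := ⟨_, rfl⟩
  have hcard : Fintype.card (Idx N k) = n := by
    rw [Fintype.card_sum, Sym2.card, Fintype.card_option, Fintype.card_fin, Fintype.card_fin,
      Nat.choose_two_right, hn, hk]
    congr 2
    rw [mul_comm]; rfl
  have hn3 : 1 < n := by
    have : 2 ≤ (N + 1) * (N + 2) / 2 := by
      rw [Nat.le_div_iff_mul_le (by norm_num)]; nlinarith
    omega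
  haveI : NeZero n := ⟨by omega⟩
  obtain ⟨e, he⟩ := cycle_lemma n hcard src tgt hinj
  let S : Idx N k → Idx N k := fun x => e (e.symm x + 1)
  let P := pt c A
  let g : Fin N → Option (Fin N) → Option (Fin N) → ℚ := fun i u v => P (S (Sum.inl s(u, v))) i
  have hg : ∀ i u v, g i u v = g i v u := fun i u v => by simp only [g, Sym2.eq_swap]
  have s0 : S (Sum.inl s(none, none)) = Sum.inl s(some L, some L) := he none
  have s1 : ∀ i, S (Sum.inl s(none, some (A i))) = Sum.inl s(some (A i), some L) :=
    fun i => he (some (Sum.inl i))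
  have s2 : ∀ i, S (Sum.inl s(some (A i), some (A i))) = Sum.inl s(some (A i), some (B i)) :=
    fun i => he (some (Sum.inr (Sum.inl i)))
  have s3 : ∀ i, S (Sum.inr i) = Sum.inl s(some (B i), some (B i)) :=
    fun i => he (some (Sum.inr (Sum.inr i)))
  have key : ∀ x i, qfun (g i none none) (cl c (g i)) (cq c (g i)) (P x) = P (S x) i := by
    rintro (z | j) i
    · induction z using Sym2.ind with | _ a b => ?_
      exact interp c h0 h1 (g i) (hg i) a b
    · refine (extra c (g i) (A j) (cA j)).trans ?_
      simp only [g, s0, s1, s2, s3, P, pt_inl, bpt, hAB, hAL, if_true, if_false, cL, cB,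
        Pi.add_apply, Pi.single_apply]
      split_ifs <;> norm_num
  refine ⟨fun i => g i none none, fun i => cl c (g i), fun i => cq c (g i), ⟨L, ?_⟩, ?_⟩
  · simp [g, s0, P, pt_inl, bpt, cL]
  · intro t ht
    have hPinj : Function.Injective (fun x i => t * P x i) := by
      intro x y hxy
      refine pt_inj c A hA h0 h1 h4 (funext fun i => ?_)
      exact mul_left_cancel₀ ht (congrFun hxy i)
    have := minper n e (fun x i => t * P x i) hPinj
      (fun x i => qfun (t * g i none none) (cl c (g i)) (fun u v => t⁻¹ * cq c (g i) u v) x)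
      (fun x => by
        funext i
        rw [← qfun_scale _ _ _ t ht]
        have : (fun j => t⁻¹ * (t * P x j)) = P x := by
          funext j; field_simp
        rw [this, key]) (Sum.inl s(none, none))
    rw [← hn, ← this]
    congr 1
    funext i
    simp [P, pt_inl, bpt]

/-- For every natural number `N ≥ 3`, the set of quadratic maps `f` on `ℚ^N`
under which the point `0` has minimal period exactly
`(N+1)(N+2)/2 + ⌊(N-1)/2⌋` is infinite. -/
theorem infinite_quadratic_maps_with_period (N : ℕ) (hN : 3 ≤ N) :
    {f : (Fin N → ℚ) → (Fin N → ℚ) |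
      (∀ i : Fin N, ∃ p : MvPolynomial (Fin N) ℚ,
        p.totalDegree ≤ 2 ∧ ∀ x : Fin N → ℚ, f x i = MvPolynomial.eval x p) ∧
      Function.minimalPeriod f (fun _ => 0) =
        (N + 1) * (N + 2) / 2 + (N - 1) / 2}.Infinite := by
  obtain ⟨a, l, q, ⟨i, hi⟩, h⟩ := main_constr N hN
  refine Set.infinite_of_injective_forall_mem (f := fun (m : ℕ) => fun x i =>
    qfun (((m : ℚ) + 1) * a i) (l i) (fun u v => ((m : ℚ) + 1)⁻¹ * q i u v) x) ?_ ?_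
  · intro m m' hm
    have := congrFun (congrFun hm (fun _ => 0)) i
    simp only [qfun, mul_zero, Finset.sum_const_zero, add_zero] at this
    have := mul_right_cancel₀ hi this
    exact_mod_cast add_right_cancel this
  · intro m
    exact ⟨fun j => qfun_poly _ _ _, h _ (by positivity)⟩
end

section
/- For every natural number N ≥ 3 and every integer n with 1 ≤ n ≤ (N+1)(N+2)/2 + ⌊(N-1)/2⌋, there exists a quadratic map f on ℚ^N such that the point 0 = (0,…,0) has minimal period exactly n under f. -/
/-- vertices of the standard simplex, indexed by `0, …, N` -/
def qmV (N m : ℕ) : Fin N → ℚ := fun x => if x.val + 1 = m then 1 else 0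

/-- midpoints -/
def qmM (N i j : ℕ) : Fin N → ℚ := fun x => (qmV N i x + qmV N j x) / 2

/-- extra points -/
def qmW (N l : ℕ) : Fin N → ℚ :=
  fun x => (-(1 / 2)) * qmV N (2 * l) x + (3 / 2) * qmV N (2 * l + 1) x

/-- barycentric coordinates as polynomials -/
noncomputable def qmL (N m : ℕ) : MvPolynomial (Fin N) ℚ :=
  if m = 0 then 1 - ∑ i, MvPolynomial.X i
  else if h : m - 1 < N then MvPolynomial.X ⟨m - 1, h⟩ else 0

lemma qmL_deg (N m : ℕ) : (qmL N m).totalDegree ≤ 1 := by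
  unfold qmL
  split_ifs with h1 h2
  · refine (MvPolynomial.totalDegree_sub _ _).trans ?_
    refine max_le (by simp) ?_
    refine MvPolynomial.totalDegree_finsetSum_le ?_
    intro i _
    simp
  · simp
  · simp

lemma qmL_eval (N m i j : ℕ) (a b : ℚ) (hab : a + b = 1) (hm : m ≤ N) (hi : i ≤ N) (hj : j ≤ N) :
    MvPolynomial.eval (fun x => a * qmV N i x + b * qmV N j x) (qmL N m)
      = a * (if m = i then 1 else 0) + b * (if m = j then 1 else 0) := by
  have key : ∀ i ≤ N, ∑ x : Fin N, qmV N i x = if 0 = i then 0 else 1 := by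
    intro i hi
    unfold qmV
    split_ifs with h
    · subst h; simp
    · have h3 : ∀ x : Fin N, (if x.val + 1 = i then (1:ℚ) else 0)
          = if x = ⟨i - 1, by omega⟩ then 1 else 0 := by
        intro x
        have : (x.val + 1 = i) ↔ x = ⟨i - 1, by omega⟩ := by
          rw [Fin.ext_iff]; simp only []; omega
        simp only [this]
      simp only [h3]
      simp
  unfold qmL
  split_ifs with h1 h2
  all_goals try subst h1
  all_goals try omega
  all_goals try simp only [map_sub, map_one, map_sum, MvPolynomial.eval_X, Finset.sum_add_distrib,
    ← Finset.mul_sum, key i hi, key j hj]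
  all_goals try simp only [qmV]
  all_goals grind

lemma qm_interp (N : ℕ) (Y : ℕ → Fin N → ℚ) (C : ℕ → ℕ → Fin N → ℚ) :
    ∃ f : (Fin N → ℚ) → (Fin N → ℚ),
      (∀ i : Fin N, ∃ p : MvPolynomial (Fin N) ℚ,
        p.totalDegree ≤ 2 ∧ ∀ x : Fin N → ℚ, f x i = MvPolynomial.eval x p) ∧
      (∀ i ≤ N, f (qmV N i) = Y i) ∧
      (∀ i j, i < j → j ≤ N → ∀ a b : ℚ, a + b = 1 →
        f (fun x => a * qmV N i x + b * qmV N j x)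
          = fun x => a * Y i x + b * Y j x + a * b * C i j x) := by
  let p : Fin N → MvPolynomial (Fin N) ℚ := fun x =>
    ∑ i ∈ Finset.range (N + 1), MvPolynomial.C (Y i x) * qmL N i +
    ∑ i ∈ Finset.range (N + 1), ∑ j ∈ Finset.range (N + 1),
      MvPolynomial.C (if i < j then C i j x else 0) * (qmL N i * qmL N j)
  have hmain : ∀ i j, i ≤ N → j ≤ N → ∀ a b : ℚ, a + b = 1 → ∀ x,
      MvPolynomial.eval (fun x => a * qmV N i x + b * qmV N j x) (p x)
        = a * Y i x + b * Y j x + a * b * (if i < j then C i j x else 0)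
          + a * b * (if j < i then C j i x else 0) := by
    intro i j hi hj a b hab x
    simp only [p, map_add, map_sum, map_mul, MvPolynomial.eval_C]
    have e1 : ∀ g : ℕ → ℚ, ∑ m ∈ Finset.range (N + 1), g m *
        MvPolynomial.eval (fun x => a * qmV N i x + b * qmV N j x) (qmL N m) = a * g i + b * g j := by
      intro g
      have : ∀ m ∈ Finset.range (N + 1), g m *
        MvPolynomial.eval (fun x => a * qmV N i x + b * qmV N j x) (qmL N m)
        = (if m = i then a * g m else 0) + (if m = j then b * g m else 0) := by
        intro m hm
        rw [qmL_eval N m i j a b hab (by simp at hm; omega) hi hj]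
        split_ifs <;> ring
      rw [Finset.sum_congr rfl this, Finset.sum_add_distrib, Finset.sum_ite_eq', Finset.sum_ite_eq']
      rw [if_pos (by simp; omega), if_pos (by simp; omega)]
    rw [e1 (fun m => Y m x)]
    have e2 : ∀ m, ∑ m' ∈ Finset.range (N + 1), (if m < m' then C m m' x else 0) *
        (MvPolynomial.eval (fun x => a * qmV N i x + b * qmV N j x) (qmL N m) *
        MvPolynomial.eval (fun x => a * qmV N i x + b * qmV N j x) (qmL N m'))
        = (a * (if m < i then C m i x else 0) + b * (if m < j then C m j x else 0)) *
        MvPolynomial.eval (fun x => a * qmV N i x + b * qmV N j x) (qmL N m) := by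
      intro m
      rw [← e1 (fun m' => if m < m' then C m m' x else 0), Finset.sum_mul]
      refine Finset.sum_congr rfl fun _ _ => by ring
    simp only [e2]
    rw [e1 (fun m => (a * (if m < i then C m i x else 0) + b * (if m < j then C m j x else 0)))]
    simp only [lt_irrefl, if_false]
    ring
  refine ⟨fun y x => MvPolynomial.eval y (p x), fun i => ⟨p i, ?_, fun _ => rfl⟩, ?_, ?_⟩
  · refine (MvPolynomial.totalDegree_add _ _).trans (max_le ?_ ?_)
    · refine MvPolynomial.totalDegree_finsetSum_le fun m _ => ?_
      refine (MvPolynomial.totalDegree_mul _ _).trans ?_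
      have := qmL_deg N m
      simp only [MvPolynomial.totalDegree_C]
      omega
    · refine MvPolynomial.totalDegree_finsetSum_le fun m _ => ?_
      refine MvPolynomial.totalDegree_finsetSum_le fun m' _ => ?_
      refine (MvPolynomial.totalDegree_mul _ _).trans ?_
      have h3 := MvPolynomial.totalDegree_mul (qmL N m) (qmL N m')
      have := qmL_deg N m
      have := qmL_deg N m'
      simp only [MvPolynomial.totalDegree_C]
      omega
  · intro i hi
    funext x
    have := hmain i i hi hi 1 0 (by norm_num) x
    simpa using this
  · intro i j hij hj a b hab
    funext x
    have := hmain i j (by omega) hj a b hab x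
    rw [if_pos hij, if_neg (by omega)] at this
    refine this.trans ?_
    ring

lemma qm_period {α : Type*} (f : α → α) (P : ℕ → α) (n : ℕ) (hn : 1 ≤ n)
    (hinj : ∀ i < n, ∀ j < n, P i = P j → i = j)
    (hf : ∀ i < n, f (P i) = P ((i + 1) % n)) : Function.minimalPeriod f (P 0) = n := by
  have hit : ∀ j, f^[j] (P 0) = P (j % n) := by
    intro j
    induction j with
    | zero => simp
    | succ j ih =>
      rw [Function.iterate_succ_apply', ih, hf _ (Nat.mod_lt _ hn), Nat.mod_add_mod]
  have hp : Function.IsPeriodicPt f n (P 0) := by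
    have := hit n
    rw [Nat.mod_self] at this
    exact this
  have hle := hp.minimalPeriod_le hn
  have hpos := hp.minimalPeriod_pos hn
  by_contra hne
  have h1 : Function.minimalPeriod f (P 0) < n := lt_of_le_of_ne hle hne
  have h2 := hit (Function.minimalPeriod f (P 0))
  rw [Function.iterate_minimalPeriod, Nat.mod_eq_of_lt h1] at h2
  have := hinj 0 hn _ h1 h2
  omega

lemma qm_enum {α : Type*} [DecidableEq α] [Inhabited α] (S : Finset α) (n m : ℕ) (hS : S.card = n)
    (l : ℕ → α) (hl : ∀ i < m, ∀ j < m, l i = l j → i = j) (hlS : ∀ i < m, l i ∈ S) :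
    ∃ P : ℕ → α, m ≤ n ∧ (∀ i < m, P i = l i) ∧ (∀ i < n, ∀ j < n, P i = P j → i = j) ∧
      (∀ s ∈ S, ∃ i < n, P i = s) ∧ (∀ i < n, P i ∈ S) := by
  set I := (Finset.range m).image l with hI
  have hIS : I ⊆ S := by
    intro x hx
    simp only [hI, Finset.mem_image, Finset.mem_range] at hx
    obtain ⟨i, hi, rfl⟩ := hx
    exact hlS i hi
  have hIc : I.card = m := by
    rw [hI, Finset.card_image_of_injOn, Finset.card_range]
    intro i hi j hj h
    simp at hi hj
    exact hl i hi j hj h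
  let L := (List.range m).map l ++ (S \ I).toList
  have hlen : L.length = n := by
    simp only [L, List.length_append, List.length_map, List.length_range, Finset.length_toList]
    rw [Finset.card_sdiff_of_subset hIS]
    have := Finset.card_le_card hIS
    omega
  have hnd : L.Nodup := by
    rw [List.nodup_append]
    refine ⟨?_, Finset.nodup_toList _, ?_⟩
    · refine List.Nodup.map_on ?_ List.nodup_range
      intro i hi j hj h
      simp at hi hj
      exact hl i hi j hj h
    · intro a ha b hb hab
      subst hab
      simp only [Finset.mem_toList, Finset.mem_sdiff, hI, Finset.mem_image, Finset.mem_range] at hb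
      simp only [List.mem_map, List.mem_range] at ha
      exact hb.2 ha
  have hmem : ∀ s, s ∈ L ↔ s ∈ S := by
    intro s
    have h1 : s ∈ L ↔ s ∈ I ∨ s ∈ S \ I := by
      simp [L, hI]
    rw [h1, Finset.mem_sdiff]
    constructor
    · rintro (h | h)
      · exact hIS h
      · exact h.1
    · intro h
      tauto
  have hget : ∀ i (h : i < n), L.getD i default = L[i]'(by omega) := by
    intro i h
    rw [List.getD_eq_getElem]
  refine ⟨fun i => L.getD i default, ?_, ?_, ?_, ?_, ?_⟩
  · rw [← hIc, ← hS]; exact Finset.card_le_card hIS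
  · intro i hi
    have : i < n := by
      have := Finset.card_le_card hIS
      omega
    simp only []
    rw [hget i this]
    simp only [L]
    rw [List.getElem_append_left (by simpa using hi)]
    simp
  · intro i hi j hj h
    simp only [] at h
    rw [hget i hi, hget j hj] at h
    exact (hnd.getElem_inj_iff).1 h
  · intro s hs
    obtain ⟨i, hi, h⟩ := List.getElem_of_mem ((hmem s).2 hs)
    exact ⟨i, by omega, by simp only []; rw [hget i (by omega)]; exact h⟩
  · intro i hi
    simp only []
    rw [hget i hi, ← hmem]
    exact List.getElem_mem _

/-- Combination: an enumeration together with its successor function. -/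
lemma qm_succ {α : Type*} [DecidableEq α] [Inhabited α] (S : Finset α) (n m : ℕ) (hS : S.card = n)
    (hm : 1 ≤ m)
    (l : ℕ → α) (hl : ∀ i < m, ∀ j < m, l i = l j → i = j) (hlS : ∀ i < m, l i ∈ S) :
    ∃ G : α → α, (∀ i, i + 1 < m → G (l i) = l (i + 1)) ∧
      ∀ f : α → α, (∀ s ∈ S, f s = G s) → Function.minimalPeriod f (l 0) = n := by
  obtain ⟨P, hmn, hPl, hPi, hPs, hPS⟩ := qm_enum S n m hS l hl hlS
  have hex : ∀ s, ∃ t, ∀ i < n, P i = s → t = P ((i + 1) % n) := by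
    intro s
    by_cases h : ∃ i < n, P i = s
    · obtain ⟨i, hi, rfl⟩ := h
      exact ⟨P ((i + 1) % n), fun j hj h => by rw [hPi j hj i hi h]⟩
    · exact ⟨s, fun i hi h' => absurd ⟨i, hi, h'⟩ h⟩
  choose G hG using hex
  refine ⟨G, ?_, ?_⟩
  · intro i hi
    rw [hG (l i) i (by omega) (hPl i (by omega)), Nat.mod_eq_of_lt (by omega), hPl _ hi]
  · intro f hf
    rw [← hPl 0 (by omega)]
    refine qm_period f P n (by omega) hPi ?_
    intro i hi
    rw [hf _ (hPS i hi), hG _ i hi rfl]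

lemma qmM_eval (N m i j : ℕ) (hm : m ≤ N) (hi : i ≤ N) (hj : j ≤ N) :
    MvPolynomial.eval (qmM N i j) (qmL N m)
      = (1 / 2) * (if m = i then 1 else 0) + (1 / 2) * (if m = j then 1 else 0) := by
  rw [← qmL_eval N m i j (1 / 2) (1 / 2) (by norm_num) hm hi hj]
  congr 2
  funext x
  simp only [qmM]
  ring

lemma qmW_eval (N m l : ℕ) (hm : m ≤ N) (hl : 2 * l + 1 ≤ N) :
    MvPolynomial.eval (qmW N l) (qmL N m)
      = (-(1 / 2)) * (if m = 2 * l then 1 else 0) + (3 / 2) * (if m = 2 * l + 1 then 1 else 0) :=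
  qmL_eval N m (2 * l) (2 * l + 1) (-(1 / 2)) (3 / 2) (by norm_num) hm (by omega) hl

lemma qmM_inj (N i j i' j' : ℕ) (hij : i ≤ j) (hj : j ≤ N) (hij' : i' ≤ j') (hj' : j' ≤ N)
    (h : qmM N i j = qmM N i' j') : i = i' ∧ j = j' := by
  have key : ∀ m ≤ N, (1 / 2 : ℚ) * (if m = i then 1 else 0) + (1 / 2) * (if m = j then 1 else 0)
      = (1 / 2) * (if m = i' then 1 else 0) + (1 / 2) * (if m = j' then 1 else 0) := by
    intro m hm
    rw [← qmM_eval N m i j hm (by omega) hj, ← qmM_eval N m i' j' hm (by omega) hj', h]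
  have key2 : ∀ m ≤ N, (if m = i then 1 else 0) + (if m = j then 1 else 0)
      = (if m = i' then 1 else 0) + (if m = j' then 1 else 0) := by
    intro m hm
    have h1 := key m hm
    rw [← mul_add, ← mul_add] at h1
    have h2 := mul_left_cancel₀ (by norm_num) h1
    exact_mod_cast h2
  have h1 := key2 i (by omega)
  have h2 := key2 j (by omega)
  have h3 := key2 i' (by omega)
  have h4 := key2 j' (by omega)
  clear key key2 h
  grind

lemma qmW_inj (N l l' : ℕ) (hl : 2 * l + 1 ≤ N) (hl' : 2 * l' + 1 ≤ N)
    (h : qmW N l = qmW N l') : l = l' := by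
  have h1 := qmW_eval N (2 * l) l (by omega) hl
  rw [h, qmW_eval N (2 * l) l' (by omega) hl'] at h1
  by_contra hne
  split_ifs at h1 <;> first | omega | (norm_num at h1)

lemma qmMW_ne (N i j l : ℕ) (hi : i ≤ N) (hj : j ≤ N) (hl : 2 * l + 1 ≤ N) :
    qmM N i j ≠ qmW N l := by
  intro h
  have h1 := qmW_eval N (2 * l) l (by omega) hl
  rw [← h, qmM_eval N (2 * l) i j (by omega) hi hj] at h1
  split_ifs at h1 <;> first | omega | (norm_num at h1)

/-- index set of pairs -/
def qmT (N : ℕ) : Finset (ℕ × ℕ) :=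
  (Finset.range (N + 1) ×ˢ Finset.range (N + 1)).filter (fun p => p.1 ≤ p.2)

lemma qmT_mem (N : ℕ) (p : ℕ × ℕ) : p ∈ qmT N ↔ p.1 ≤ p.2 ∧ p.2 ≤ N := by
  simp only [qmT, Finset.mem_filter, Finset.mem_product, Finset.mem_range]
  omega

lemma qmT_card (N : ℕ) : (qmT N).card = (N + 1) * (N + 2) / 2 := by
  have h : (qmT N) = ((Finset.range (N + 1)).sigma (fun j => Finset.range (j + 1))).image
      (fun s => (s.2, s.1)) := by
    ext ⟨a, b⟩
    rw [qmT_mem]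
    simp only [Finset.mem_image, Finset.mem_sigma, Finset.mem_range, Prod.mk.injEq, Sigma.exists]
    constructor
    · intro h
      exact ⟨b, a, by omega, rfl, rfl⟩
    · rintro ⟨b', a', h, rfl, rfl⟩
      omega
  rw [h, Finset.card_image_of_injective, Finset.card_sigma]
  · simp only [Finset.card_range]
    have : ∀ M : ℕ, (∑ j ∈ Finset.range M, (j + 1)) * 2 = M * (M + 1) := by
      intro M
      induction M with
      | zero => simp
      | succ M ih => rw [Finset.sum_range_succ, add_mul, ih]; ring
    have := this (N + 1)
    rw [show N + 2 = N + 1 + 1 from rfl]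
    omega
  · rintro ⟨a, b⟩ ⟨c, d⟩ h
    simp at h
    simp [h.1, h.2]

lemma qmM_self (N i : ℕ) : qmM N i i = qmV N i := by
  funext x; simp [qmM]

lemma qmM_form (N i j : ℕ) :
    qmM N i j = fun x => (1 / 2) * qmV N i x + (1 / 2) * qmV N j x := by
  funext x; simp only [qmM]; ring

lemma qmV_zero (N : ℕ) : qmV N 0 = fun _ => 0 := by
  funext x; simp [qmV]

lemma qm_small (N n : ℕ) (hn : 1 ≤ n) (hn' : n ≤ (N + 1) * (N + 2) / 2) :
    ∃ f : (Fin N → ℚ) → (Fin N → ℚ),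
      (∀ i : Fin N, ∃ p : MvPolynomial (Fin N) ℚ,
        p.totalDegree ≤ 2 ∧ ∀ x : Fin N → ℚ, f x i = MvPolynomial.eval x p) ∧
      Function.minimalPeriod f (fun _ => 0) = n := by
  classical
  obtain ⟨T, hT0, hT1, hTc⟩ := Finset.exists_subsuperset_card_eq (n := n)
    (s := {((0 : ℕ), (0 : ℕ))}) (t := qmT N)
    (by simp [qmT_mem]) (by simpa using hn) (by rw [qmT_card]; exact hn')
  let S := T.image (fun p => qmM N p.1 p.2)
  have hS : S.card = n := by
    rw [← hTc]
    refine Finset.card_image_of_injOn ?_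
    intro p hp q hq h
    have h1 := (qmT_mem N p).1 (hT1 hp)
    have h2 := (qmT_mem N q).1 (hT1 hq)
    have := qmM_inj N _ _ _ _ h1.1 h1.2 h2.1 h2.2 h
    exact Prod.ext this.1 this.2
  obtain ⟨G, -, hG⟩ := qm_succ S n 1 hS le_rfl (fun _ => qmM N 0 0) (by omega) (by
    intro i _
    refine Finset.mem_image.2 ⟨(0, 0), hT0 (by simp), rfl⟩)
  obtain ⟨f, hf, hV, hE⟩ := qm_interp N (fun i => G (qmV N i))
    (fun i j x => 4 * (G (qmM N i j) x - (G (qmV N i) x + G (qmV N j) x) / 2))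
  refine ⟨f, hf, ?_⟩
  have := hG f ?_
  · simpa only [qmM_self, qmV_zero] using this
  · intro s hs
    obtain ⟨p, hp, rfl⟩ := Finset.mem_image.1 hs
    have h1 := (qmT_mem N p).1 (hT1 hp)
    obtain ⟨i, j⟩ := p
    simp only [] at h1 ⊢
    rcases Nat.lt_or_ge i j with h | h
    · have := hE i j h h1.2 (1 / 2) (1 / 2) (by norm_num)
      rw [← qmM_form] at this
      rw [this]
      funext x
      ring
    · have : i = j := by omega
      subst this
      rw [qmM_self, hV i h1.2]

/-- first index of the chain -/
def qmA (k i : ℕ) : ℕ :=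
  if i < k + 1 then 2 * i
  else if i < 2 * (k + 1) then (if i - (k + 1) < k then 2 * (i - (k + 1)) else 0)
  else (if i - 2 * (k + 1) < k then 2 * (i - 2 * (k + 1)) + 1 else 0)

/-- second index of the chain -/
def qmB (k i : ℕ) : ℕ :=
  if i < k + 1 then 2 * i
  else if i < 2 * (k + 1) then (if i - (k + 1) < k then 2 * (i - (k + 1)) + 1 else 2 * k)
  else (if i - 2 * (k + 1) < k then 2 * (i - 2 * (k + 1)) + 1 else 2 * k + 1)

lemma qm_big (N k : ℕ) (hk : 1 ≤ k) (hkN : 2 * k + 1 ≤ N) :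
    ∃ f : (Fin N → ℚ) → (Fin N → ℚ),
      (∀ i : Fin N, ∃ p : MvPolynomial (Fin N) ℚ,
        p.totalDegree ≤ 2 ∧ ∀ x : Fin N → ℚ, f x i = MvPolynomial.eval x p) ∧
      Function.minimalPeriod f (fun _ => 0) = (N + 1) * (N + 2) / 2 + k := by
  classical
  let T := (qmT N).erase (2 * k, 2 * k + 1)
  have hTm : ∀ i j, (i, j) ∈ T ↔ (i ≤ j ∧ j ≤ N) ∧ ¬ (i = 2 * k ∧ j = 2 * k + 1) := by
    intro i j
    simp only [T, Finset.mem_erase, qmT_mem, ne_eq, Prod.mk.injEq]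
    tauto
  let S1 := T.image (fun p => qmM N p.1 p.2)
  let S2 := (Finset.range (k + 1)).image (fun l => qmW N l)
  have hS1 : S1.card = (N + 1) * (N + 2) / 2 - 1 := by
    rw [← qmT_card, ← Finset.card_erase_of_mem (a := (2 * k, 2 * k + 1))
      (by rw [qmT_mem]; simp only []; omega)]
    refine Finset.card_image_of_injOn ?_
    rintro ⟨i, j⟩ hp ⟨i', j'⟩ hq h
    have h1 := (hTm i j).1 hp
    have h2 := (hTm i' j').1 hq
    have := qmM_inj N _ _ _ _ h1.1.1 h1.1.2 h2.1.1 h2.1.2 h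
    exact Prod.ext this.1 this.2
  have hS2 : S2.card = k + 1 := by
    rw [← Finset.card_range (k + 1)]
    refine Finset.card_image_of_injOn ?_
    intro l hl l' hl' h
    simp at hl hl'
    exact qmW_inj N l l' (by omega) (by omega) h
  have hdis : Disjoint S1 S2 := by
    rw [Finset.disjoint_left]
    intro s h1 h2
    obtain ⟨⟨i, j⟩, hp, rfl⟩ := Finset.mem_image.1 h1
    obtain ⟨l, hl, h⟩ := Finset.mem_image.1 h2
    have h1 := (hTm i j).1 hp
    simp at hl
    exact qmMW_ne N i j l (by omega) (by omega) (by omega) h.symm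
  have hS : (S1 ∪ S2).card = (N + 1) * (N + 2) / 2 + k := by
    rw [Finset.card_union_of_disjoint hdis, hS1, hS2]
    have : 1 ≤ (N + 1) * (N + 2) / 2 := by
      rw [Nat.le_div_iff_mul_le (by norm_num)]
      nlinarith
    omega
  let l : ℕ → Fin N → ℚ := fun i => if i < 3 * (k + 1) then qmM N (qmA k i) (qmB k i)
    else qmW N (i - 3 * (k + 1))
  have hAB : ∀ i, i < 3 * (k + 1) → (qmA k i, qmB k i) ∈ T := by
    intro i hi
    rw [hTm]
    unfold qmA qmB
    split_ifs <;> omega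
  have hABinj : ∀ i < 3 * (k + 1), ∀ j < 3 * (k + 1), qmA k i = qmA k j → qmB k i = qmB k j →
      i = j := by
    intro i hi j hj h1 h2
    unfold qmA at h1
    unfold qmB at h2
    split_ifs at h1 h2 <;> omega
  have hl : ∀ i < 4 * (k + 1), ∀ j < 4 * (k + 1), l i = l j → i = j := by
    intro i hi j hj h
    simp only [l] at h
    split_ifs at h with h1 h2 h2
    · have a1 := (hTm _ _).1 (hAB i h1)
      have a2 := (hTm _ _).1 (hAB j h2)
      have := qmM_inj N _ _ _ _ a1.1.1 a1.1.2 a2.1.1 a2.1.2 h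
      exact hABinj i h1 j h2 this.1 this.2
    · have a1 := (hTm _ _).1 (hAB i h1)
      exact absurd h (qmMW_ne N _ _ _ (by omega) (by omega) (by omega))
    · have a1 := (hTm _ _).1 (hAB j h2)
      exact absurd h.symm (qmMW_ne N _ _ _ (by omega) (by omega) (by omega))
    · have := qmW_inj N _ _ (by omega) (by omega) h
      omega
  have hlS : ∀ i < 4 * (k + 1), l i ∈ S1 ∪ S2 := by
    intro i hi
    simp only [l]
    rw [Finset.mem_union]
    split_ifs with h
    · left
      exact Finset.mem_image.2 ⟨_, hAB i h, rfl⟩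
    · right
      exact Finset.mem_image.2 ⟨i - 3 * (k + 1), by simp; omega, rfl⟩
  obtain ⟨G, hGl, hG⟩ := qm_succ (S1 ∪ S2) _ (4 * (k + 1)) hS (by omega) l hl hlS
  -- values on the chains
  have gA : ∀ j < k, G (qmV N (2 * j)) = qmV N (2 * (j + 1)) := by
    intro j hj
    have h := hGl j (by omega)
    simp only [l] at h
    rw [if_pos (by omega), if_pos (by omega)] at h
    have a1 : ∀ i < k + 1, qmA k i = 2 * i := fun i hi => by unfold qmA; rw [if_pos hi]
    have a2 : ∀ i < k + 1, qmB k i = 2 * i := fun i hi => by unfold qmB; rw [if_pos hi]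
    rw [a1 j (by omega), a2 j (by omega), a1 (j + 1) (by omega), a2 (j + 1) (by omega),
      qmM_self, qmM_self] at h
    exact h
  have gM : ∀ j < k, G (qmM N (2 * j) (2 * j + 1)) =
      if j + 1 < k then qmM N (2 * (j + 1)) (2 * (j + 1) + 1) else qmM N 0 (2 * k) := by
    intro j hj
    have h := hGl (j + (k + 1)) (by omega)
    have a1 : qmA k (j + (k + 1)) = 2 * j := by unfold qmA; split_ifs <;> omega
    have a2 : qmB k (j + (k + 1)) = 2 * j + 1 := by unfold qmB; split_ifs <;> omega
    simp only [l] at h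
    rw [if_pos (by omega), if_pos (by omega), a1, a2] at h
    rw [h]
    split_ifs with h'
    · congr 1
      · unfold qmA; split_ifs <;> omega
      · unfold qmB; split_ifs <;> omega
    · congr 1
      · unfold qmA; split_ifs <;> omega
      · unfold qmB; split_ifs <;> omega
  have gB : ∀ j < k, G (qmV N (2 * j + 1)) =
      if j + 1 < k then qmV N (2 * (j + 1) + 1) else qmM N 0 (2 * k + 1) := by
    intro j hj
    have h := hGl (j + 2 * (k + 1)) (by omega)
    have a1 : qmA k (j + 2 * (k + 1)) = 2 * j + 1 := by unfold qmA; split_ifs <;> omega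
    have a2 : qmB k (j + 2 * (k + 1)) = 2 * j + 1 := by unfold qmB; split_ifs <;> omega
    simp only [l] at h
    rw [if_pos (by omega), if_pos (by omega), a1, a2, qmM_self] at h
    rw [h]
    split_ifs with h'
    · rw [← qmM_self]
      congr 1
      · unfold qmA; split_ifs <;> omega
      · unfold qmB; split_ifs <;> omega
    · congr 1
      · unfold qmA; split_ifs <;> omega
      · unfold qmB; split_ifs <;> omega
  have gW : ∀ j < k, G (qmW N j) = qmW N (j + 1) := by
    intro j hj
    have h := hGl (j + 3 * (k + 1)) (by omega)
    simp only [l] at h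
    rw [if_neg (by omega), if_neg (by omega)] at h
    rw [show j + 3 * (k + 1) - 3 * (k + 1) = j by omega,
      show j + 3 * (k + 1) + 1 - 3 * (k + 1) = j + 1 by omega] at h
    exact h
  obtain ⟨f, hf, hV, hE⟩ := qm_interp N (fun i => G (qmV N i))
    (fun i j x => if i = 2 * k ∧ j = 2 * k + 1 then
        -(4 / 3) * (G (qmW N k) x + (1 / 2) * G (qmV N (2 * k)) x
          - (3 / 2) * G (qmV N (2 * k + 1)) x)
      else 4 * (G (qmM N i j) x - (G (qmV N i) x + G (qmV N j) x) / 2))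
  refine ⟨f, hf, ?_⟩
  have hfin := hG f ?_
  · have l0 : l 0 = fun _ => 0 := by
      simp only [l]
      rw [if_pos (by omega)]
      have a1 : qmA k 0 = 0 := by simp [qmA]
      have a2 : qmB k 0 = 0 := by simp [qmB]
      rw [a1, a2, qmM_self, qmV_zero]
    rw [l0] at hfin
    exact hfin
  · intro s hs
    rcases Finset.mem_union.1 hs with hs | hs
    · obtain ⟨⟨i, j⟩, hp, rfl⟩ := Finset.mem_image.1 hs
      have h1 := (hTm i j).1 hp
      simp only []
      rcases Nat.lt_or_ge i j with h | h
      · have := hE i j h h1.1.2 (1 / 2) (1 / 2) (by norm_num)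
        rw [← qmM_form] at this
        rw [this]
        funext x
        rw [if_neg h1.2]
        ring
      · have : i = j := by omega
        subst this
        rw [qmM_self, hV i h1.1.2]
    · obtain ⟨j, hj, rfl⟩ := Finset.mem_image.1 hs
      simp only [Finset.mem_range] at hj
      have := hE (2 * j) (2 * j + 1) (by omega) (by omega) (-(1 / 2)) (3 / 2) (by norm_num)
      change f (qmW N j) = _ at this
      rw [this]
      funext x
      by_cases hjk : j = k
      · subst hjk
        rw [if_pos ⟨rfl, rfl⟩]
        ring
      · have hjk' : j < k := by omega
        rw [if_neg (by omega), gA j hjk', gB j hjk', gM j hjk', gW j hjk']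
        split_ifs with h
        · simp only [qmW, qmM]
          ring
        · have : k = j + 1 := by omega
          subst this
          simp only [qmW, qmM]
          ring

/-- For every natural number `N ≥ 3` and every `1 ≤ n ≤ (N+1)(N+2)/2 + ⌊(N-1)/2⌋`,
there exists a quadratic map `f` on `ℚ^N` such that the point `0` has minimal
period exactly `n` under `f`. -/
theorem exists_quadratic_map_with_each_smaller_period (N : ℕ) (hN : 3 ≤ N)
    (n : ℕ) (hn : 1 ≤ n) (hn' : n ≤ (N + 1) * (N + 2) / 2 + (N - 1) / 2) :
    ∃ f : (Fin N → ℚ) → (Fin N → ℚ),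
      (∀ i : Fin N, ∃ p : MvPolynomial (Fin N) ℚ,
        p.totalDegree ≤ 2 ∧ ∀ x : Fin N → ℚ, f x i = MvPolynomial.eval x p) ∧
      Function.minimalPeriod f (fun _ => 0) = n := by
  rcases Nat.lt_or_ge ((N + 1) * (N + 2) / 2) n with h | h
  · obtain ⟨k, rfl⟩ := Nat.exists_eq_add_of_le h.le
    exact qm_big N k (by omega) (by omega)
  · exact qm_small N n hn h
end

section
/- For every natural number N ≥ 3, there exist homogeneous quadratic forms F_0, …, F_{N-1} in MvPolynomial (Fin (N+1)) ℚ such that (i) the forms F_0, …, F_{N-1} together with X_N^2 have no common zero in ℂ^{N+1} other than the origin (after mapping coefficients into ℂ), and (ii) the point 0 = (0,…,0) ∈ ℚ^N has minimal period exactly (N+1)(N+2)/2 + ⌊(N-1)/2⌋ under the affine map f whose i-th coordinate is x ↦ F_i(x_0, …, x_{N-1}, 1). -/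
namespace QP
/-- labels of the orbit points -/
inductive Lab (m : ℕ) : Type
  | O : Lab m
  | E0 : Lab m
  | T0 : Lab m
  | E (c : Fin m) : Lab m
  | T (c : Fin m) : Lab m
  | P0 (c : Fin m) : Lab m
  | P (p : {p : Fin m × Fin m // p.2 < p.1}) : Lab m
  | Q (c : {c : Fin m // c.val < m / 2}) : Lab m

def blk {m : ℕ} (c : Fin m) : List (Lab m) :=
  (if h : c.val < m / 2 then [Lab.Q ⟨c, h⟩] else []) ++ [Lab.T c, Lab.E c, Lab.P0 c]

noncomputable def orb (m : ℕ) : List (Lab m) :=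
  [Lab.T0, Lab.O, Lab.E0] ++ ((List.finRange m).flatMap blk ++
    (Finset.univ : Finset {p : Fin m × Fin m // p.2 < p.1}).toList.map Lab.P)

lemma mem_blk {m : ℕ} (c : Fin m) (x : Lab m) : x ∈ blk c ↔
    (∃ h : c.val < m / 2, x = Lab.Q ⟨c, h⟩) ∨ x = Lab.T c ∨ x = Lab.E c ∨ x = Lab.P0 c := by
  unfold blk
  split_ifs with h <;> simp [h]

lemma mem_orb {m : ℕ} (x : Lab m) : x ∈ orb m := by
  rcases x with _ | _ | _ | c | c | c | p | c <;> simp [orb, mem_blk]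
  exact ⟨c.1, c.2, rfl⟩

lemma nodup_orb (m : ℕ) : (orb m).Nodup := by
  unfold orb
  rw [List.nodup_append, List.nodup_append, List.nodup_flatMap]
  refine ⟨by simp, ⟨⟨?_, ?_⟩, ?_, ?_⟩, ?_⟩
  · intro c _
    unfold blk
    split_ifs <;> simp
  · refine (List.nodup_finRange m).imp ?_
    intro a b hab x hx hy
    rw [mem_blk] at hx hy
    rcases hx with ⟨_, rfl⟩ | rfl | rfl | rfl <;> simp_all
  · refine (Finset.nodup_toList _).map ?_
    intro a b h
    simpa using h
  · intro a ha b hb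
    simp only [List.mem_flatMap, mem_blk, List.mem_map] at ha hb
    obtain ⟨c, -, ⟨_, rfl⟩ | rfl | rfl | rfl⟩ := ha <;> obtain ⟨p, _, rfl⟩ := hb <;> simp
  · intro a ha b hb
    simp only [List.mem_append, List.mem_flatMap, mem_blk, List.mem_map] at hb
    simp only [List.mem_cons, List.not_mem_nil, or_false] at ha
    obtain ⟨c, -, ⟨_, rfl⟩ | rfl | rfl | rfl⟩ | ⟨p, _, rfl⟩ := hb <;>
      rcases ha with rfl | rfl | rfl <;> simp

lemma card_pairs (m : ℕ) : Fintype.card {p : Fin m × Fin m // p.2 < p.1} = m * (m - 1) / 2 := by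
  have e : {p : Fin m × Fin m // p.2 < p.1} ≃ (Σ c : Fin m, Fin c.val) :=
    { toFun := fun p => ⟨p.1.1, ⟨p.1.2.val, p.2⟩⟩
      invFun := fun s => ⟨(s.1, ⟨s.2.val, s.2.2.trans s.1.2⟩), s.2.2⟩
      left_inv := fun p => rfl
      right_inv := fun s => rfl }
  rw [Fintype.card_congr e, Fintype.card_sigma]
  simp only [Fintype.card_fin]
  rw [Fin.sum_univ_eq_sum_range (fun i => i) m, Finset.sum_range_id]

lemma length_orb (m : ℕ) :
    (orb m).length = (m + 1 + 1) * (m + 1 + 2) / 2 + (m + 1 - 1) / 2 := by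
  have h1 : ∀ c : Fin m, (blk c).length = (if c.val < m / 2 then 1 else 0) + 3 := by
    intro c
    unfold blk
    split_ifs <;> simp
  have h2 : ((List.finRange m).flatMap blk).length = m / 2 + m * 3 := by
    rw [List.length_flatMap]
    rw [show (List.map (fun a => (blk a).length) (List.finRange m)).sum
      = ∑ c : Fin m, (blk c).length by rw [← List.ofFn_eq_map, List.sum_ofFn]]
    simp only [h1, Finset.sum_add_distrib, Finset.sum_boole, Fin.card_filter_val_lt]
    simp
    omega
  unfold orb
  rw [List.length_append, List.length_append, h2]
  simp only [List.length_map, Finset.length_toList, Finset.card_univ, card_pairs]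
  simp only [List.length_cons, List.length_nil]
  obtain ⟨t, ht⟩ : ∃ t, m * (m - 1) = 2 * t := (Nat.even_mul_pred_self m).two_dvd
  have : (m + 1 + 1) * (m + 1 + 2) = 2 * (t + 3 * m + 3) := by
    cases m with
    | zero => simp at ht ⊢; omega
    | succ n => simp at ht; nlinarith
  rw [this, ht]
  omega

open Classical in
noncomputable def tau (m : ℕ) : Equiv.Perm (Lab m) := (orb m).formPerm

lemma tau_of_split {m : ℕ} (x y : Lab m) (l₁ l₂ : List (Lab m))
    (h : orb m = l₁ ++ x :: y :: l₂) : tau m x = y := by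
  classical
  have hn := nodup_orb m
  have hlen : l₁.length + 1 < (orb m).length := by rw [h]; simp
  have := List.formPerm_apply_lt_getElem (orb m) hn l₁.length hlen
  unfold tau
  convert this using 2
  · simp [h]
  · simp [h]

lemma tau_T0 (m : ℕ) : tau m Lab.T0 = Lab.O := tau_of_split _ _ [] _ rfl
lemma tau_O (m : ℕ) : tau m Lab.O = Lab.E0 := tau_of_split _ _ [Lab.T0] _ rfl

lemma blk_split {m : ℕ} (c : Fin m) : ∃ l₁ l₂, orb m = l₁ ++ blk c ++ l₂ := by
  obtain ⟨a, b, hab⟩ := List.append_of_mem (List.mem_finRange c)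
  unfold orb
  rw [hab, List.flatMap_append, List.flatMap_cons]
  exact ⟨[Lab.T0, Lab.O, Lab.E0] ++ a.flatMap blk, _, by simp only [List.append_assoc]; rfl⟩

lemma blk_split' {m : ℕ} (c : Fin m) :
    ∃ l₁ l₂, orb m = l₁ ++ [Lab.T c, Lab.E c, Lab.P0 c] ++ l₂ := by
  obtain ⟨a, b, hab⟩ := blk_split c
  unfold blk at hab
  exact ⟨_, _, hab.trans (by rw [← List.append_assoc])⟩

lemma tau_T {m : ℕ} (c : Fin m) : tau m (Lab.T c) = Lab.E c := by
  obtain ⟨a, b, hab⟩ := blk_split' c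
  exact tau_of_split _ _ a (Lab.P0 c :: b) (by rw [hab]; simp)

lemma tau_E {m : ℕ} (c : Fin m) : tau m (Lab.E c) = Lab.P0 c := by
  obtain ⟨a, b, hab⟩ := blk_split' c
  exact tau_of_split _ _ (a ++ [Lab.T c]) b (by rw [hab]; simp)

lemma tau_Q {m : ℕ} (c : {c : Fin m // c.val < m / 2}) : tau m (Lab.Q c) = Lab.T c.1 := by
  obtain ⟨a, b, hab⟩ := blk_split c.1
  exact tau_of_split _ _ a ([Lab.E c.1, Lab.P0 c.1] ++ b) (by rw [hab]; simp [blk, c.2])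

lemma tau_period {m : ℕ} (x : Lab m) :
    Function.minimalPeriod (tau m) x = (orb m).length := by
  classical
  obtain ⟨j, hj, rfl⟩ := List.getElem_of_mem (mem_orb x)
  have hn := nodup_orb m
  have hpow : ∀ i : ℕ, (tau m)^[i] ((orb m)[j]) =
      (orb m)[(j + i) % (orb m).length]'(Nat.mod_lt _ (by omega)) := by
    intro i
    rw [← List.formPerm_pow_apply_getElem (orb m) hn i j hj, ← Equiv.Perm.iterate_eq_pow]
    unfold tau
    congr!
  have key : ∀ i : ℕ, Function.IsPeriodicPt (tau m) i ((orb m)[j]) ↔ (orb m).length ∣ i := by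
    intro i
    unfold Function.IsPeriodicPt Function.IsFixedPt
    rw [hpow, hn.getElem_inj_iff]
    constructor
    · intro h
      have h1 : (j + i) ≡ j + 0 [MOD (orb m).length] := by
        unfold Nat.ModEq; rw [h, add_zero, Nat.mod_eq_of_lt hj]
      exact (Nat.modEq_zero_iff_dvd).1 (Nat.ModEq.add_left_cancel' _ h1)
    · rintro ⟨t, rfl⟩
      rw [Nat.add_mul_mod_self_left, Nat.mod_eq_of_lt hj]
  apply Nat.dvd_antisymm
  · exact ((key _).2 dvd_rfl).minimalPeriod_dvd
  · exact (key _).1 (Function.isPeriodicPt_minimalPeriod _ _)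

/-- first coordinate of a point -/
def pa {m : ℕ} (r : ℚ) : Lab m → ℚ
  | .O => 0 | .E0 => 1 | .T0 => r | .E _ => 0 | .T _ => 0 | .P0 _ => 1 | .P _ => 0 | .Q _ => 0

/-- the other coordinates of a point -/
def pv {m : ℕ} (r u : ℚ) : Lab m → Fin m → ℚ
  | .O => 0
  | .E0 => 0
  | .T0 => 0
  | .E c => Pi.single c 1
  | .T c => Pi.single c r
  | .P0 c => Pi.single c u
  | .P p => Pi.single p.1.1 1 + Pi.single p.1.2 1
  | .Q c => Pi.single c.1 (1 - r)

def pt {m : ℕ} (r u : ℚ) (x : Lab m) : Fin (m + 1) → ℚ := Fin.cons (pa r x) (pv r u x)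

lemma pt_inj {m : ℕ} (r u : ℚ) (hr : 0 < r) (hr' : r < 1 / 4) (hu : u ≤ -1) :
    Function.Injective (pt (m := m) r u) := by
  intro x y h
  have h0 : pa r x = pa r y := by have := congrFun h 0; simpa [pt] using this
  have hv : pv r u x = pv r u y := by
    funext c; have := congrFun h c.succ; simpa [pt] using this
  have hs : ∑ c, pv r u x c = ∑ c, pv r u y c := by rw [hv]
  have hsing : ∀ (s : ℚ) (_ : s ≠ 0) (c d : Fin m),
      (Pi.single c s : Fin m → ℚ) = Pi.single d s → c = d := by
    intro s hs c d hcd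
    by_contra hne
    have := congrFun hcd c
    rw [Pi.single_eq_same, Pi.single_eq_of_ne hne] at this
    exact hs this
  rcases x with _ | _ | _ | c | c | c | p | c <;> rcases y with _ | _ | _ | d | d | d | q | d <;>
    simp [pa, pv, Finset.sum_add_distrib] at h0 hs <;> try first | rfl | (exfalso; linarith)
  · rw [hsing _ one_ne_zero c d hv]
  · rw [hsing _ hr.ne' c d hv]
  · rw [hsing _ (by linarith) c d hv]
  · obtain ⟨⟨a, b⟩, hab⟩ := p
    obtain ⟨⟨a', b'⟩, hab'⟩ := q
    simp only [pv] at hv hab hab'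
    have e1 := congrFun hv a
    have e2 := congrFun hv b
    simp only [Pi.add_apply, Pi.single_apply] at e1 e2
    have hne : a ≠ b := hab.ne'
    have hne' : a' ≠ b' := hab'.ne'
    have k1 : a = a' ∨ a = b' := by
      by_contra hc
      push Not at hc
      simp [hc.1, hc.2, hne] at e1
    have k2 : b = a' ∨ b = b' := by
      by_contra hc
      push Not at hc
      simp [hc.1, hc.2, hne.symm] at e2
    have : a = a' ∧ b = b' := by
      rcases k1 with k1 | k1 <;> rcases k2 with k2 | k2
      · exact absurd (k1.trans k2.symm) hne
      · exact ⟨k1, k2⟩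
      · subst k1 k2; exact absurd (hab.trans hab') (lt_irrefl _)
      · exact absurd (k1.trans k2.symm) hne
    obtain ⟨rfl, rfl⟩ := this
    rfl
  · exact congrArg Lab.Q (Subtype.ext (hsing _ (by linarith) _ _ hv))

lemma pt_bound {m : ℕ} (r u : ℚ) (hr : 0 < r) (hr' : r < 1 / 4) (hu : |u| ≤ 2)
    (x : Lab m) (i : Fin (m + 1)) : |pt r u x i| ≤ 2 := by
  have hs : ∀ (s : ℚ) (c d : Fin m), |s| ≤ 2 → |(Pi.single c s : Fin m → ℚ) d| ≤ 2 := by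
    intro s c d h
    rw [Pi.single_apply]; split_ifs <;> simp [h]
  have hra : |r| ≤ 2 := by rw [abs_of_pos hr]; linarith
  refine Fin.cases ?_ (fun d => ?_) i
  · rcases x with _ | _ | _ | c | c | c | p | c <;> simp [pt, pa, hra]
  · rcases x with _ | _ | _ | c | c | c | p | c <;> simp only [pt, pv, Fin.cons_succ]
    · simp
    · simp
    · simp
    · exact hs _ _ _ (by simp)
    · exact hs _ _ _ hra
    · exact hs _ _ _ hu
    · simp only [Pi.add_apply, Pi.single_apply]
      split_ifs <;> norm_num
    · refine hs _ _ _ ?_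
      rw [abs_of_pos] <;> linarith

section interp
variable {m : ℕ} (r u : ℚ) (h : Lab m → ℚ)

def cA0 : ℚ := (r * h .E0 - h .T0 + (1 - r) * h .O) / (r * (1 - r))
def cL0 : ℚ := h .E0 - h .O - cA0 r h
def cA (c : Fin m) : ℚ := (r * h (.E c) - h (.T c) + (1 - r) * h .O) / (r * (1 - r))
def cL (c : Fin m) : ℚ := h (.E c) - h .O - cA r h c
/-- bounded part of the mixed coefficient -/
def cR (c : Fin m) : ℚ := (h (.P0 c) - h .E0) / u - (h (.E c) - h .O)
def cD (c : Fin m) : ℚ := cR u h c + (1 - u) * cA r h c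
def cB (p : {p : Fin m × Fin m // p.2 < p.1}) : ℚ :=
  h (.P p) - h (.E p.1.1) - h (.E p.1.2) + h .O

def qd (a : ℚ) (v : Fin m → ℚ) : ℚ :=
  h .O + a * cL0 r h + a ^ 2 * cA0 r h +
    ∑ c, (v c * cL r h c + v c ^ 2 * cA r h c + a * v c * cD r u h c) +
    ∑ p : {p : Fin m × Fin m // p.2 < p.1}, v p.1.1 * v p.1.2 * cB h p

lemma qd_single (a s : ℚ) (c : Fin m) : qd r u h a (Pi.single c s) =
    h .O + a * cL0 r h + a ^ 2 * cA0 r h +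
      (s * cL r h c + s ^ 2 * cA r h c + a * s * cD r u h c) := by
  unfold qd
  rw [Finset.sum_eq_single c, Finset.sum_eq_zero]
  · simp
  · intro p _
    have hp := p.2.ne
    by_cases hc : p.1.1 = c
    · rw [Pi.single_eq_of_ne (i := c) (i' := p.1.2) (by rw [← hc]; exact hp)]; simp
    · rw [Pi.single_eq_of_ne (i := c) (i' := p.1.1) hc]; simp
  · intro b _ hb
    rw [Pi.single_eq_of_ne hb]; simp
  · simp

lemma qd_pair (p : {p : Fin m × Fin m // p.2 < p.1}) :
    qd r u h 0 (Pi.single p.1.1 1 + Pi.single p.1.2 1) =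
    h .O + (cL r h p.1.1 + cA r h p.1.1) + (cL r h p.1.2 + cA r h p.1.2) + cB h p := by
  obtain ⟨⟨a, b⟩, hab⟩ := p
  have hne : a ≠ b := hab.ne'
  unfold qd
  have h2 : ∑ q : {p : Fin m × Fin m // p.2 < p.1},
      (Pi.single a 1 + Pi.single b 1 : Fin m → ℚ) q.1.1 *
      (Pi.single a 1 + Pi.single b 1 : Fin m → ℚ) q.1.2 * cB h q = cB h ⟨(a, b), hab⟩ := by
    rw [Finset.sum_eq_single ⟨(a, b), hab⟩]
    · simp [Pi.single_apply, hne, hne.symm]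
    · rintro ⟨⟨c, d⟩, hcd⟩ _ hq
      simp only [Pi.add_apply, Pi.single_apply]
      simp only at hcd hab
      by_cases k1 : c ≠ a ∧ c ≠ b
      · simp [k1.1, k1.2]
      by_cases k2 : d ≠ a ∧ d ≠ b
      · simp [k2.1, k2.2]
      exfalso
      apply hq
      have k1' : c = a ∨ c = b := by tauto
      have k2' : d = a ∨ d = b := by tauto
      rcases k1' with rfl | rfl <;> rcases k2' with rfl | rfl
      · exact absurd hcd (lt_irrefl _)
      · rfl
      · exact absurd hcd (lt_asymm hab)
      · exact absurd hcd (lt_irrefl _)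
    · simp
  have h1 : ∀ c, ((Pi.single a 1 + Pi.single b 1 : Fin m → ℚ) c * cL r h c +
      (Pi.single a 1 + Pi.single b 1 : Fin m → ℚ) c ^ 2 * cA r h c +
      0 * (Pi.single a 1 + Pi.single b 1 : Fin m → ℚ) c * cD r u h c) =
      (if c = a then (cL r h c + cA r h c) else 0) + (if c = b then (cL r h c + cA r h c) else 0) := by
    intro c
    simp only [Pi.add_apply, Pi.single_apply]
    by_cases k1 : c = a <;> by_cases k2 : c = b
    · exact absurd (k1.symm.trans k2) hne
    all_goals simp [k1, k2, hne, hne.symm]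
  simp only [h2]
  rw [Finset.sum_congr rfl (fun c _ => h1 c), Finset.sum_add_distrib]
  simp
  ring

lemma qd_interp (hr : 0 < r) (hr' : r < 1 / 4) (hu : u ≠ 0)
    (hQ : ∀ c : {c : Fin m // c.val < m / 2},
      h (.T c.1) - h (.Q c) = (2 * r - 1) * (h (.E c.1) - h .O)) (x : Lab m) :
    qd r u h (pa r x) (pv r u x) = h x := by
  have hr1 : 1 - r ≠ 0 := by linarith
  have hr0 : r ≠ 0 := hr.ne'
  have hz : ∀ a, qd r u h a (0 : Fin m → ℚ) = h .O + a * cL0 r h + a ^ 2 * cA0 r h := by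
    intro a; simp [qd]
  rcases x with _ | _ | _ | c | c | c | p | c <;> simp only [pa, pv, hz, qd_single, qd_pair]
  · ring
  · simp only [cL0]; ring
  · simp only [cL0, cA0]; field_simp; ring
  · simp only [cL]; ring
  · simp only [cL, cA]; field_simp; ring
  · simp only [cL0, cL, cD, cR]; field_simp; ring
  · simp only [cL, cB]; ring
  · have e : h (.Q c) = h (.T c.1) - (2 * r - 1) * (h (.E c.1) - h .O) := by
      rw [← hQ c]; ring
    rw [e]
    simp only [cL, cA]; field_simp; ring

open MvPolynomial in
/-- the homogeneous form -/
noncomputable def form : MvPolynomial (Fin (m + 1 + 1)) ℚ :=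
  C (h .O) * (X (Fin.last (m + 1)) * X (Fin.last (m + 1)))
  + C (cL0 r h) * (X (Fin.last (m + 1)) * X (Fin.castSucc 0))
  + C (cA0 r h) * (X (Fin.castSucc 0) * X (Fin.castSucc 0))
  + ∑ c : Fin m, (C (cL r h c) * (X (Fin.last (m + 1)) * X (Fin.castSucc c.succ))
      + C (cA r h c) * (X (Fin.castSucc c.succ) * X (Fin.castSucc c.succ))
      + C (cD r u h c) * (X (Fin.castSucc 0) * X (Fin.castSucc c.succ)))
  + ∑ p : {p : Fin m × Fin m // p.2 < p.1},
      C (cB h p) * (X (Fin.castSucc p.1.1.succ) * X (Fin.castSucc p.1.2.succ))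

open MvPolynomial in
lemma form_hom : (form r u h).IsHomogeneous 2 := by
  have key : ∀ (a : ℚ) (i j : Fin (m + 1 + 1)), (C a * (X i * X j)).IsHomogeneous 2 := by
    intro a i j
    simpa using (isHomogeneous_C _ a).mul ((isHomogeneous_X ℚ i).mul (isHomogeneous_X ℚ j))
  unfold form
  refine ((((key _ _ _).add (key _ _ _)).add (key _ _ _)).add ?_).add ?_
  · exact IsHomogeneous.sum _ _ _ fun c _ => ((key _ _ _).add (key _ _ _)).add (key _ _ _)
  · exact IsHomogeneous.sum _ _ _ fun c _ => key _ _ _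

open MvPolynomial in
lemma form_eval (a : ℚ) (v : Fin m → ℚ) :
    eval (Fin.snoc (Fin.cons a v : Fin (m + 1) → ℚ) 1 : Fin (m + 1 + 1) → ℚ) (form r u h) =
      qd r u h a v := by
  unfold form qd
  simp only [map_add, map_mul, map_sum, eval_C, eval_X, Fin.snoc_last, Fin.snoc_castSucc,
    Fin.cons_zero, Fin.cons_succ]
  congr 1
  · congr 1
    · ring
    · exact Finset.sum_congr rfl fun c _ => by ring
  · exact Finset.sum_congr rfl fun c _ => by ring

open MvPolynomial in
lemma form_evalC (z : Fin (m + 1 + 1) → ℂ) (hz : z (Fin.last (m + 1)) = 0) :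
    eval z (map (algebraMap ℚ ℂ) (form r u h)) =
      (cA0 r h : ℂ) * z (Fin.castSucc 0) ^ 2 +
      ∑ c : Fin m, ((cA r h c : ℂ) * z (Fin.castSucc c.succ) ^ 2 +
        (cD r u h c : ℂ) * (z (Fin.castSucc 0) * z (Fin.castSucc c.succ))) +
      ∑ p : {p : Fin m × Fin m // p.2 < p.1},
        (cB h p : ℂ) * (z (Fin.castSucc p.1.1.succ) * z (Fin.castSucc p.1.2.succ)) := by
  unfold form
  simp only [map_add, map_mul, map_sum, eval_C, eval_X, map_C, map_X, hz]
  simp [sq]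

end interp

section nondeg

lemma norm_ratCast_le (q B : ℚ) (h : |q| ≤ B) : ‖(q : ℂ)‖ ≤ (B : ℝ) := by
  have : ‖(q : ℂ)‖ = ((|q| : ℚ) : ℝ) := by
    rw [Complex.norm_ratCast]; push_cast; rfl
  rw [this]
  exact_mod_cast h

lemma small_bound {m : ℕ} (u : ℚ) (hu : u ≤ -1) (h : Lab m → ℚ) (hh : ∀ x, |h x| ≤ 2)
    (z0 : ℂ) (z : Fin m → ℂ) (M : ℝ) (hM0 : ‖z0‖ ≤ M) (hM : ∀ c, ‖z c‖ ≤ M) :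
    ‖∑ c : Fin m, (cR u h c : ℂ) * (z0 * z c) +
      ∑ p : {p : Fin m × Fin m // p.2 < p.1}, (cB h p : ℂ) * (z p.1.1 * z p.1.2)‖
      ≤ 8 * ((m : ℝ) + 1) ^ 2 * M ^ 2 := by
  have hMnn : 0 ≤ M := (norm_nonneg _).trans hM0
  have hR : ∀ c, |cR u h c| ≤ 8 := by
    intro c
    have h1 := abs_le.1 (hh (.P0 c))
    have h2 := abs_le.1 (hh .E0)
    have h3 := abs_le.1 (hh (.E c))
    have h4 := abs_le.1 (hh .O)
    have h5 : |(h (.P0 c) - h .E0) / u| ≤ 4 := by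
      rw [abs_div]
      have : 1 ≤ |u| := by rw [abs_of_neg] <;> linarith
      have h6 : |h (.P0 c) - h .E0| ≤ 4 := abs_le.2 ⟨by linarith, by linarith⟩
      rw [div_le_iff₀ (by linarith)]
      linarith
    have h5' := abs_le.1 h5
    unfold cR
    exact abs_le.2 ⟨by linarith, by linarith⟩
  have hB : ∀ p, |cB h p| ≤ 8 := by
    intro p
    have h1 := abs_le.1 (hh (.P p))
    have h2 := abs_le.1 (hh (.E p.1.1))
    have h3 := abs_le.1 (hh (.E p.1.2))
    have h4 := abs_le.1 (hh .O)
    unfold cB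
    exact abs_le.2 ⟨by linarith, by linarith⟩
  have tm : ∀ (q : ℚ) (a b : ℂ), |q| ≤ 8 → ‖a‖ ≤ M → ‖b‖ ≤ M →
      ‖(q : ℂ) * (a * b)‖ ≤ 8 * M ^ 2 := by
    intro q a b hq ha hb
    rw [norm_mul, norm_mul, sq]
    have := norm_ratCast_le q 8 hq
    push_cast at this
    gcongr
  have s1 := norm_sum_le_of_le (Finset.univ : Finset (Fin m))
    (fun c _ => tm (cR u h c) z0 (z c) (hR c) hM0 (hM c))
  have s2 := norm_sum_le_of_le (Finset.univ : Finset {p : Fin m × Fin m // p.2 < p.1})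
    (fun p _ => tm (cB h p) (z p.1.1) (z p.1.2) (hB p) (hM _) (hM _))
  simp only [Finset.sum_const, Finset.card_univ, nsmul_eq_mul, Fintype.card_fin] at s1 s2
  have hc : (Fintype.card {p : Fin m × Fin m // p.2 < p.1} : ℝ) ≤ (m : ℝ) ^ 2 := by
    have := Fintype.card_subtype_le (fun p : Fin m × Fin m => p.2 < p.1)
    simp only [Fintype.card_prod, Fintype.card_fin] at this
    rw [sq]
    exact_mod_cast this
  refine (norm_add_le _ _).trans ((add_le_add s1 s2).trans ?_)
  have : (Fintype.card {p : Fin m × Fin m // p.2 < p.1} : ℝ) * (8 * M ^ 2) ≤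
      (m : ℝ) ^ 2 * (8 * M ^ 2) := by gcongr
  have hm : (0 : ℝ) ≤ m := Nat.cast_nonneg m
  nlinarith [mul_nonneg hm (sq_nonneg M), sq_nonneg M]

/-- value of the coordinate `i` at the image of a label -/
noncomputable def hv {m : ℕ} (r u : ℚ) (i : Fin (m + 1)) (x : Lab m) : ℚ := pt r u (tau m x) i

lemma hv_Q {m : ℕ} (r u : ℚ) (hu : u * (2 * r - 1) = 1 - r) (i : Fin (m + 1))
    (c : {c : Fin m // c.val < m / 2}) :
    hv r u i (.T c.1) - hv r u i (.Q c) = (2 * r - 1) * (hv r u i (.E c.1) - hv r u i .O) := by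
  simp only [hv, tau_T, tau_Q, tau_E, tau_O]
  refine Fin.cases ?_ (fun d => ?_) i
  · simp [pt, pa]
  · simp only [pt, pv, Fin.cons_succ, Pi.single_apply, Pi.zero_apply]
    split_ifs <;> linarith

lemma nondeg {m : ℕ} (r u : ℚ) (hr : 0 < r) (hr4 : r < 1 / 4)
    (hrm : r * (2000 * ((m : ℚ) + 1) ^ 3) = 1)
    (hu : u ≤ -1) (hu2 : -2 ≤ u)
    (z : Fin (m + 1 + 1) → ℂ) (hz : z (Fin.last (m + 1)) = 0)
    (hF : ∀ i : Fin (m + 1),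
      MvPolynomial.eval z (MvPolynomial.map (algebraMap ℚ ℂ) (form r u (hv r u i))) = 0) :
    z = 0 := by
  set M : ℝ := ‖z‖ with hMdef
  have hM : ∀ i, ‖z i‖ ≤ M := fun i => norm_le_pi_norm z i
  have hMnn : 0 ≤ M := norm_nonneg _
  set z0 : ℂ := z (Fin.castSucc 0) with hz0
  set y : Fin m → ℂ := fun c => z (Fin.castSucc c.succ) with hy
  set w : Fin m → ℂ := fun c => y c ^ 2 + (1 - (u : ℂ)) * (z0 * y c) with hw
  set S : Fin (m + 1) → ℂ := fun i => ∑ c : Fin m, (cR u (hv r u i) c : ℂ) * (z0 * y c) +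
      ∑ p : {p : Fin m × Fin m // p.2 < p.1}, (cB (hv r u i) p : ℂ) * (y p.1.1 * y p.1.2) with hS
  have hr1 : 1 - r ≠ 0 := by linarith
  have hK : r * (1 - r) ≠ 0 := mul_ne_zero hr.ne' hr1
  have hb : ∀ (i : Fin (m + 1)) (x : Lab m), |hv r u i x| ≤ 2 := fun i x =>
    pt_bound r u hr hr4 (abs_le.2 ⟨hu2, by linarith⟩) _ _
  have hSb : ∀ i, ‖S i‖ ≤ 8 * ((m : ℝ) + 1) ^ 2 * M ^ 2 := fun i =>
    small_bound u hu (hv r u i) (hb i) z0 y M (hM _) (fun c => hM _)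
  have hrR : (r : ℝ) * (2000 * ((m : ℝ) + 1) ^ 3) = 1 := by exact_mod_cast hrm
  have hrpos : (0 : ℝ) < r := by exact_mod_cast hr
  have hr4R : (r : ℝ) < 1 / 4 := by
    have : ((r : ℚ) : ℝ) < ((1 / 4 : ℚ) : ℝ) := by exact_mod_cast hr4
    simpa using this
  have hm : (0 : ℝ) ≤ m := Nat.cast_nonneg m
  -- the split identity
  have hsplit : ∀ i, (((r * (1 - r) * cA0 r (hv r u i) : ℚ) : ℂ)) * z0 ^ 2 +
      ∑ c, ((r * (1 - r) * cA r (hv r u i) c : ℚ) : ℂ) * w c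
        + ((r * (1 - r) : ℚ) : ℂ) * S i = 0 := by
    intro i
    have h1 := hF i
    rw [form_evalC _ _ _ _ hz] at h1
    rw [← mul_zero ((r * (1 - r) : ℚ) : ℂ), ← h1]
    simp only [hS, hw, mul_add, Finset.mul_sum, ← add_assoc, cD]
    rw [← hz0]
    rw [Finset.sum_add_distrib]
    push_cast
    have : ∀ c : Fin m, (r : ℂ) * (1 - r) * ((((cR u (hv r u i) c : ℂ) +
        (1 - (u : ℂ)) * (cA r (hv r u i) c : ℂ))) * (z0 * z (Fin.castSucc c.succ))) =
        (r : ℂ) * (1 - r) * cA r (hv r u i) c * ((1 - (u : ℂ)) * (z0 * y c)) +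
        (r : ℂ) * (1 - r) * (cR u (hv r u i) c * (z0 * y c)) := by
      intro c; simp only [hy]; ring
    simp only [Finset.sum_add_distrib, this, hy]
    simp only [mul_assoc]
    ring
  have hA : ∀ (i : Fin (m + 1)) (c : Fin m), r * (1 - r) * cA r (hv r u i) c =
      r * hv r u i (.E c) - hv r u i (.T c) + (1 - r) * hv r u i .O := by
    intro i c; unfold cA; field_simp
  have hA0 : ∀ i : Fin (m + 1), r * (1 - r) * cA0 r (hv r u i) =
      r * hv r u i .E0 - hv r u i .T0 + (1 - r) * hv r u i .O := by
    intro i; unfold cA0; field_simp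
  have hKn : ‖((r * (1 - r) : ℚ) : ℂ)‖ ≤ r := by
    refine norm_ratCast_le _ _ ?_
    rw [abs_of_pos] <;> nlinarith
  have hKS : ∀ i, ‖((r * (1 - r) : ℚ) : ℂ) * S i‖ ≤ r * (8 * ((m : ℝ) + 1) ^ 2 * M ^ 2) := by
    intro i
    rw [norm_mul]
    exact mul_le_mul hKn (hSb i) (norm_nonneg _) hrpos.le
  have hz0M : ‖z0 ^ 2‖ ≤ M ^ 2 := by
    rw [norm_pow]; exact pow_le_pow_left₀ (norm_nonneg _) (hM _) 2
  have hone : (1 : ℝ) ≤ ((m : ℝ) + 1) ^ 2 := by nlinarith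
  have hMM : M ^ 2 ≤ ((m : ℝ) + 1) ^ 2 * M ^ 2 := le_mul_of_one_le_left (sq_nonneg M) hone
  -- coordinates succ b
  have hwb : ∀ b : Fin m, ‖w b‖ ≤ 10 * r * ((m : ℝ) + 1) ^ 2 * M ^ 2 := by
    intro b
    have h1 := hsplit b.succ
    simp only [hA, hA0] at h1
    have e1 : ∀ c : Fin m, r * hv r u b.succ (.E c) - hv r u b.succ (.T c) + (1 - r) * hv r u b.succ .O =
        if c = b then r * u - 1 else 0 := by
      intro c
      simp only [hv, tau_T, tau_E, tau_O, pt, pv, Fin.cons_succ, Pi.single_apply, Pi.zero_apply,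
        eq_comm (a := b)]
      split_ifs <;> ring
    have e0 : r * hv r u b.succ .E0 - hv r u b.succ .T0 + (1 - r) * hv r u b.succ .O
        = r * hv r u b.succ .E0 := by
      simp [hv, tau_T0, tau_O, pt, pv]
    simp only [e1, e0] at h1
    rw [Finset.sum_eq_single b (fun c _ hc => by simp [hc]) (by simp)] at h1
    simp only [if_true] at h1
    have h2 : ((1 - r * u : ℚ) : ℂ) * w b = ((r * hv r u b.succ .E0 : ℚ) : ℂ) * z0 ^ 2 +
        ((r * (1 - r) : ℚ) : ℂ) * S b.succ := by
      push_cast at h1 ⊢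
      linear_combination -h1
    have h3 : ‖((r * hv r u b.succ .E0 : ℚ) : ℂ)‖ ≤ ((r * 2 : ℚ) : ℝ) := by
      refine norm_ratCast_le _ _ ?_
      rw [abs_mul, abs_of_pos hr]
      exact mul_le_mul_of_nonneg_left (hb _ _) hr.le
    have h4 : (1 : ℝ) ≤ ‖((1 - r * u : ℚ) : ℂ)‖ := by
      rw [Complex.norm_ratCast]
      refine le_trans ?_ (le_abs_self _)
      have : (1 : ℚ) ≤ 1 - r * u := by nlinarith
      exact_mod_cast this
    have h5 : ‖w b‖ ≤ ‖((1 - r * u : ℚ) : ℂ) * w b‖ := by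
      rw [norm_mul]; exact le_mul_of_one_le_left (norm_nonneg _) h4
    rw [h2] at h5
    have h6 : ‖((r * hv r u b.succ .E0 : ℚ) : ℂ) * z0 ^ 2‖ ≤ ((r * 2 : ℚ) : ℝ) * M ^ 2 := by
      rw [norm_mul]
      exact mul_le_mul h3 hz0M (norm_nonneg _) ((norm_nonneg _).trans h3)
    push_cast at h6
    have h7 := h5.trans (norm_add_le _ _)
    have h8 := hKS b.succ
    push_cast at h7 h8
    have h9 := mul_le_mul_of_nonneg_left hMM hrpos.le
    linarith
  have hz0b : ‖z0‖ ^ 2 ≤ M ^ 2 / 100 := by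
    have h1 := hsplit 0
    simp only [hA, hA0] at h1
    have e1 : ∀ c : Fin m, r * hv r u (0 : Fin (m + 1)) (.E c) - hv r u (0 : Fin (m + 1)) (.T c) + (1 - r) * hv r u (0 : Fin (m + 1)) .O = 1 := by
      intro c
      simp only [hv, tau_T, tau_E, tau_O, pt, pa, Fin.cons_zero]
      ring
    have e0 : r * hv r u (0 : Fin (m + 1)) .E0 - hv r u (0 : Fin (m + 1)) .T0 + (1 - r) * hv r u (0 : Fin (m + 1)) .O
        = 1 - (r - r * hv r u (0 : Fin (m + 1)) .E0) := by
      simp only [hv, tau_T0, tau_O, pt, pa, Fin.cons_zero]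
      ring
    simp only [e1, e0] at h1
    have h2 : z0 ^ 2 = ((r - r * hv r u (0 : Fin (m + 1)) .E0 : ℚ) : ℂ) * z0 ^ 2 - ∑ c, w c -
        ((r * (1 - r) : ℚ) : ℂ) * S 0 := by
      push_cast at h1 ⊢
      simp only [one_mul] at h1
      linear_combination h1
    have h3 : ‖((r - r * hv r u (0 : Fin (m + 1)) .E0 : ℚ) : ℂ)‖ ≤ ((r * 3 : ℚ) : ℝ) := by
      refine norm_ratCast_le _ _ ?_
      have := abs_le.1 (hb 0 .E0)
      exact abs_le.2 ⟨by nlinarith, by nlinarith⟩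
    have h6 : ‖((r - r * hv r u (0 : Fin (m + 1)) .E0 : ℚ) : ℂ) * z0 ^ 2‖ ≤ ((r * 3 : ℚ) : ℝ) * M ^ 2 := by
      rw [norm_mul]
      exact mul_le_mul h3 hz0M (norm_nonneg _) ((norm_nonneg _).trans h3)
    have h7 : ‖∑ c, w c‖ ≤ m * (10 * r * ((m : ℝ) + 1) ^ 2 * M ^ 2) := by
      have := norm_sum_le_of_le (Finset.univ : Finset (Fin m)) (fun c _ => hwb c)
      simpa using this
    have h8 := hKS 0
    have h9 : ‖z0 ^ 2‖ ≤ ((r * 3 : ℚ) : ℝ) * M ^ 2 + m * (10 * r * ((m : ℝ) + 1) ^ 2 * M ^ 2) +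
        r * (8 * ((m : ℝ) + 1) ^ 2 * M ^ 2) := by
      rw [h2]
      exact (norm_sub_le _ _).trans
        (add_le_add ((norm_sub_le _ _).trans (add_le_add h6 h7)) h8)
    rw [norm_pow] at h9
    push_cast at h9
    have h10 := mul_le_mul_of_nonneg_left hMM hrpos.le
    have h11 : (r : ℝ) * ((m : ℝ) + 1) ^ 3 * M ^ 2 = M ^ 2 / 2000 := by
      have : (r : ℝ) * ((m : ℝ) + 1) ^ 3 = 1 / 2000 := by linarith
      rw [this]; ring
    have h12 : (0 : ℝ) ≤ m * (r * ((m : ℝ) + 1) ^ 2 * M ^ 2) := by positivity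
    nlinarith [sq_nonneg M]
  have hz0c : ‖z0‖ ≤ M / 10 := by
    refine abs_le_of_sq_le_sq' ?_ (by positivity) |>.2
    linarith [hz0b, show (M / 10) ^ 2 = M ^ 2 / 100 by ring]
  have hyb : ∀ c, ‖y c‖ ≤ 9 / 10 * M := by
    intro c
    have h1 : y c ^ 2 = w c - ((1 - u : ℚ) : ℂ) * (z0 * y c) := by
      simp only [hw]; push_cast; ring
    have h2 : ‖((1 - u : ℚ) : ℂ)‖ ≤ ((3 : ℚ) : ℝ) :=
      norm_ratCast_le _ _ (abs_le.2 ⟨by linarith, by linarith⟩)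
    push_cast at h2
    have h3 : ‖((1 - u : ℚ) : ℂ) * (z0 * y c)‖ ≤ 3 * (M / 10 * M) := by
      rw [norm_mul, norm_mul]
      push_cast
      gcongr
      exact hM _
    have h4 := norm_sub_le (w c) (((1 - u : ℚ) : ℂ) * (z0 * y c))
    rw [← h1, norm_pow] at h4
    have h5 := hwb c
    have h11 : (r : ℝ) * ((m : ℝ) + 1) ^ 3 * M ^ 2 = M ^ 2 / 2000 := by
      have : (r : ℝ) * ((m : ℝ) + 1) ^ 3 = 1 / 2000 := by linarith
      rw [this]; ring
    have h12 : (0 : ℝ) ≤ m * (r * ((m : ℝ) + 1) ^ 2 * M ^ 2) := by positivity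
    refine abs_le_of_sq_le_sq' ?_ (by positivity) |>.2
    nlinarith [sq_nonneg M]
  have hfin : M ≤ 9 / 10 * M := by
    rw [hMdef, pi_norm_le_iff_of_nonneg (by positivity)]
    rw [← hMdef]
    intro i
    refine Fin.lastCases ?_ (fun j => ?_) i
    · rw [hz, norm_zero]; positivity
    · refine Fin.cases ?_ (fun c => ?_) j
      · exact hz0c.trans (by linarith)
      · exact hyb c
  have : M = 0 := by linarith
  exact norm_eq_zero.1 this

end nondeg

end QP

/-- For every `N ≥ 3` there exist homogeneous quadratic forms `F₀, …, F_{N-1}` in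
`N+1` variables over `ℚ` such that, together with `X_N²`, they have no common zero
in `ℂ^{N+1}` other than the origin, and such that `0 ∈ ℚ^N` has minimal period
exactly `(N+1)(N+2)/2 + ⌊(N-1)/2⌋` under the associated affine map
`x ↦ (F₀(x,1), …, F_{N-1}(x,1))`. -/
theorem exists_morphism_forms_with_period (N : ℕ) (hN : 3 ≤ N) :
    ∃ F : Fin N → MvPolynomial (Fin (N + 1)) ℚ,
      (∀ i : Fin N, (F i).IsHomogeneous 2) ∧
      (∀ z : Fin (N + 1) → ℂ,
        (∀ i : Fin N,
          MvPolynomial.eval z (MvPolynomial.map (algebraMap ℚ ℂ) (F i)) = 0) →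
        z (Fin.last N) ^ 2 = 0 → z = 0) ∧
      Function.minimalPeriod
        (fun (x : Fin N → ℚ) (i : Fin N) => MvPolynomial.eval (Fin.snoc x 1) (F i))
        (fun _ => 0) = (N + 1) * (N + 2) / 2 + (N - 1) / 2 := by

  obtain ⟨m, rfl⟩ : ∃ m, N = m + 1 := ⟨N - 1, by omega⟩
  clear hN
  have hm : (0 : ℚ) ≤ m := Nat.cast_nonneg m
  have hm3 : (1 : ℚ) ≤ ((m : ℚ) + 1) ^ 3 := one_le_pow₀ (by linarith)
  obtain ⟨r, hr, hr4, hrm⟩ : ∃ r : ℚ, 0 < r ∧ r < 1 / 4 ∧ r * (2000 * ((m : ℚ) + 1) ^ 3) = 1 := by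
    refine ⟨1 / (2000 * ((m : ℚ) + 1) ^ 3), by positivity, ?_, ?_⟩
    · rw [div_lt_div_iff₀ (by positivity) (by norm_num)]
      linarith
    · field_simp
  obtain ⟨u, hu, hu1, hu2⟩ : ∃ u : ℚ, u * (2 * r - 1) = 1 - r ∧ u ≤ -1 ∧ -2 ≤ u := by
    have hne : 1 - 2 * r > 0 := by linarith
    refine ⟨-((1 - r) / (1 - 2 * r)), ?_, ?_, ?_⟩
    · have h0 : 1 - 2 * r ≠ 0 := hne.ne'
      have h1 := div_mul_cancel₀ (1 - r) h0
      linear_combination h1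
    · have : 1 ≤ (1 - r) / (1 - 2 * r) := by
        rw [le_div_iff₀ hne]; linarith
      linarith
    · have : (1 - r) / (1 - 2 * r) ≤ 2 := by
        rw [div_le_iff₀ hne]; linarith
      linarith
  refine ⟨fun i => QP.form r u (QP.hv r u i), fun i => QP.form_hom _ _ _, ?_, ?_⟩
  · intro z hz hlast
    exact QP.nondeg r u hr hr4 hrm hu1 hu2 z (pow_eq_zero_iff (two_ne_zero) |>.1 hlast) hz
  · set f : (Fin (m + 1) → ℚ) → (Fin (m + 1) → ℚ) := fun x i =>
      MvPolynomial.eval (Fin.snoc x 1 : Fin (m + 1 + 1) → ℚ) (QP.form r u (QP.hv r u i)) with hf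
    have hstep : ∀ x : QP.Lab m, f (QP.pt r u x) = QP.pt r u (QP.tau m x) := by
      intro x
      funext i
      simp only [hf]
      rw [QP.pt, QP.form_eval, QP.qd_interp r u _ hr hr4 (by linarith) (QP.hv_Q r u hu i)]
      rfl
    have hsemi : Function.Semiconj (QP.pt (m := m) r u) (QP.tau m) f := fun x => (hstep x).symm
    have hO : (fun _ => 0 : Fin (m + 1) → ℚ) = QP.pt r u QP.Lab.O := by
      funext i
      refine Fin.cases ?_ (fun c => ?_) i <;> simp [QP.pt, QP.pa, QP.pv]
    rw [hO, ← QP.length_orb, ← QP.tau_period QP.Lab.O]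
    rw [Function.minimalPeriod_eq_minimalPeriod_iff]
    intro n
    unfold Function.IsPeriodicPt Function.IsFixedPt
    rw [← (hsemi.iterate_right n).eq]
    exact (QP.pt_inj r u hr hr4 hu1).eq_iff
end

section
/- For every natural number N ≥ 3, the set of tuples of homogeneous quadratic forms (F_0, …, F_{N-1}) in MvPolynomial (Fin (N+1)) ℚ such that F_0, …, F_{N-1}, X_N^2 have no common zero in ℂ^{N+1} other than the origin and such that 0 ∈ ℚ^N has minimal period exactly (N+1)(N+2)/2 + ⌊(N-1)/2⌋ under the affine map x ↦ (F_0(x,1), …, F_{N-1}(x,1)) is infinite. -/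
open MvPolynomial

/-- Minimal period from an explicit orbit. -/
lemma minPer_of_orbit {α : Type*} (f : α → α) (p : ℕ → α) (n : ℕ) (hn : 0 < n)
    (hs : ∀ k < n, f (p k) = p (k + 1)) (hn0 : p n = p 0)
    (hne : ∀ k, 0 < k → k < n → p k ≠ p 0) : Function.minimalPeriod f (p 0) = n := by
  have hit : ∀ k ≤ n, f^[k] (p 0) = p k := by
    intro k
    induction k with
    | zero => intro _; rfl
    | succ k ih =>
      intro hk
      rw [Function.iterate_succ_apply', ih (by omega), hs k (by omega)]
  have hper : Function.IsPeriodicPt f n (p 0) := by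
    show f^[n] (p 0) = p 0
    rw [hit n le_rfl, hn0]
  have hle := hper.minimalPeriod_le hn
  have hpos := hper.minimalPeriod_pos hn
  by_contra hcon
  have hlt : Function.minimalPeriod f (p 0) < n := lt_of_le_of_ne hle hcon
  have h1 := Function.iterate_minimalPeriod (f := f) (x := p 0)
  rw [hit _ hle] at h1
  exact hne _ hpos hlt h1

/-- The set in the theorem, for a general period `n`. -/
def GoodSet (N n : ℕ) : Set (Fin N → MvPolynomial (Fin (N + 1)) ℚ) :=
    {F : Fin N → MvPolynomial (Fin (N + 1)) ℚ |
      (∀ i : Fin N, (F i).IsHomogeneous 2) ∧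
      (∀ z : Fin (N + 1) → ℂ,
        (∀ i : Fin N,
          MvPolynomial.eval z (MvPolynomial.map (algebraMap ℚ ℂ) (F i)) = 0) →
        z (Fin.last N) ^ 2 = 0 → z = 0) ∧
      Function.minimalPeriod
        (fun (x : Fin N → ℚ) (i : Fin N) => MvPolynomial.eval (Fin.snoc x 1) (F i))
        (fun _ => 0) = n}

/-- Substitution used for the conjugation by a scaling. -/
noncomputable def sub (N : ℕ) (s : ℚ) (j : Fin (N + 1)) : MvPolynomial (Fin (N + 1)) ℚ :=
  if j = Fin.last N then X j else C s⁻¹ * X j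

/-- Conjugate of a system by a scaling. -/
noncomputable def scaled {N : ℕ} (s : ℚ) (F : Fin N → MvPolynomial (Fin (N + 1)) ℚ) (i : Fin N) :
    MvPolynomial (Fin (N + 1)) ℚ :=
  C s * bind₁ (sub N s) (F i)

lemma sub_hom (N : ℕ) (s : ℚ) (j : Fin (N + 1)) : (sub N s j).IsHomogeneous 1 := by
  unfold sub
  split_ifs
  · exact isHomogeneous_X _ _
  · simpa using (isHomogeneous_C (Fin (N+1)) s⁻¹).mul (isHomogeneous_X ℚ j)

lemma eval_scaled {N : ℕ} (s : ℚ) (F : Fin N → MvPolynomial (Fin (N + 1)) ℚ) (i : Fin N)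
    (x : Fin N → ℚ) : eval (Fin.snoc x 1) (scaled s F i)
      = s * eval (Fin.snoc (fun k => s⁻¹ * x k) 1) (F i) := by
  unfold scaled
  rw [map_mul, eval_C]
  congr 1
  have h : eval (Fin.snoc x 1) (bind₁ (sub N s) (F i)) =
      eval (fun j => eval (Fin.snoc x 1) (sub N s j)) (F i) := by
    have := eval₂Hom_bind₁ (RingHom.id ℚ) (Fin.snoc x 1 : Fin (N+1) → ℚ) (sub N s) (F i)
    exact this
  rw [h]
  congr 1
  congr 1
  funext j
  refine Fin.lastCases ?_ (fun j => ?_) j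
  · simp [sub]
  · simp [sub, Fin.castSucc_ne_last]

lemma infinite_of_good (N n : ℕ) (hn : 2 ≤ n) (F : Fin N → MvPolynomial (Fin (N + 1)) ℚ)
    (hF : F ∈ GoodSet N n) : (GoodSet N n).Infinite := by
  obtain ⟨h1, h2, h3⟩ := hF
  set f : (Fin N → ℚ) → (Fin N → ℚ) :=
    fun (x : Fin N → ℚ) (i : Fin N) => MvPolynomial.eval (Fin.snoc x 1) (F i) with hf
  have hf0 : f (fun _ => 0) ≠ fun _ => 0 := by
    intro h
    have : Function.minimalPeriod f (fun _ => 0) = 1 :=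
      Function.minimalPeriod_eq_one_iff_isFixedPt.2 h
    omega
  obtain ⟨i0, hi0⟩ := Function.ne_iff.1 hf0
  refine Set.infinite_of_injective_forall_mem (f := fun k : ℕ => scaled ((k : ℚ) + 1) F) ?_ ?_
  · intro a b hab
    have h := congrArg (fun q => eval (Fin.snoc (fun _ => 0) 1) q) (congrFun hab i0)
    simp only [eval_scaled, mul_zero] at h
    have h' := mul_right_cancel₀ hi0 h
    have : (a : ℚ) = b := by linarith
    exact_mod_cast this
  · intro k
    have hs : ((k : ℚ) + 1) ≠ 0 := by positivity
    set s : ℚ := (k : ℚ) + 1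
    refine ⟨fun i => ?_, fun z hz hl => ?_, ?_⟩
    · have := (h1 i).aeval (sub N s) (n := 1) (fun j => sub_hom N s j)
      simpa [scaled] using (isHomogeneous_C (Fin (N+1)) s).mul this
    · have hsC : ((algebraMap ℚ ℂ) s) ≠ 0 := by simpa using hs
      have hz0 : (fun j => if j = Fin.last N then z j else (algebraMap ℚ ℂ s)⁻¹ * z j) = 0 := by
        apply h2
        · intro i
          have h := hz i
          unfold scaled at h
          rw [map_mul, map_mul, map_C, eval_C] at h
          have h := (mul_eq_zero.1 h).resolve_left hsC
          rw [map_bind₁] at h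
          have e := eval₂Hom_bind₁ (RingHom.id ℂ) z
            (fun j => map (algebraMap ℚ ℂ) (sub N s j)) (map (algebraMap ℚ ℂ) (F i))
          change eval z _ = eval _ _ at e
          rw [e] at h
          rw [← h]
          congr 2
          funext j
          change _ = eval z _
          unfold sub
          split_ifs
          · simp
          · simp
        · simpa using hl
      funext j
      have := congrFun hz0 j
      simp only [Pi.zero_apply] at this ⊢
      split_ifs at this
      · exact this
      · exact (mul_eq_zero.1 this).resolve_left (inv_ne_zero hsC)
    · rw [← h3]
      set g : (Fin N → ℚ) → (Fin N → ℚ) :=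
        fun (x : Fin N → ℚ) (i : Fin N) => MvPolynomial.eval (Fin.snoc x 1) (scaled s F i) with hg
      have hsemi : Function.Semiconj (fun (x : Fin N → ℚ) i => s * x i) f g := by
        intro x
        funext i
        simp only [hf, hg, eval_scaled]
        congr 3
        congr 1
        funext k
        field_simp
      rw [Function.minimalPeriod_eq_minimalPeriod_iff]
      intro m
      have := (hsemi.iterate_right m) (fun _ => 0)
      simp only [mul_zero] at this
      unfold Function.IsPeriodicPt Function.IsFixedPt
      rw [← this]
      constructor
      · intro h
        funext i
        exact (mul_eq_zero.1 (congrFun h i)).resolve_left hs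
      · intro h
        rw [h]; simp

/-- `g` is the dehomogenization of a form of degree `d`. -/
def HQ {N : ℕ} (d : ℕ) (g : (Fin N → ℚ) → ℚ) : Prop :=
  ∃ q : MvPolynomial (Fin (N + 1)) ℚ, q.IsHomogeneous d ∧
    ∀ x : Fin N → ℚ, eval (Fin.snoc x 1) q = g x

namespace HQ
variable {N : ℕ}

lemma add {d : ℕ} {g h : (Fin N → ℚ) → ℚ} (hg : HQ d g) (hh : HQ d h) :
    HQ d (fun x => g x + h x) := by
  obtain ⟨q, h1, h2⟩ := hg
  obtain ⟨r, h3, h4⟩ := hh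
  exact ⟨q + r, h1.add h3, fun x => by rw [map_add, h2, h4]⟩

lemma smul {d : ℕ} {g : (Fin N → ℚ) → ℚ} (a : ℚ) (hg : HQ d g) :
    HQ d (fun x => a * g x) := by
  obtain ⟨q, h1, h2⟩ := hg
  refine ⟨C a * q, ?_, fun x => by rw [map_mul, h2, eval_C]⟩
  simpa using (isHomogeneous_C (Fin (N+1)) a).mul h1

lemma sub {d : ℕ} {g h : (Fin N → ℚ) → ℚ} (hg : HQ d g) (hh : HQ d h) :
    HQ d (fun x => g x - h x) := by
  obtain ⟨q, h1, h2⟩ := hg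
  obtain ⟨r, h3, h4⟩ := hh
  exact ⟨q - r, h1.sub h3, fun x => by rw [map_sub, h2, h4]⟩

lemma mul {g h : (Fin N → ℚ) → ℚ} (hg : HQ 1 g) (hh : HQ 1 h) :
    HQ 2 (fun x => g x * h x) := by
  obtain ⟨q, h1, h2⟩ := hg
  obtain ⟨r, h3, h4⟩ := hh
  exact ⟨q * r, h1.mul h3, fun x => by rw [map_mul, h2, h4]⟩

lemma coord (i : Fin N) : HQ 1 (fun x : Fin N → ℚ => x i) :=
  ⟨X i.castSucc, isHomogeneous_X _ _, fun x => by simp⟩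

lemma const (a : ℚ) : HQ 1 (fun _ : Fin N → ℚ => a) :=
  ⟨C a * X (Fin.last N), by
    simpa using (isHomogeneous_C (Fin (N+1)) a).mul (isHomogeneous_X ℚ (Fin.last N)),
    fun x => by simp⟩

lemma up {g : (Fin N → ℚ) → ℚ} (hg : HQ 1 g) : HQ 2 g := by
  simpa using hg.mul (const 1)

lemma zero (d : ℕ) : HQ d (fun _ : Fin N → ℚ => 0) :=
  ⟨0, isHomogeneous_zero _ _ _, fun x => by simp⟩

lemma sum {ι : Type*} {d : ℕ} (s : Finset ι) (g : ι → (Fin N → ℚ) → ℚ)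
    (hg : ∀ i ∈ s, HQ d (g i)) : HQ d (fun x => ∑ i ∈ s, g i x) := by
  classical
  induction s using Finset.induction_on with
  | empty => simpa using zero d
  | insert a s ha ih =>
    simp only [Finset.sum_insert ha]
    exact (hg a (by simp)).add (ih fun i hi => hg i (by simp [hi]))

end HQ

lemma form_bound {M : ℕ} (q : MvPolynomial (Fin M) ℚ) (hq : q.IsHomogeneous 2) :
    ∃ B : ℝ, 0 ≤ B ∧ ∀ (z : Fin M → ℂ) (r : ℝ), (∀ i, ‖z i‖ ≤ r) →
      ‖eval z (map (algebraMap ℚ ℂ) q)‖ ≤ B * r ^ 2 := by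
  refine ⟨∑ d ∈ q.support, ‖(algebraMap ℚ ℂ) (coeff d q)‖, by positivity, fun z r hz => ?_⟩
  rw [eval_map, eval₂_eq', Finset.sum_mul]
  refine (norm_sum_le _ _).trans (Finset.sum_le_sum fun d hd => ?_)
  rw [norm_mul]
  refine mul_le_mul_of_nonneg_left ?_ (norm_nonneg _)
  rw [norm_prod]
  have hdeg : ∑ i, d i = 2 := by
    have := hq (mem_support_iff.1 hd)
    rw [← this, Finsupp.weight_apply, Finsupp.sum_fintype] <;> simp
  calc ∏ i, ‖z i ^ d i‖ ≤ ∏ i, r ^ d i := by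
        refine Finset.prod_le_prod (fun i _ => norm_nonneg _) (fun i _ => ?_)
        rw [norm_pow]
        exact pow_le_pow_left₀ (norm_nonneg _) (hz i) _
    _ = r ^ 2 := by rw [Finset.prod_pow_eq_pow_sum, hdeg]

/-- Boolean orbits of quadratic maps give good systems. -/
lemma good_of_bool (N n : ℕ) (hn : 2 ≤ n) (q : Fin N → (Fin N → ℚ) → ℚ)
    (hq : ∀ i, HQ 2 (q i)) (p : ℕ → Fin N → ℚ)
    (hb : ∀ k < n, ∀ i, p k i = 0 ∨ p k i = 1) (h0 : p 0 = fun _ => 0)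
    (hs : ∀ k < n, ∀ i, q i (p k) = p (k + 1) i) (hn0 : p n = fun _ => 0)
    (hne : ∀ k, 0 < k → k < n → p k ≠ fun _ => 0) : (GoodSet N n).Infinite := by
  choose Q hQ1 hQ2 using hq
  choose B hB0 hB using fun i => form_bound (Q i) (hQ1 i)
  obtain ⟨c, hc⟩ := exists_nat_gt (∑ i, B i)
  refine infinite_of_good N n hn
    (fun i => Q i + C (c : ℚ) * (X i.castSucc * X i.castSucc - X i.castSucc * X (Fin.last N)))
    ⟨fun i => ?_, fun z hz hl => ?_, ?_⟩
  · refine (hQ1 i).add ?_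
    have h := ((isHomogeneous_X ℚ i.castSucc).mul (isHomogeneous_X ℚ i.castSucc)).sub
      ((isHomogeneous_X ℚ i.castSucc).mul (isHomogeneous_X ℚ (Fin.last N)))
    simpa using (isHomogeneous_C (Fin (N+1)) (c : ℚ)).mul h
  · have hl0 : z (Fin.last N) = 0 := by simpa using hl
    obtain ⟨j, -, hj⟩ := Finset.exists_max_image Finset.univ (fun j => ‖z j‖) ⟨Fin.last N, by simp⟩
    have hzj : z j = 0 := by
      revert hj
      refine Fin.lastCases (fun _ => hl0) (fun i => ?_) j
      intro hj
      have h1 := hz i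
      simp only [map_add, map_mul, map_sub, map_C, map_X, eval_C, eval_X, hl0, mul_zero,
        sub_zero] at h1
      have h2 := hB i z ‖z i.castSucc‖ (fun k => hj k (by simp))
      have h3 : eval z (map (algebraMap ℚ ℂ) (Q i)) =
          -(((c : ℕ) : ℂ) * (z i.castSucc * z i.castSucc)) := by
        simp only [map_natCast] at h1
        linear_combination h1
      rw [h3, norm_neg, norm_mul, norm_mul, Complex.norm_natCast] at h2
      have h4 : B i ≤ ∑ i, B i := Finset.single_le_sum (fun i _ => hB0 i) (Finset.mem_univ i)
      by_contra hne
      have h5 : 0 < ‖z i.castSucc‖ := norm_pos_iff.2 hne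
      nlinarith [mul_pos h5 h5]
    funext k
    have := hj k (by simp)
    rw [hzj, norm_zero] at this
    simpa using this
  · have key := minPer_of_orbit (fun (x : Fin N → ℚ) (i : Fin N) => MvPolynomial.eval (Fin.snoc x 1)
      (Q i + C (c : ℚ) * (X i.castSucc * X i.castSucc - X i.castSucc * X (Fin.last N)))) p n
      (by omega) ?_ (by rw [hn0, h0]) (by rw [h0]; exact hne)
    · rw [h0] at key
      exact key
    · intro k hk
      funext i
      simp only [map_add, map_mul, map_sub, eval_C, eval_X, Fin.snoc_castSucc, Fin.snoc_last,
        hQ2, hs k hk i]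
      rcases hb k hk i with h | h <;> rw [h] <;> simp

/-- A literal: the value of a bit, negated when `b = true`. -/
def litv {N : ℕ} (x : Fin N → Bool) (l : Fin N × Bool) : Bool := xor (x l.1) l.2

/-- A multiplexer of three literals. -/
def muxv {N : ℕ} (x : Fin N → Bool) (g : (Fin N × Bool) × (Fin N × Bool) × (Fin N × Bool)) : Bool :=
  if litv x g.1 then litv x g.2.1 else litv x g.2.2

/-- Rational value of a bit. -/
def bq (b : Bool) : ℚ := if b then 1 else 0

/-- Affine function computing a literal. -/
def litq {N : ℕ} (l : Fin N × Bool) (x : Fin N → ℚ) : ℚ := if l.2 then 1 - x l.1 else x l.1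

lemma litq_HQ {N : ℕ} (l : Fin N × Bool) : HQ 1 (litq l) := by
  obtain ⟨i, b⟩ := l
  cases b
  · have e : litq (i, false) = fun x : Fin N → ℚ => x i := by funext x; simp [litq]
    rw [e]; exact HQ.coord i
  · have e : litq (i, true) = fun x : Fin N → ℚ => 1 - x i := by funext x; simp [litq]
    rw [e]; exact (HQ.const 1).sub (HQ.coord i)

lemma litq_eq {N : ℕ} (l : Fin N × Bool) (x : Fin N → Bool) :
    litq l (fun i => bq (x i)) = bq (litv x l) := by
  obtain ⟨i, b⟩ := l
  cases b <;> cases h : x i <;> simp [litq, litv, bq, h]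

/-- Circuits of multiplexers, given with the table of an orbit. -/
lemma good_of_table (N n : ℕ) (hn : 2 ≤ n)
    (G : Fin N → (Fin N × Bool) × (Fin N × Bool) × (Fin N × Bool)) (t : List ℕ)
    (h0 : ∀ i : Fin N, (t.getD 0 0).testBit i = false)
    (hs : ∀ k < n, ∀ i : Fin N,
      muxv (fun j : Fin N => (t.getD k 0).testBit j) (G i) = (t.getD (k + 1) 0).testBit i)
    (hn0 : ∀ i : Fin N, (t.getD n 0).testBit i = false)
    (hne : ∀ k < n, 0 < k → ∃ i : Fin N, (t.getD k 0).testBit i = true) :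
    (GoodSet N n).Infinite := by
  refine good_of_bool N n hn
    (fun i x => litq (G i).1 x * litq (G i).2.1 x + (1 - litq (G i).1 x) * litq (G i).2.2 x)
    (fun i => ((litq_HQ _).mul (litq_HQ _)).add (((HQ.const 1).sub (litq_HQ _)).mul (litq_HQ _)))
    (fun k i => bq ((t.getD k 0).testBit i)) ?_ ?_ ?_ ?_ ?_
  · intro k _ i
    cases h : (t.getD k 0).testBit i <;> simp [bq]
  · funext i; rw [h0 i]; simp [bq]
  · intro k hk i
    have e := hs k hk i
    simp only [litq_eq (x := fun j : Fin N => (t.getD k 0).testBit j)]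
    rw [← e]
    unfold muxv
    cases litv (fun j : Fin N => (t.getD k 0).testBit j) (G i).1 <;> simp [bq]
  · funext i; rw [hn0 i]; simp [bq]
  · intro k h1 h2 h
    obtain ⟨i, hi⟩ := hne k h2 h1
    have h3 := congrFun h i
    simp only [hi] at h3
    simp [bq] at h3

lemma good5 : (GoodSet 5 23).Infinite :=
  good_of_table 5 23 (by norm_num)
    ![((2, false), (4, true), (4, false)),
      ((3, false), (3, false), (3, false)),
      ((1, false), (4, false), (4, true)),
      ((3, false), (1, true), (0, false)),
      ((1, false), (0, true), (0, false))]
    [0, 4, 5, 29, 26, 23, 12, 15, 3, 8, 14, 19, 13, 31, 6, 17, 25, 27, 7, 9, 30, 22, 20, 0]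
    (by decide +kernel) (by decide +kernel) (by decide +kernel) (by decide +kernel)

lemma good6 : (GoodSet 6 30).Infinite :=
  good_of_table 6 30 (by norm_num)
    ![((4, true), (5, false), (5, true)),
      ((0, false), (4, false), (1, true)),
      ((3, false), (4, false), (4, true)),
      ((5, true), (5, true), (5, true)),
      ((0, true), (5, true), (5, false)),
      ((2, true), (2, false), (2, false))]
    [0, 30, 61, 54, 32, 7, 44, 35, 21, 43, 17, 11, 8, 26, 29, 47, 49, 18, 25, 15, 40, 3, 12, 58, 4, 62, 36, 39, 53, 50, 0]
    (by decide +kernel) (by decide +kernel) (by decide +kernel) (by decide +kernel)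

lemma good7 : (GoodSet 7 39).Infinite :=
  good_of_table 7 39 (by norm_num)
    ![((1, true), (6, false), (6, true)),
      ((2, true), (4, true), (3, false)),
      ((4, true), (3, true), (3, false)),
      ((1, true), (1, true), (1, true)),
      ((5, false), (5, true), (2, true)),
      ((5, false), (5, false), (5, false)),
      ((6, true), (0, false), (0, true))]
    [0, 30, 7, 69, 13, 74, 82, 80, 89, 29, 78, 66, 86, 64, 95, 6, 5, 76, 75, 18, 17, 88, 93, 15, 67, 22, 1, 94, 70, 68, 77, 11, 83, 16, 24, 28, 14, 3, 87, 0]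
    (by decide +kernel) (by decide +kernel) (by decide +kernel) (by decide +kernel)

lemma good8 : (GoodSet 8 48).Infinite :=
  good_of_table 8 48 (by norm_num)
    ![((1, true), (1, true), (1, true)),
      ((2, true), (2, true), (2, true)),
      ((0, false), (7, false), (2, false)),
      ((2, true), (7, false), (3, true)),
      ((6, true), (1, true), (1, false)),
      ((4, false), (4, false), (4, false)),
      ((5, false), (7, true), (7, false)),
      ((3, true), (3, true), (3, true))]
    [0, 147, 238, 20, 189, 53, 249, 47, 64, 131, 206, 84, 173, 21, 185, 63, 96, 195, 222, 116, 237, 5, 153, 127, 112, 227, 158, 100, 205, 69, 137, 95, 48, 243, 190, 36, 221, 101, 201, 79, 16, 179, 174, 4, 157, 117, 233, 15, 0]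
    (by decide +kernel) (by decide +kernel) (by decide +kernel) (by decide +kernel)

lemma good9 : (GoodSet 9 59).Infinite :=
  good_of_table 9 59 (by norm_num)
    ![((1, true), (1, true), (1, true)),
      ((5, true), (5, false), (1, true)),
      ((6, false), (6, false), (6, false)),
      ((4, false), (4, false), (4, false)),
      ((2, true), (7, false), (7, true)),
      ((2, true), (2, true), (2, true)),
      ((0, true), (8, true), (8, false)),
      ((3, false), (3, false), (3, false)),
      ((8, false), (3, true), (3, false))]
    [0, 97, 39, 16, 105, 423, 320, 293, 339, 364, 151, 8, 481, 375, 348, 157, 393, 241, 63, 408, 185, 443, 248, 511, 204, 453, 325, 341, 349, 221, 397, 193, 53, 27, 424, 179, 56, 491, 244, 79, 404, 265, 225, 55, 24, 489, 247, 12, 465, 381, 223, 396, 129, 49, 43, 416, 307, 360, 167, 0]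
    (by decide +kernel) (by decide +kernel) (by decide +kernel) (by decide +kernel)

/-- Lagrange interpolation on the boolean vectors of weight at most two. -/
lemma lagrange {N : ℕ} (B T : Finset (Fin N)) (hT : T ⊆ B) (hc : T.card ≤ 2) :
    ∃ g : (Fin N → ℚ) → ℚ, HQ 2 g ∧ ∀ (x : Fin N → ℚ) (U : Finset (Fin N)), U ⊆ B → U.card ≤ 2 →
      (∀ i ∈ B, x i = if i ∈ U then 1 else 0) → g x = if T = U then 1 else 0 := by
  classical
  have hsig : HQ 1 (fun x : Fin N → ℚ => ∑ i ∈ B, x i) := HQ.sum _ _ fun i _ => HQ.coord i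
  have hval : ∀ (x : Fin N → ℚ) (U : Finset (Fin N)), U ⊆ B →
      (∀ i ∈ B, x i = if i ∈ U then 1 else 0) → ∑ i ∈ B, x i = (U.card : ℚ) := by
    intro x U hU hx
    rw [Finset.sum_congr rfl hx, Finset.sum_ite_mem, Finset.inter_eq_right.2 hU]
    simp
  have h3 : T.card = 0 ∨ T.card = 1 ∨ T.card = 2 := by omega
  rcases h3 with h | h | h
  · obtain rfl := Finset.card_eq_zero.1 h
    refine ⟨fun x => (1/2) * ((1 - ∑ i ∈ B, x i) * (2 - ∑ i ∈ B, x i)),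
      (((HQ.const 1).sub hsig).mul ((HQ.const 2).sub hsig)).smul _, ?_⟩
    intro x U hU hc' hx
    simp only [hval x U hU hx]
    have h4 : U.card = 0 ∨ U.card = 1 ∨ U.card = 2 := by omega
    rcases h4 with h' | h' | h'
    · obtain rfl := Finset.card_eq_zero.1 h'
      norm_num
    · rw [if_neg (by rintro rfl; simp at h'), h']; norm_num
    · rw [if_neg (by rintro rfl; simp at h'), h']; norm_num
  · obtain ⟨a, rfl⟩ := Finset.card_eq_one.1 h
    refine ⟨fun x => x a * (2 - ∑ i ∈ B, x i), (HQ.coord a).mul ((HQ.const 2).sub hsig), ?_⟩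
    intro x U hU hc' hx
    simp only [hval x U hU hx, hx a (hT (by simp))]
    by_cases ha : a ∈ U
    · have h1 : 1 ≤ U.card := Finset.card_pos.2 ⟨a, ha⟩
      have h4 : U.card = 1 ∨ U.card = 2 := by omega
      rcases h4 with h' | h'
      · have : {a} = U := Finset.eq_of_subset_of_card_le (by simpa using ha) (by simp [h'])
        rw [if_pos ha, if_pos this, h']; norm_num
      · rw [if_pos ha, if_neg (by rintro rfl; simp at h'), h']; norm_num
    · rw [if_neg ha, if_neg (by rintro rfl; simp at ha)]; simp
  · obtain ⟨a, b, hab, rfl⟩ := Finset.card_eq_two.1 h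
    refine ⟨fun x => x a * x b, (HQ.coord a).mul (HQ.coord b), ?_⟩
    intro x U hU hc' hx
    simp only [hx a (hT (by simp)), hx b (hT (by simp))]
    by_cases ha : a ∈ U
    · by_cases hb : b ∈ U
      · have : {a, b} = U := Finset.eq_of_subset_of_card_le
          (by intro y hy; simp at hy; rcases hy with rfl | rfl <;> assumption) (by omega)
        simp [ha, hb, this]
      · have hne : ¬ ({a, b} : Finset (Fin N)) = U := by rintro rfl; simp at hb
        simp [hb, hne]
    · have hne : ¬ ({a, b} : Finset (Fin N)) = U := by rintro rfl; simp at ha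
      simp [ha, hne]

/-- An enumeration of sets of size at most two, starting with the empty set. -/
lemma exists_enum {N : ℕ} (B : Finset (Fin N)) (K : ℕ)
    (hK : K ≤ 1 + B.card + B.card * (B.card - 1) / 2) :
    ∃ u : ℕ → Finset (Fin N), u 0 = ∅ ∧ (∀ k < K, u k ⊆ B ∧ (u k).card ≤ 2) ∧
      ∀ k < K, ∀ l < K, u k = u l → k = l := by
  classical
  set W : Finset (Finset (Fin N)) := B.powerset.filter (fun T => T.card ≤ 2) with hW
  have hWc : 1 + B.card + B.card * (B.card - 1) / 2 ≤ W.card := by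
    have hdis : ((Finset.range 3).biUnion fun j => B.powersetCard j).card
        = ∑ j ∈ Finset.range 3, (B.powersetCard j).card := by
      apply Finset.card_biUnion
      intro a _ b _ hab
      exact Finset.pairwise_disjoint_powersetCard B hab
    have hsub : ((Finset.range 3).biUnion fun j => B.powersetCard j) ⊆ W := by
      intro T hT
      simp only [Finset.mem_biUnion, Finset.mem_range, Finset.mem_powersetCard] at hT
      obtain ⟨j, hj, h1, h2⟩ := hT
      simp only [hW, Finset.mem_filter, Finset.mem_powerset]
      exact ⟨h1, by omega⟩
    have := Finset.card_le_card hsub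
    rw [hdis] at this
    simpa [Finset.sum_range_succ, Nat.choose_two_right] using this
  have hempty : (∅ : Finset (Fin N)) ∈ W := by simp [hW]
  have hpos : 0 < W.card := Finset.card_pos.2 ⟨_, hempty⟩
  let e : Fin W.card ≃ W := W.equivFin.symm
  let e' : Fin W.card ≃ W := (Equiv.swap ⟨0, hpos⟩ (e.symm ⟨∅, hempty⟩)).trans e
  refine ⟨fun k => if h : k < W.card then (e' ⟨k, h⟩ : Finset (Fin N)) else ∅, ?_, ?_, ?_⟩
  · simp [hpos, e']
  · intro k hk
    have hk' : k < W.card := by omega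
    have := (e' ⟨k, hk'⟩).2
    simp only [hW, Finset.mem_filter, Finset.mem_powerset] at this
    simpa [hk'] using this
  · intro k hk l hl h
    have hk' : k < W.card := by omega
    have hl' : l < W.card := by omega
    simp only [hk', hl', dif_pos] at h
    have := e'.injective (Subtype.ext h)
    simpa using this

/-- The encoding of a state: position `k` on the loop and control bit `c`. -/
def enc {N : ℕ} (u : ℕ → Finset (Fin N)) (K k : ℕ) (c : ℚ) (i : Fin N) : ℚ :=
  if i.val = 0 then (if k + 1 = K then 1 else 0) else if i.val = 1 then c else
    if i ∈ u k then 1 else 0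

lemma good_large (N n K j : ℕ) (hN : 3 ≤ N) (hK3 : 3 ≤ K) (hj : j ≤ 1) (hn : n + j = 2 * K)
    (hK : K ≤ 1 + (N - 2) + (N - 2) * (N - 2 - 1) / 2) : (GoodSet N n).Infinite := by
  classical
  set B : Finset (Fin N) := Finset.univ.filter (fun i => 2 ≤ i.val) with hB
  have hBc : B.card = N - 2 := by
    have h1 : B = Finset.Ici (⟨2, by omega⟩ : Fin N) := by
      ext i; simp [hB, Fin.le_def]
    rw [h1, Fin.card_Ici]
  obtain ⟨u, hu0, huB, hinj⟩ := exists_enum B K (by rw [hBc]; exact hK)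
  have hlag : ∀ k, ∃ g : (Fin N → ℚ) → ℚ, HQ 2 g ∧ (k < K → ∀ l < K, ∀ c,
      g (enc u K l c) = if k = l then 1 else 0) := by
    intro k
    by_cases hk : k < K
    · obtain ⟨g, h1, h2⟩ := lagrange B (u k) (huB k hk).1 (huB k hk).2
      refine ⟨g, h1, fun _ l hl c => ?_⟩
      rw [h2 (enc u K l c) (u l) (huB l hl).1 (huB l hl).2]
      · by_cases hkl : k = l
        · simp [hkl]
        · rw [if_neg hkl, if_neg (fun h => hkl (hinj k hk l hl h))]
      · intro i hi
        simp only [hB, Finset.mem_filter] at hi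
        unfold enc
        rw [if_neg (by omega), if_neg (by omega)]
    · exact ⟨_, HQ.zero 2, fun h => absurd h hk⟩
  choose g hg1 hg2 using hlag
  let i0 : Fin N := ⟨0, by omega⟩
  let i1 : Fin N := ⟨1, by omega⟩
  let q : Fin N → (Fin N → ℚ) → ℚ := fun i x =>
    if i.val = 0 then g (K - 2) x else
    if i.val = 1 then (x i1 + x i0) - 2 * (x i0 * x i1) else
    (∑ k ∈ Finset.range (K - 1), (if i ∈ u (k + 1) then 1 else 0) * g k x) +
      (if i ∈ u j then 1 else 0) * (x i0 * (1 - x i1))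
  have hq : ∀ i, HQ 2 (q i) := by
    intro i
    by_cases h0 : i.val = 0
    · simp only [q, h0, if_true]; exact hg1 _
    · by_cases h1 : i.val = 1
      · simp only [q, h1, if_true]
        exact ((HQ.coord i1).add (HQ.coord i0)).up.sub (((HQ.coord i0).mul (HQ.coord i1)).smul 2)
      · simp only [q, h0, h1, if_false]
        exact (HQ.sum _ _ fun k _ => (hg1 k).smul _).add
          (((HQ.coord i0).mul ((HQ.const 1).sub (HQ.coord i1))).smul _)
  have e0 : ∀ k c, enc u K k c i0 = if k + 1 = K then 1 else 0 := by
    intro k c; simp [enc, i0]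
  have e1 : ∀ k c, enc u K k c i1 = c := by
    intro k c; simp [enc, i1]
  -- moving along the loop
  have stepA : ∀ k c i, k + 1 < K → q i (enc u K k c) = enc u K (k + 1) c i := by
    intro k c i hk
    by_cases h0 : i.val = 0
    · have hr : enc u K (k + 1) c i = if k + 1 + 1 = K then 1 else 0 := by simp only [enc, h0, if_true]
      rw [hr]
      simp only [q, h0, if_true]
      rw [hg2 (K - 2) (by omega) k (by omega) c]
      by_cases h : K - 2 = k
      · rw [if_pos h, if_pos (by omega)]
      · rw [if_neg h, if_neg (by omega)]
    · by_cases h1 : i.val = 1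
      · simp only [q, h1, if_true, e0, e1]
        rw [if_neg (by omega), if_neg (by omega)]
        simp [enc, h1]
      · simp only [q, h0, h1, if_false, e0, e1]
        rw [if_neg (show ¬ (k + 1 = K) by omega), zero_mul, mul_zero, add_zero]
        rw [Finset.sum_eq_single k]
        · rw [hg2 k (by omega) k (by omega) c, if_pos rfl, mul_one]
          simp [enc, h0, h1]
        · intro l hl hlk
          rw [Finset.mem_range] at hl
          rw [hg2 l (by omega) k (by omega) c, if_neg hlk, mul_zero]
        · intro h
          exact absurd (Finset.mem_range.2 (by omega)) h
  have hsum : ∀ (i : Fin N) c, ∑ k ∈ Finset.range (K - 1),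
      (if i ∈ u (k + 1) then (1 : ℚ) else 0) * g k (enc u K (K - 1) c) = 0 := by
    intro i c
    refine Finset.sum_eq_zero fun k hk => ?_
    rw [Finset.mem_range] at hk
    rw [hg2 k (by omega) (K - 1) (by omega) c, if_neg (show ¬ (k = K - 1) by omega), mul_zero]
  have hKK : K - 1 + 1 = K := by omega
  have stepB : ∀ i, q i (enc u K (K - 1) 0) = enc u K j 1 i := by
    intro i
    by_cases h0 : i.val = 0
    · simp only [q, h0, if_true]
      rw [hg2 (K - 2) (by omega) (K - 1) (by omega) 0, if_neg (by omega)]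
      simp only [enc, h0, if_true]
      rw [if_neg (by omega)]
    · by_cases h1 : i.val = 1
      · simp only [q, h1, if_true, e0, e1]
        simp [enc, h1, hKK]
      · simp only [q, h0, h1, if_false, e0, e1, hsum]
        simp [enc, h0, h1, hKK]
  have stepC : ∀ i, q i (enc u K (K - 1) 1) = enc u K 0 0 i := by
    intro i
    by_cases h0 : i.val = 0
    · simp only [q, h0, if_true]
      rw [hg2 (K - 2) (by omega) (K - 1) (by omega) 1, if_neg (by omega)]
      simp only [enc, h0, if_true]
      rw [if_neg (by omega)]
    · by_cases h1 : i.val = 1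
      · simp only [q, h1, if_true, e0, e1]
        simp [enc, h1, hKK]
        norm_num
      · simp only [q, h0, h1, if_false, e0, e1, hsum]
        simp [enc, h0, h1, hu0]
  have enc00 : enc u K 0 0 = fun _ => 0 := by
    funext i
    simp only [enc, hu0]
    rw [if_neg (show ¬ (0 + 1 = K) by omega)]
    simp
  let p : ℕ → Fin N → ℚ := fun r =>
    if r < K then enc u K r 0 else if r < n then enc u K (r - K + j) 1 else fun _ => 0
  refine good_of_bool N n (by omega) q hq p ?_ ?_ ?_ ?_ ?_
  · intro k hk i
    simp only [p]
    split_ifs <;> unfold enc <;> split_ifs <;> simp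
  · simp only [p]; rw [if_pos (by omega), enc00]
  · intro k hk i
    simp only [p]
    rcases lt_trichotomy (k + 1) K with h | h | h
    · rw [if_pos (by omega), if_pos h, stepA k 0 i h]
    · rw [if_pos (by omega), if_neg (by omega), if_pos (by omega)]
      obtain rfl : k = K - 1 := by omega
      rw [stepB, show K - 1 + 1 - K + j = j by omega]
    · rw [if_neg (by omega), if_pos hk, if_neg (by omega)]
      by_cases h2 : k + 1 < n
      · rw [if_pos h2, stepA _ _ _ (by omega), show k + 1 - K + j = k - K + j + 1 by omega]
      · rw [if_neg h2, show k - K + j = K - 1 by omega, stepC, enc00]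
  · simp only [p]; rw [if_neg (by omega), if_neg (by omega)]
  · intro k h1 h2 h
    simp only [p] at h
    by_cases hk : k < K
    · rw [if_pos hk] at h
      have hne : u k ≠ ∅ := by
        intro hh
        have := hinj k hk 0 (by omega) (by rw [hh, hu0])
        omega
      obtain ⟨i, hi⟩ := Finset.nonempty_iff_ne_empty.2 hne
      have h3 := congrFun h i
      have h4 := (huB k hk).1 hi
      simp only [hB, Finset.mem_filter] at h4
      unfold enc at h3
      rw [if_neg (by omega), if_neg (by omega), if_pos hi] at h3
      norm_num at h3
    · rw [if_neg hk, if_pos h2] at h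
      have h3 := congrFun h i1
      rw [e1] at h3
      norm_num at h3

lemma good_ge_ten (N : ℕ) (hN : 10 ≤ N) :
    (GoodSet N ((N + 1) * (N + 2) / 2 + (N - 1) / 2)).Infinite := by
  obtain ⟨M, rfl⟩ : ∃ M, N = M + 10 := ⟨N - 10, by omega⟩
  have a1 : (M + 10 + 1) * (M + 10 + 2) = M * M + 23 * M + 132 := by ring
  have a2 : (M + 10 - 2) * (M + 10 - 2 - 1) = M * M + 15 * M + 56 := by
    rw [show M + 10 - 2 = M + 8 by omega, show M + 8 - 1 = M + 7 by omega]; ring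
  rw [a1]
  generalize hn : (M * M + 23 * M + 132) / 2 + (M + 10 - 1) / 2 = n
  refine good_large (M + 10) n ((n + 1) / 2) (n % 2) (by omega) (by omega) (by omega) (by omega) ?_
  rw [a2]
  generalize M * M = w at *
  omega

/-- An orbit of period 11 in dimension three. -/
def tab3 : List (Fin 3 → ℚ) := [![0, 0, 0], ![0, -1, 0], ![-1, -1, 1], ![-2, 3, 3], ![0, 1, 0],
  ![1, 0, 1], ![0, 1, 1], ![1, 1, 1], ![1, 1, 0], ![1, 0, 0], ![0, 0, 1], ![0, 0, 0]]

lemma hom_mon {M : ℕ} (a : ℚ) (i j : Fin M) : (C a * (X i * X j)).IsHomogeneous 2 := by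
  simpa using (isHomogeneous_C (Fin M) a).mul ((isHomogeneous_X ℚ i).mul (isHomogeneous_X ℚ j))

lemma good3 : (GoodSet 3 11).Infinite := by
  refine infinite_of_good 3 11 (by norm_num)
    ![C (1/2) * (X 0 * X 3) + C 1 * (X 1 * X 3) + C (-1/2) * (X 0 * X 0),
      C (-1) * (X 3 * X 3) + C (-3/2) * (X 0 * X 3) + C (1/2) * (X 1 * X 3)
        + C (16/3) * (X 2 * X 3) + C (5/2) * (X 0 * X 0) + C (1/2) * (X 1 * X 1)
        + C (-13/3) * (X 2 * X 2) + C (-1) * (X 0 * X 1),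
      C (-3/2) * (X 0 * X 3) + C (17/3) * (X 2 * X 3) + C (5/2) * (X 0 * X 0) + C 1 * (X 1 * X 1)
        + C (-17/3) * (X 2 * X 2) + C (-2) * (X 0 * X 1)] ⟨?_, ?_, ?_⟩
  · intro i
    fin_cases i
    all_goals
      simp only [Fin.zero_eta, Fin.mk_one, Fin.reduceFinMk, Matrix.cons_val]
      repeat' apply IsHomogeneous.add
      all_goals exact hom_mon _ _ _
  · intro z hz hl
    have h3 : z 3 = 0 := by simpa using hl
    have f0 := hz 0
    have f1 := hz 1
    have f2 := hz 2
    simp only [Matrix.cons_val, map_add, map_mul, map_C, map_X, eval_C, eval_X, h3, eq_ratCast] at f0 f1 f2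
    push_cast at f0 f1 f2
    have z0 : z 0 = 0 := by
      have : z 0 ^ 2 = 0 := by linear_combination -2 * f0
      simpa using this
    simp only [z0] at f1 f2
    have z2 : z 2 = 0 := by
      have : z 2 ^ 2 = 0 := by linear_combination (-2 * f1 + f2) / 3
      simpa using this
    have z1 : z 1 = 0 := by
      have : z 1 ^ 2 = 0 := by rw [z2] at f2; linear_combination f2
      simpa using this
    funext i
    fin_cases i <;> simp [z0, z1, z2, h3]
  · have e : (fun _ => 0 : Fin 3 → ℚ) = (fun k => tab3.getD k 0) 0 := by
      funext i; fin_cases i <;> simp [tab3]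
    rw [e]
    apply minPer_of_orbit _ (fun k => tab3.getD k 0) 11 (by norm_num)
    · intro k hk
      funext i
      have s0 : ∀ x : Fin 3 → ℚ, (Fin.snoc x 1 : Fin 4 → ℚ) 0 = x 0 := fun _ => rfl
      have s1 : ∀ x : Fin 3 → ℚ, (Fin.snoc x 1 : Fin 4 → ℚ) 1 = x 1 := fun _ => rfl
      have s2 : ∀ x : Fin 3 → ℚ, (Fin.snoc x 1 : Fin 4 → ℚ) 2 = x 2 := fun _ => rfl
      have s3 : ∀ x : Fin 3 → ℚ, (Fin.snoc x 1 : Fin 4 → ℚ) 3 = 1 := fun _ => rfl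
      fin_cases i
      all_goals
        simp only [Fin.zero_eta, Fin.mk_one, Fin.reduceFinMk, Matrix.cons_val, map_add, map_mul,
          eval_C, eval_X, s0, s1, s2, s3]
        interval_cases k <;> decide +kernel
    · rfl
    · intro k h1 h2 h
      have h0 := congrFun h 0
      have h1' := congrFun h 1
      have h2' := congrFun h 2
      interval_cases k <;> first
        | exact absurd h0 (by decide +kernel)
        | exact absurd h1' (by decide +kernel)
        | exact absurd h2' (by decide +kernel)

/-- An orbit of period 16 in dimension four. -/
def tab4 : List (Fin 4 → ℚ) := [![0, 0, 0, 0], ![0, 0, 2, 0], ![0, 0, 1, 0], ![1, 0, 2, 0],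
  ![1, 1, 1, 1], ![0, 1, 1, 0], ![1, 0, 1, 0], ![0, 1, 2, 1],
  ![0, 0, 0, 1], ![0, 0, 2, 1], ![0, 0, 1, 1], ![1, 0, 2, 1],
  ![1, 1, 1, 0], ![0, 1, 1, 1], ![1, 0, 1, 1], ![0, 1, 2, 0], ![0, 0, 0, 0]]

lemma good4 : (GoodSet 4 16).Infinite := by
  refine infinite_of_good 4 16 (by norm_num)
    ![C 2 * (X 2 * X 4) + C (-1) * (X 2 * X 2) + C (-2) * (X 0 * X 4) + C 2 * (X 0 * X 2)
        + C (-1) * (X 0 * X 0),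
      C 1 * (X 0 * X 4) + C 1 * (X 1 * X 1) + C (-1) * (X 1 * X 4),
      C 2 * (X 4 * X 4) + C (1/2) * (X 2 * X 4) + C (-1/2) * (X 2 * X 2) + C (-1) * (X 1 * X 4),
      C 1 * (X 3 * X 3) + C 1 * (X 0 * X 4) + C (-2) * (X 3 * X 0)] ⟨?_, ?_, ?_⟩
  · intro i
    fin_cases i
    all_goals
      simp only [Fin.zero_eta, Fin.mk_one, Fin.reduceFinMk, Matrix.cons_val]
      repeat' apply IsHomogeneous.add
      all_goals exact hom_mon _ _ _
  · intro z hz hl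
    have h4 : z 4 = 0 := by simpa using hl
    have f0 := hz 0
    have f1 := hz 1
    have f2 := hz 2
    have f3 := hz 3
    simp only [Matrix.cons_val, map_add, map_mul, map_C, map_X, eval_C, eval_X, h4, eq_ratCast] at f0 f1 f2 f3
    push_cast at f0 f1 f2 f3
    have z2 : z 2 = 0 := by
      have : z 2 ^ 2 = 0 := by linear_combination -2 * f2
      simpa using this
    have z1 : z 1 = 0 := by
      have : z 1 ^ 2 = 0 := by linear_combination f1
      simpa using this
    have z0 : z 0 = 0 := by
      have : z 0 ^ 2 = 0 := by rw [z2] at f0; linear_combination - f0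
      simpa using this
    have z3 : z 3 = 0 := by
      have : z 3 ^ 2 = 0 := by rw [z0] at f3; linear_combination f3
      simpa using this
    funext i
    fin_cases i <;> simp [z0, z1, z2, z3, h4]
  · have e : (fun _ => 0 : Fin 4 → ℚ) = (fun k => tab4.getD k 0) 0 := by
      funext i; fin_cases i <;> simp [tab4]
    rw [e]
    apply minPer_of_orbit _ (fun k => tab4.getD k 0) 16 (by norm_num)
    · intro k hk
      funext i
      have s0 : ∀ x : Fin 4 → ℚ, (Fin.snoc x 1 : Fin 5 → ℚ) 0 = x 0 := fun _ => rfl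
      have s1 : ∀ x : Fin 4 → ℚ, (Fin.snoc x 1 : Fin 5 → ℚ) 1 = x 1 := fun _ => rfl
      have s2 : ∀ x : Fin 4 → ℚ, (Fin.snoc x 1 : Fin 5 → ℚ) 2 = x 2 := fun _ => rfl
      have s3 : ∀ x : Fin 4 → ℚ, (Fin.snoc x 1 : Fin 5 → ℚ) 3 = x 3 := fun _ => rfl
      have s4 : ∀ x : Fin 4 → ℚ, (Fin.snoc x 1 : Fin 5 → ℚ) 4 = 1 := fun _ => rfl
      fin_cases i
      all_goals
        simp only [Fin.zero_eta, Fin.mk_one, Fin.reduceFinMk, Matrix.cons_val, map_add, map_mul,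
          eval_C, eval_X, s0, s1, s2, s3, s4]
        interval_cases k <;> decide +kernel
    · rfl
    · intro k h1 h2 h
      have h0 := congrFun h 0
      have h1' := congrFun h 1
      have h2' := congrFun h 2
      have h3' := congrFun h 3
      interval_cases k <;> first
        | exact absurd h0 (by decide +kernel)
        | exact absurd h1' (by decide +kernel)
        | exact absurd h2' (by decide +kernel)
        | exact absurd h3' (by decide +kernel)


/-- For every `N ≥ 3`, the set of tuples of homogeneous quadratic forms
`(F₀, …, F_{N-1})` in `N+1` variables over `ℚ` which, together with `X_N²`, have
no common zero in `ℂ^{N+1}` other than the origin and for which `0 ∈ ℚ^N` has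
minimal period exactly `(N+1)(N+2)/2 + ⌊(N-1)/2⌋` under the associated affine
map is infinite. -/
theorem infinite_morphism_forms_with_period (N : ℕ) (hN : 3 ≤ N) :
    {F : Fin N → MvPolynomial (Fin (N + 1)) ℚ |
      (∀ i : Fin N, (F i).IsHomogeneous 2) ∧
      (∀ z : Fin (N + 1) → ℂ,
        (∀ i : Fin N,
          MvPolynomial.eval z (MvPolynomial.map (algebraMap ℚ ℂ) (F i)) = 0) →
        z (Fin.last N) ^ 2 = 0 → z = 0) ∧
      Function.minimalPeriod
        (fun (x : Fin N → ℚ) (i : Fin N) => MvPolynomial.eval (Fin.snoc x 1) (F i))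
        (fun _ => 0) = (N + 1) * (N + 2) / 2 + (N - 1) / 2}.Infinite := by

  change (GoodSet N ((N + 1) * (N + 2) / 2 + (N - 1) / 2)).Infinite
  by_cases h : 10 ≤ N
  · exact good_ge_ten N h
  · interval_cases N
    · exact good3
    · exact good4
    · exact good5
    · exact good6
    · exact good7
    · exact good8
    · exact good9
end

section
/- There exist homogeneous quadratic forms F_0, F_1 in MvPolynomial (Fin 3) ℚ such that F_0, F_1, X_2^2 have no common zero in ℂ^3 other than the origin and such that the point (0,0) ∈ ℚ^2 has minimal period exactly 7 under the affine map (x_0, x_1) ↦ (F_0(x_0, x_1, 1), F_1(x_0, x_1, 1)). -/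
open MvPolynomial

/-- There exist homogeneous quadratic forms `F₀, F₁` in three variables over `ℚ`
such that `F₀, F₁, X₂²` have no common zero in `ℂ³` other than the origin and
such that `(0,0) ∈ ℚ²` has minimal period exactly `7` under the affine map
`(x₀, x₁) ↦ (F₀(x₀,x₁,1), F₁(x₀,x₁,1))`. -/
theorem exists_morphism_forms_P2_period_seven :
    ∃ F : Fin 2 → MvPolynomial (Fin 3) ℚ,
      (∀ i : Fin 2, (F i).IsHomogeneous 2) ∧
      (∀ z : Fin 3 → ℂ,
        (∀ i : Fin 2,
          MvPolynomial.eval z (MvPolynomial.map (algebraMap ℚ ℂ) (F i)) = 0) →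
        z (Fin.last 2) ^ 2 = 0 → z = 0) ∧
      Function.minimalPeriod
        (fun (x : Fin 2 → ℚ) (i : Fin 2) => MvPolynomial.eval (Fin.snoc x 1) (F i))
        (fun _ => 0) = 7 := by
  refine ⟨![C 1 * (X 2 * X 2) + C (-1/2) * (X 1 * X 2) + C (-1) * (X 0 * X 0)
      + C 2 * (X 0 * X 1) + C (-3/2) * (X 1 * X 1),
      C (-1) * (X 1 * X 2) + C 1 * (X 0 * X 0) + C (-1) * (X 1 * X 1)], ?_, ?_, ?_⟩
  · have h : ∀ (c : ℚ) (i j : Fin 3),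
        (C c * (X i * X j) : MvPolynomial (Fin 3) ℚ).IsHomogeneous 2 := by
      intro c i j
      exact ((isHomogeneous_X ℚ i).mul (isHomogeneous_X ℚ j)).C_mul c
    intro i
    fin_cases i
    · exact ((((h _ _ _).add (h _ _ _)).add (h _ _ _)).add (h _ _ _)).add (h _ _ _)
    · exact ((h _ _ _).add (h _ _ _)).add (h _ _ _)
  · intro z hz h2
    have e2 : z 2 = 0 := by simpa using h2
    have e0 := hz 0
    have e1 := hz 1
    simp [e2] at e0 e1
    have a1 : z 0 * z 0 = z 1 * z 1 := by linear_combination e1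
    have a2 : 4 * (z 0 * z 1) = 5 * (z 1 * z 1) := by linear_combination 2 * e0 + 2 * a1
    have a3 : (z 1) ^ 4 = 0 := by
      linear_combination (-1/9) * (4 * (z 0 * z 1) + 5 * (z 1 * z 1)) * (-a2) * (-1)
        + (-1/9) * (-16) * (z 1 * z 1) * a1
    have y0 : z 1 = 0 := by simpa using a3
    have x0 : z 0 = 0 := by simpa [y0] using a1
    funext i
    fin_cases i
    · exact x0
    · exact y0
    · exact e2
  · set f : (Fin 2 → ℚ) → (Fin 2 → ℚ) := _
    change Function.minimalPeriod f _ = 7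
    have hf : ∀ a b : ℚ, f ![a, b] =
        ![1 - b / 2 - a * a + 2 * (a * b) - 3 / 2 * (b * b), - b + a * a - b * b] := by
      intro a b
      funext i
      have s0 : (Fin.snoc ![a, b] 1 : Fin 3 → ℚ) 0 = a := rfl
      have s1 : (Fin.snoc ![a, b] 1 : Fin 3 → ℚ) 1 = b := rfl
      have s2 : (Fin.snoc ![a, b] 1 : Fin 3 → ℚ) 2 = 1 := rfl
      fin_cases i
      · simp [f, s0, s1, s2]; ring
      · simp [f, s0, s1, s2]; ring
    have hz : (fun _ => 0 : Fin 2 → ℚ) = ![0, 0] := by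
      funext i; fin_cases i <;> rfl
    rw [hz]
    have : Fact (Nat.Prime 7) := ⟨by norm_num⟩
    apply Function.minimalPeriod_eq_prime
    · change f (f (f (f (f (f (f ![0, 0])))))) = ![0, 0]
      norm_num [hf]
    · intro h
      have h' : f ![0, 0] = ![0, 0] := h
      rw [hf] at h'
      have := congrFun h' 0
      norm_num at this
end

section
/- For every natural number k there exist a real constant c > 0 and a natural number N_0 such that for all N ≥ N_0 there exist homogeneous quadratic forms F_0, …, F_{N-1} in MvPolynomial (Fin (N+1)) ℚ with the properties: (i) F_0, …, F_{N-1}, X_N^2 have no common zero in ℂ^{N+1} other than the origin, and (ii) some point P ∈ ℚ^N is periodic under the affine map x ↦ (F_0(x,1), …, F_{N-1}(x,1)) with minimal period strictly greater than c · N^k. -/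
open Equiv in
/-- A permutation of `Fin N` whose order is large. -/
lemma exists_perm_large_order (k s N : ℕ) (hs : 1 ≤ s)
    (hN : k * (k + 1) * k.factorial * s ≤ N) :
    ∃ σ : Perm (Fin N), s ^ k ≤ orderOf σ := by
  set t := k.factorial * s with ht
  have htpos : s ≤ t := Nat.le_mul_of_pos_left _ k.factorial_pos
  let f : ℕ → ℕ := fun i => (i + 1) * t + 1
  have hf : ∀ i, t ≤ f i := fun i => by simp only [f]; nlinarith
  have hf2 : ∀ i, 2 ≤ f i := fun i => by simp only [f]; nlinarith
  have hsum : ∑ i ∈ Finset.range k, f i ≤ N := by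
    have h1 : ∑ i ∈ Finset.range k, f i ≤ ∑ i ∈ Finset.range k, (k + 1) * t := by
      refine Finset.sum_le_sum fun i hi => ?_
      have := Finset.mem_range.1 hi
      simp only [f]; nlinarith
    refine h1.trans (le_trans (le_of_eq ?_) hN)
    simp [ht]; ring
  have hcop : Set.Pairwise (Finset.range k : Set ℕ) (Nat.Coprime.onFun f) := by
    have key : ∀ i j, i < j → j < k → Nat.Coprime (f i) (f j) := by
      intro i j hij hj
      apply Nat.coprime_mul_succ
      exact (Nat.dvd_factorial (by omega) (by omega)).trans (Dvd.intro _ rfl)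
    intro i hi j hj hij
    have hi' : i < k := by simpa using hi
    have hj' : j < k := by simpa using hj
    rcases lt_or_gt_of_ne hij with h | h
    · exact key i j h hj'
    · exact (key j i h hi').symm
  obtain ⟨σ, hσ⟩ := (Equiv.Perm.exists_with_cycleType_iff (Fin N)
    (m := (Finset.range k).val.map f)).2 ⟨by rw [Fintype.card_fin]; exact hsum, by
      intro a ha
      obtain ⟨i, -, rfl⟩ := Multiset.mem_map.1 ha
      exact hf2 i⟩
  refine ⟨σ, ?_⟩
  rw [← Equiv.Perm.lcm_cycleType, hσ, ← Finset.lcm_def, Finset.lcm_eq_prod hcop]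
  calc s ^ k = ∏ i ∈ Finset.range k, s := by simp
    _ ≤ _ := Finset.prod_le_prod' fun i _ => htpos.trans (hf i)

/-- A `0/1` vector (indicator of a transversal of the cycles) which determines
when a power of `σ` is trivial. -/
lemma exists_transversal_indicator {N : ℕ} (σ : Equiv.Perm (Fin N)) :
    ∃ P : Fin N → ℚ, (∀ i, P i ^ 2 = P i) ∧
      ∀ n : ℕ, (∀ i, P ((σ ^ n) i) = P i) → σ ^ n = 1 := by
  classical
  let S := Equiv.Perm.SameCycle.setoid σ
  let r : Fin N → Fin N := fun x => (Quotient.mk S x).out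
  have hr : ∀ x, σ.SameCycle (r x) x := fun x => Quotient.mk_out (s := S) x
  have hinv : ∀ x y, σ.SameCycle x y → r x = r y := fun x y h => by
    have : Quotient.mk S x = Quotient.mk S y := Quotient.sound h
    simp only [r, this]
  refine ⟨fun x => if r x = x then 1 else 0, fun i => by dsimp only; split_ifs <;> norm_num, ?_⟩
  intro n hn
  ext1 x
  have h1 : r (r x) = r x := hinv _ _ (hr x)
  have h2 := hn (r x)
  simp only [h1, if_true] at h2
  have h3 : r ((σ ^ n) (r x)) = (σ ^ n) (r x) := by
    by_contra h
    simp [h] at h2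
  have h4 : r ((σ ^ n) (r x)) = r (r x) :=
    (hinv _ _ ⟨n, by simp⟩).symm
  have h5 : (σ ^ n) (r x) = r x := by rw [← h3, h4, h1]
  obtain ⟨j, hj⟩ := hr x
  rw [← hj, ← Equiv.Perm.mul_apply, ((Commute.refl σ).pow_left n |>.zpow_right j).eq,
    Equiv.Perm.mul_apply, h5]
  rfl

/-- For every natural number `k` there exist a constant `c > 0` and `N₀` such
that for all `N ≥ N₀` there are homogeneous quadratic forms `F₀, …, F_{N-1}` in
`N+1` variables over `ℚ` which, together with `X_N²`, have no common zero in
`ℂ^{N+1}` other than the origin, and some `P ∈ ℚ^N` is periodic under the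
associated affine map with minimal period strictly greater than `c · N^k`. -/
theorem exists_morphisms_with_large_periods (k : ℕ) :
    ∃ c : ℝ, 0 < c ∧ ∃ N₀ : ℕ, ∀ N : ℕ, N₀ ≤ N →
      ∃ F : Fin N → MvPolynomial (Fin (N + 1)) ℚ,
        (∀ i : Fin N, (F i).IsHomogeneous 2) ∧
        (∀ z : Fin (N + 1) → ℂ,
          (∀ i : Fin N,
            MvPolynomial.eval z (MvPolynomial.map (algebraMap ℚ ℂ) (F i)) = 0) →
          z (Fin.last N) ^ 2 = 0 → z = 0) ∧
        ∃ P : Fin N → ℚ,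
          0 < Function.minimalPeriod
            (fun (x : Fin N → ℚ) (i : Fin N) =>
              MvPolynomial.eval (Fin.snoc x 1) (F i)) P ∧
          c * (N : ℝ) ^ k <
            (Function.minimalPeriod
              (fun (x : Fin N → ℚ) (i : Fin N) =>
                MvPolynomial.eval (Fin.snoc x 1) (F i)) P : ℝ) := by
  classical
  set D : ℕ := k * (k + 1) * k.factorial + 1 with hD
  have hDpos : (0 : ℝ) < D := by exact_mod_cast Nat.succ_pos _
  refine ⟨1 / (2 * (2 * (D : ℝ)) ^ k), by positivity, D, fun N hN => ?_⟩
  have hs : 1 ≤ N / D := (Nat.one_le_div_iff (Nat.succ_pos _)).2 hN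
  have hNs : D * (N / D) ≤ N := Nat.mul_div_le N D
  have hNlt : N < D * (N / D + 1) := Nat.lt_mul_div_succ N (Nat.succ_pos _)
  set s := N / D
  obtain ⟨σ, hσ⟩ := exists_perm_large_order k s N hs (by nlinarith)
  obtain ⟨P, hP, hPσ⟩ := exists_transversal_indicator σ
  refine ⟨fun i => MvPolynomial.X (σ i).castSucc ^ 2, fun i => ?_, fun z hz hl => ?_, P, ?_⟩
  · simpa using (MvPolynomial.isHomogeneous_X ℚ (σ i).castSucc).pow 2
  · funext j
    refine Fin.lastCases ?_ (fun i => ?_) j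
    · simpa using hl
    · simpa using hz (σ.symm i)
  have hfun : (fun (x : Fin N → ℚ) (i : Fin N) =>
      MvPolynomial.eval (Fin.snoc x 1 : Fin (N + 1) → ℚ)
        (MvPolynomial.X (σ i).castSucc ^ 2)) = fun x i => x (σ i) ^ 2 := by
    funext x i
    simp
  rw [hfun]
  set f : (Fin N → ℚ) → (Fin N → ℚ) := fun x i => x (σ i) ^ 2 with hf
  have hit : ∀ n : ℕ, f^[n] P = fun i => P ((σ ^ n) i) := by
    intro n
    induction n with
    | zero => simp
    | succ n ih =>
      rw [Function.iterate_succ_apply', ih]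
      funext i
      simp only [hf, hP]
      rw [pow_succ, Equiv.Perm.mul_apply]
  have hper : Function.IsPeriodicPt f (orderOf σ) P := by
    unfold Function.IsPeriodicPt Function.IsFixedPt
    rw [hit, pow_orderOf_eq_one]
    rfl
  have hpos : 0 < Function.minimalPeriod f P := hper.minimalPeriod_pos (orderOf_pos σ)
  refine ⟨hpos, ?_⟩
  have hle : orderOf σ ≤ Function.minimalPeriod f P := by
    apply orderOf_le_of_pow_eq_one hpos
    apply hPσ
    have h := Function.isPeriodicPt_minimalPeriod f P
    unfold Function.IsPeriodicPt Function.IsFixedPt at h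
    rw [hit] at h
    exact fun i => congrFun h i
  have hfin : ((s : ℝ)) ^ k ≤ (Function.minimalPeriod f P : ℝ) := by
    exact_mod_cast hσ.trans hle
  have hN2 : (N : ℝ) ≤ 2 * D * s := by
    have : N ≤ 2 * D * s := by nlinarith
    exact_mod_cast this
  have hspos : (0 : ℝ) < s := by exact_mod_cast hs
  have hpw : (N : ℝ) ^ k ≤ (2 * (D : ℝ)) ^ k * (s : ℝ) ^ k := by
    rw [← mul_pow]
    exact pow_le_pow_left₀ (by positivity) hN2 k
  refine lt_of_lt_of_le ?_ hfin
  have hA : (0 : ℝ) < (2 * (D : ℝ)) ^ k := by positivity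
  have hB : (0 : ℝ) < (s : ℝ) ^ k := by positivity
  rw [one_div, inv_mul_lt_iff₀ (by positivity)]
  nlinarith [mul_pos hA hB]
end

section
/- For every natural number N ≥ 2 there exists a quadratic map f on ℚ^N with the following property. Enumerate the pairs (ℓ, s) with 1 ≤ ℓ ≤ N and 0 ≤ s ≤ N − ℓ in order of increasing ℓ, and for fixed ℓ in order of increasing s; for the j-th pair (ℓ, s) in this enumeration (1 ≤ j ≤ N(N+1)/2), let w_j ∈ ℚ^N be the vector whose i-th coordinate equals 1 if s ≤ i ≤ s + ℓ − 1 and 0 otherwise. Then the j-th iterate f^[j](0) of the point 0 = (0,…,0) equals w_j for every j = 1, …, N(N+1)/2. (In particular the orbit of 0 runs through 0 → e_0 → e_1 → ⋯ → e_{N-1} → e_0 + e_1 → ⋯ → (1,1,…,1).) -/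
open MvPolynomial in
/-- The `k`-th variable, or `0` when `k` is out of range. -/
noncomputable def qvar (N k : ℕ) : MvPolynomial (Fin N) ℚ :=
  if h : k < N then X ⟨k, h⟩ else 0

/-- The `i`-th coordinate polynomial of the map. -/
noncomputable def qpoly (N i : ℕ) : MvPolynomial (Fin N) ℚ :=
  if i = 0 then 1 - ∑ a ∈ Finset.range N, qvar N a * (1 - qvar N (a + 1)) + qvar N (N - 1)
  else qvar N (i - 1) * (1 - qvar N (N - 1)) + qvar N (N - 1) * qvar N (N - i)

/-- Indicator vector of the interval of length `l` that starts at `s`. -/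
def wvec (N l s : ℕ) : Fin N → ℚ := fun i => if s ≤ i.val ∧ i.val ≤ s + l - 1 then 1 else 0

/-- The quadratic map. -/
noncomputable def qmap (N : ℕ) (x : Fin N → ℚ) : Fin N → ℚ :=
  fun i => MvPolynomial.eval x (qpoly N i.val)

lemma qvar_deg (N k : ℕ) : (qvar N k).totalDegree ≤ 1 := by
  unfold qvar; split_ifs <;> simp

lemma one_sub_qvar_deg (N k : ℕ) : (1 - qvar N k).totalDegree ≤ 1 := by
  refine (MvPolynomial.totalDegree_sub _ _).trans ?_
  simp [qvar_deg]

lemma deg_mul_two {N : ℕ} {p q : MvPolynomial (Fin N) ℚ} (hp : p.totalDegree ≤ 1)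
    (hq : q.totalDegree ≤ 1) : (p * q).totalDegree ≤ 2 :=
  (MvPolynomial.totalDegree_mul _ _).trans (by omega)

lemma qpoly_deg (N i : ℕ) : (qpoly N i).totalDegree ≤ 2 := by
  unfold qpoly
  split_ifs
  · refine (MvPolynomial.totalDegree_add _ _).trans (max_le ?_ ((qvar_deg _ _).trans (by omega)))
    refine (MvPolynomial.totalDegree_sub _ _).trans (max_le (by simp) ?_)
    exact MvPolynomial.totalDegree_finsetSum_le
      (fun a _ => deg_mul_two (qvar_deg _ _) (one_sub_qvar_deg _ _))
  · exact (MvPolynomial.totalDegree_add _ _).trans (max_le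
      (deg_mul_two (qvar_deg _ _) (one_sub_qvar_deg _ _))
      (deg_mul_two (qvar_deg _ _) (qvar_deg _ _)))

lemma eval_qvar_wvec (N l s k : ℕ) (hl : 1 ≤ l) (h : s + l ≤ N) :
    MvPolynomial.eval (wvec N l s) (qvar N k) = if s ≤ k ∧ k < s + l then 1 else 0 := by
  unfold qvar
  split_ifs <;> simp [wvec] <;> omega

lemma eval_qsum (N l s : ℕ) (hl : 1 ≤ l) (h : s + l ≤ N) :
    ∑ a ∈ Finset.range N, (if s ≤ a ∧ a < s + l then (1 : ℚ) else 0) *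
      (1 - if s ≤ a + 1 ∧ a + 1 < s + l then (1 : ℚ) else 0) = 1 := by
  rw [Finset.sum_eq_single (s + l - 1)]
  · rw [if_pos (by omega), if_neg (by omega)]; norm_num
  · intro b _ hb
    split_ifs <;> first | omega | norm_num
  · intro hb
    simp only [Finset.mem_range] at hb
    omega

lemma qmap_wvec (N l s : ℕ) (hl : 1 ≤ l) (h : s + l ≤ N) (i : Fin N) :
    qmap N (wvec N l s) i =
      if i.val = 0 then (if s + l = N then 1 else 0)
      else if s + l = N then (if s ≤ N - i.val then 1 else 0)
      else if s + 1 ≤ i.val ∧ i.val ≤ s + l then 1 else 0 := by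
  have hi := i.isLt
  unfold qmap qpoly
  by_cases h0 : i.val = 0
  · simp only [h0, if_true, map_add, map_sub, map_one, map_sum, map_mul, eval_qvar_wvec N l s _ hl h,
      eval_qsum N l s hl h]
    split_ifs <;> first | omega | norm_num
  · simp only [h0, if_false, map_add, map_sub, map_one, map_mul, eval_qvar_wvec N l s _ hl h]
    split_ifs <;> first | omega | norm_num

lemma qmap_zero (N : ℕ) : qmap N (fun _ => 0) = wvec N 1 0 := by
  have hv : ∀ k, MvPolynomial.eval (fun _ => 0) (qvar N k) = 0 := by
    intro k; unfold qvar; split_ifs <;> simp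
  funext i
  unfold qmap qpoly wvec
  by_cases h0 : i.val = 0
  · simp only [h0, hv, if_true, if_false, map_add, map_sub, map_one, map_sum, map_mul]; simp
  · simp only [h0, hv, if_true, if_false, map_add, map_sub, map_one, map_sum, map_mul]; simp [h0]

lemma qmap_shift (N l s : ℕ) (hl : 1 ≤ l) (h : s + l < N) :
    qmap N (wvec N l s) = wvec N l (s + 1) := by
  funext i
  rw [qmap_wvec N l s hl h.le]
  unfold wvec
  split_ifs <;> first | rfl | omega

lemma qmap_wrap (N l s : ℕ) (hl : 1 ≤ l) (h : s + l = N) (hs : 1 ≤ s) :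
    qmap N (wvec N l s) = wvec N (l + 1) 0 := by
  funext i
  have hi := i.isLt
  rw [qmap_wvec N l s hl h.le]
  unfold wvec
  split_ifs <;> first | rfl | omega

lemma orbit_shift (N l j : ℕ) (hl : 1 ≤ l)
    (h0 : (qmap N)^[j] (fun _ => 0) = wvec N l 0) (s : ℕ) (h : s + l ≤ N) :
    (qmap N)^[j + s] (fun _ => 0) = wvec N l s := by
  induction s with
  | zero => exact h0
  | succ s ih =>
    rw [← add_assoc, Function.iterate_succ_apply', ih (by omega), qmap_shift N l s hl (by omega)]

lemma index_step (N m : ℕ) (h : m + 1 < N) :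
    (m + 1) * (N + 1) - (m + 1) * (m + 2) / 2 = m * (N + 1) - m * (m + 1) / 2 + (N - m) := by
  have e : (m + 1) * (m + 2) / 2 = m * (m + 1) / 2 + (m + 1) := by
    rw [show (m + 1) * (m + 2) = m * (m + 1) + (m + 1) * 2 by ring]
    exact Nat.add_mul_div_right _ _ (by norm_num)
  have b : m * (m + 1) / 2 ≤ m * (N + 1) :=
    (Nat.div_le_self _ _).trans (Nat.mul_le_mul_left _ (by omega))
  have c : (m + 1) * (N + 1) = m * (N + 1) + (N + 1) := by ring
  omega

lemma orbit_start (N m : ℕ) (h : m < N) :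
    (qmap N)^[m * (N + 1) - m * (m + 1) / 2 + 1] (fun _ => 0) = wvec N (m + 1) 0 := by
  induction m with
  | zero => simpa using qmap_zero N
  | succ m ih =>
    have h1 := orbit_shift N (m + 1) _ (by omega) (ih (by omega)) (N - (m + 1)) (by omega)
    have e : (m + 1) * (N + 1) - (m + 1) * (m + 1 + 1) / 2 + 1
        = (m * (N + 1) - m * (m + 1) / 2 + 1 + (N - (m + 1))) + 1 := by
      have := index_step N m h
      rw [show m + 1 + 1 = m + 2 from rfl]
      omega
    rw [e, Function.iterate_succ_apply', h1]
    exact qmap_wrap N (m + 1) _ (by omega) (by omega) (by omega)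

/-- For every `N ≥ 2` there is a quadratic map `f` on `ℚ^N` whose orbit of `0`
runs through the prescribed sequence of 0-1 vectors: enumerating the pairs
`(ℓ, s)` with `1 ≤ ℓ ≤ N` and `0 ≤ s ≤ N - ℓ` first by `ℓ` and then by `s`, the
pair `(ℓ, s)` is the `j`-th pair with `j = (ℓ-1)(N+1) - (ℓ-1)ℓ/2 + s + 1`, and
the `j`-th iterate of `0` under `f` is the vector with `1` in coordinates
`s, …, s + ℓ - 1` and `0` elsewhere. -/
theorem exists_quadratic_map_with_prescribed_orbit (N : ℕ) (hN : 2 ≤ N) :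
    ∃ f : (Fin N → ℚ) → (Fin N → ℚ),
      (∀ i : Fin N, ∃ p : MvPolynomial (Fin N) ℚ,
        p.totalDegree ≤ 2 ∧ ∀ x : Fin N → ℚ, f x i = MvPolynomial.eval x p) ∧
      ∀ ℓ s : ℕ, 1 ≤ ℓ → ℓ ≤ N → s ≤ N - ℓ →
        f^[(ℓ - 1) * (N + 1) - (ℓ - 1) * ℓ / 2 + s + 1] (fun _ => 0) =
          fun i : Fin N => if s ≤ i.val ∧ i.val ≤ s + ℓ - 1 then 1 else 0 := by

  refine ⟨qmap N, fun i => ⟨qpoly N i.val, qpoly_deg _ _, fun _ => rfl⟩, ?_⟩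
  intro l s hl hlN hs
  obtain ⟨m, rfl⟩ : ∃ m, l = m + 1 := ⟨l - 1, by omega⟩
  have h := orbit_shift N (m + 1) _ hl (orbit_start N m (by omega)) s (by omega)
  rw [Nat.add_sub_cancel, add_right_comm]
  exact h
end

section
/- Let N, M ≥ 1. Suppose F_0, …, F_{N-1} are homogeneous quadratic forms in MvPolynomial (Fin (N+1)) ℚ such that F_0, …, F_{N-1}, X_N^2 have no common zero in ℂ^{N+1} other than the origin, and G_0, …, G_{M-1} are homogeneous quadratic forms in MvPolynomial (Fin (M+1)) ℚ such that G_0, …, G_{M-1}, X_M^2 have no common zero in ℂ^{M+1} other than the origin. Form the N+M forms in the N+M+1 variables x_0, …, x_{N+M} obtained by substituting in each F_i the variables (x_0, …, x_{N-1}, x_{N+M}) and in each G_j the variables (x_N, …, x_{N+M-1}, x_{N+M}). Then these N+M forms together with X_{N+M}^2 have no common zero in ℂ^{N+M+1} other than the origin. -/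
/-- If the forms `F₀, …, F_{N-1}, X_N²` over `ℚ` have no nontrivial common zero
in `ℂ^{N+1}` and the forms `G₀, …, G_{M-1}, X_M²` have no nontrivial common zero
in `ℂ^{M+1}`, then the `N+M` forms in `N+M+1` variables obtained by substituting
into the `F_i` the variables `(x₀, …, x_{N-1}, x_{N+M})` and into the `G_j` the
variables `(x_N, …, x_{N+M-1}, x_{N+M})`, together with `X_{N+M}²`, have no
nontrivial common zero in `ℂ^{N+M+1}`. -/
theorem combined_forms_no_common_zero (N M : ℕ) (hN : 1 ≤ N) (hM : 1 ≤ M)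
    (F : Fin N → MvPolynomial (Fin (N + 1)) ℚ)
    (G : Fin M → MvPolynomial (Fin (M + 1)) ℚ)
    (hFhom : ∀ i : Fin N, (F i).IsHomogeneous 2)
    (hGhom : ∀ j : Fin M, (G j).IsHomogeneous 2)
    (hF : ∀ z : Fin (N + 1) → ℂ,
      (∀ i : Fin N,
        MvPolynomial.eval z (MvPolynomial.map (algebraMap ℚ ℂ) (F i)) = 0) →
      z (Fin.last N) ^ 2 = 0 → z = 0)
    (hG : ∀ z : Fin (M + 1) → ℂ,
      (∀ j : Fin M,
        MvPolynomial.eval z (MvPolynomial.map (algebraMap ℚ ℂ) (G j)) = 0) →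
      z (Fin.last M) ^ 2 = 0 → z = 0) :
    ∀ z : Fin (N + M + 1) → ℂ,
      (∀ i : Fin (N + M),
        MvPolynomial.eval z (MvPolynomial.map (algebraMap ℚ ℂ)
          (Fin.addCases
            (fun i₁ : Fin N => MvPolynomial.rename
              (Fin.snoc (fun j : Fin N => (Fin.castLE (by omega) j : Fin (N + M + 1)))
                (Fin.last (N + M))) (F i₁))
            (fun j₁ : Fin M => MvPolynomial.rename
              (Fin.snoc (fun l : Fin M => (⟨N + l.val, by omega⟩ : Fin (N + M + 1)))
                (Fin.last (N + M))) (G j₁))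
            i)) = 0) →
      z (Fin.last (N + M)) ^ 2 = 0 → z = 0 := by
  intro z hz hl
  have h1 := hF (z ∘ Fin.snoc (α := fun _ => Fin (N + M + 1))
      (fun j : Fin N => (Fin.castLE (by omega) j : Fin (N + M + 1))) (Fin.last (N + M)))
    (fun i => by
      have h := hz (Fin.castAdd M i)
      rw [Fin.addCases_left, MvPolynomial.map_rename, MvPolynomial.eval_rename] at h
      exact h)
    (by simpa using hl)
  have h2 := hG (z ∘ Fin.snoc (α := fun _ => Fin (N + M + 1))
      (fun l : Fin M => (⟨N + l.val, by omega⟩ : Fin (N + M + 1))) (Fin.last (N + M)))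
    (fun i => by
      have h := hz (Fin.natAdd N i)
      rw [Fin.addCases_right, MvPolynomial.map_rename, MvPolynomial.eval_rename] at h
      exact h)
    (by simpa using hl)
  funext k
  obtain ⟨k, hk⟩ := k
  by_cases hkN : k < N
  · have h := congrFun h1 (Fin.castSucc ⟨k, hkN⟩)
    rw [Function.comp_apply, Fin.snoc_castSucc] at h
    exact h
  by_cases hkM : k < N + M
  · have h := congrFun h2 (Fin.castSucc ⟨k - N, by omega⟩)
    have e : N + (k - N) = k := by omega
    rw [Function.comp_apply, Fin.snoc_castSucc] at h
    simpa [e] using h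
  · have e : k = N + M := by omega
    subst e
    exact pow_eq_zero_iff (two_ne_zero) |>.mp hl
end

section
/- Let N, M ≥ 1. Suppose F_0, …, F_{N-1} are homogeneous quadratic forms in MvPolynomial (Fin (N+1)) ℚ such that F_0, …, F_{N-1}, X_N^2 have no common zero in ℂ^{N+1} other than the origin, and that P_1 ∈ ℚ^N is periodic with minimal period n under the affine map x ↦ (F_0(x,1), …, F_{N-1}(x,1)). Suppose likewise G_0, …, G_{M-1} are homogeneous quadratic forms in MvPolynomial (Fin (M+1)) ℚ such that G_0, …, G_{M-1}, X_M^2 have no common zero in ℂ^{M+1} other than the origin, and that P_2 ∈ ℚ^M is periodic with minimal period m under x ↦ (G_0(x,1), …, G_{M-1}(x,1)). Then there exist homogeneous quadratic forms H_0, …, H_{N+M-1} in MvPolynomial (Fin (N+M+1)) ℚ such that H_0, …, H_{N+M-1}, X_{N+M}^2 have no common zero in ℂ^{N+M+1} other than the origin, and the point (P_1, P_2) ∈ ℚ^{N+M} is periodic with minimal period exactly lcm(n, m) under the affine map x ↦ (H_0(x,1), …, H_{N+M-1}(x,1)). -/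
/-- Given morphism-defining quadratic forms on `ℙ^N` with `P₁ ∈ ℚ^N` of minimal
period `n` under the associated affine map, and morphism-defining quadratic
forms on `ℙ^M` with `P₂ ∈ ℚ^M` of minimal period `m`, there are
morphism-defining quadratic forms on `ℙ^{N+M}` for which `(P₁, P₂) ∈ ℚ^{N+M}`
has minimal period exactly `lcm(n, m)` under the associated affine map. -/
theorem exists_combined_morphism_forms_lcm_period (N M : ℕ) (hN : 1 ≤ N) (hM : 1 ≤ M)
    (F : Fin N → MvPolynomial (Fin (N + 1)) ℚ)
    (G : Fin M → MvPolynomial (Fin (M + 1)) ℚ)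
    (hFhom : ∀ i : Fin N, (F i).IsHomogeneous 2)
    (hGhom : ∀ j : Fin M, (G j).IsHomogeneous 2)
    (hF : ∀ z : Fin (N + 1) → ℂ,
      (∀ i : Fin N,
        MvPolynomial.eval z (MvPolynomial.map (algebraMap ℚ ℂ) (F i)) = 0) →
      z (Fin.last N) ^ 2 = 0 → z = 0)
    (hG : ∀ z : Fin (M + 1) → ℂ,
      (∀ j : Fin M,
        MvPolynomial.eval z (MvPolynomial.map (algebraMap ℚ ℂ) (G j)) = 0) →
      z (Fin.last M) ^ 2 = 0 → z = 0)
    (P₁ : Fin N → ℚ) (P₂ : Fin M → ℚ) (n m : ℕ) (hn : 1 ≤ n) (hm : 1 ≤ m)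
    (hP₁ : Function.minimalPeriod
      (fun (x : Fin N → ℚ) (i : Fin N) => MvPolynomial.eval (Fin.snoc x 1) (F i)) P₁ = n)
    (hP₂ : Function.minimalPeriod
      (fun (x : Fin M → ℚ) (j : Fin M) => MvPolynomial.eval (Fin.snoc x 1) (G j)) P₂ = m) :
    ∃ H : Fin (N + M) → MvPolynomial (Fin (N + M + 1)) ℚ,
      (∀ i : Fin (N + M), (H i).IsHomogeneous 2) ∧
      (∀ z : Fin (N + M + 1) → ℂ,
        (∀ i : Fin (N + M),
          MvPolynomial.eval z (MvPolynomial.map (algebraMap ℚ ℂ) (H i)) = 0) →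
        z (Fin.last (N + M)) ^ 2 = 0 → z = 0) ∧
      Function.minimalPeriod
        (fun (x : Fin (N + M) → ℚ) (i : Fin (N + M)) =>
          MvPolynomial.eval (Fin.snoc x 1) (H i))
        (Fin.append P₁ P₂) = Nat.lcm n m := by
  classical
  let a : Fin (N + 1) → Fin (N + M + 1) :=
    Fin.snoc (α := fun _ => Fin (N + M + 1)) (fun i => (Fin.castAdd M i).castSucc) (Fin.last _)
  let b : Fin (M + 1) → Fin (N + M + 1) :=
    Fin.snoc (α := fun _ => Fin (N + M + 1)) (fun i => (Fin.natAdd N i).castSucc) (Fin.last _)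
  have ha1 : ∀ i : Fin N, a i.castSucc = (Fin.castAdd M i).castSucc := fun i => by simp [a]
  have ha2 : a (Fin.last N) = Fin.last _ := by simp [a]
  have hb1 : ∀ i : Fin M, b i.castSucc = (Fin.natAdd N i).castSucc := fun i => by simp [b]
  have hb2 : b (Fin.last M) = Fin.last _ := by simp [b]
  have hza : ∀ (x : Fin N → ℚ) (y : Fin M → ℚ),
      (Fin.snoc (α := fun _ => ℚ) (Fin.append x y) 1 : Fin (N + M + 1) → ℚ) ∘ a
        = Fin.snoc (α := fun _ => ℚ) x 1 := by
    intro x y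
    funext i
    refine Fin.lastCases ?_ (fun i => ?_) i
    · simp [ha2]
    · simp only [Function.comp_apply, ha1, Fin.snoc_castSucc, Fin.append_left]
  have hzb : ∀ (x : Fin N → ℚ) (y : Fin M → ℚ),
      (Fin.snoc (α := fun _ => ℚ) (Fin.append x y) 1 : Fin (N + M + 1) → ℚ) ∘ b
        = Fin.snoc (α := fun _ => ℚ) y 1 := by
    intro x y
    funext i
    refine Fin.lastCases ?_ (fun i => ?_) i
    · simp [hb2]
    · simp only [Function.comp_apply, hb1, Fin.snoc_castSucc, Fin.append_right]
  refine ⟨Fin.append (fun i => MvPolynomial.rename a (F i))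
    (fun j => MvPolynomial.rename b (G j)), ?_, ?_, ?_⟩
  · intro i
    refine Fin.addCases (fun i => ?_) (fun i => ?_) i
    · rw [Fin.append_left]; exact (hFhom i).rename_isHomogeneous
    · rw [Fin.append_right]; exact (hGhom i).rename_isHomogeneous
  · intro z hz hl
    have h1 : z ∘ a = 0 := by
      apply hF
      · intro i
        have := hz (Fin.castAdd M i)
        rwa [Fin.append_left, MvPolynomial.map_rename, MvPolynomial.eval_rename] at this
      · rw [Function.comp_apply, ha2]; exact hl
    have h2 : z ∘ b = 0 := by
      apply hG
      · intro i
        have := hz (Fin.natAdd N i)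
        rwa [Fin.append_right, MvPolynomial.map_rename, MvPolynomial.eval_rename] at this
      · rw [Function.comp_apply, hb2]; exact hl
    funext i
    refine Fin.lastCases ?_ (fun i => ?_) i
    · exact pow_eq_zero_iff (two_ne_zero) |>.1 hl
    · refine Fin.addCases (fun i => ?_) (fun i => ?_) i
      · rw [← ha1]; exact congrFun h1 _
      · rw [← hb1]; exact congrFun h2 _
  · rw [← hP₁, ← hP₂]
    set f := fun (x : Fin N → ℚ) (i : Fin N) => MvPolynomial.eval (Fin.snoc x 1) (F i)
    set g := fun (x : Fin M → ℚ) (j : Fin M) => MvPolynomial.eval (Fin.snoc x 1) (G j)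
    have hsemi : Function.Semiconj (fun p : (Fin N → ℚ) × (Fin M → ℚ) => Fin.append p.1 p.2)
        (Prod.map f g)
        (fun (x : Fin (N + M) → ℚ) (i : Fin (N + M)) =>
          MvPolynomial.eval (Fin.snoc x 1)
            ((Fin.append (fun i => MvPolynomial.rename a (F i))
              (fun j => MvPolynomial.rename b (G j)) : Fin (N + M) → _) i)) := by
      rintro ⟨x, y⟩
      funext i
      refine Fin.addCases (fun i => ?_) (fun i => ?_) i
      · simp only [Prod.map, Fin.append_left, MvPolynomial.eval_rename, hza, f]
      · simp only [Prod.map, Fin.append_right, MvPolynomial.eval_rename, hzb, g]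
    have hinj : Function.Injective
        (fun p : (Fin N → ℚ) × (Fin M → ℚ) => Fin.append p.1 p.2) :=
      (Fin.appendEquiv N M).injective
    refine Eq.trans ?_ (Function.minimalPeriod_prodMap f g (P₁, P₂))
    rw [Function.minimalPeriod_eq_minimalPeriod_iff]
    intro k
    have := (hsemi.iterate_right k) (P₁, P₂)
    simp only [Function.IsPeriodicPt, Function.IsFixedPt]
    rw [← hinj.eq_iff, this]
end

section
/- The three homogeneous quadratic forms over ℂ in variables x₀, x₁, x₂ given by F₀ = -38/45·x₀² + 2·x₀·x₁ - 7/45·x₀·x₂ - 1/2·x₁² - 1/2·x₁·x₂ + x₂², F₁ = -67/90·x₀² + 2·x₀·x₁ + 157/90·x₀·x₂ - x₁·x₂, and F₂ = x₂² have no common zero in ℂ³ other than (0, 0, 0); that is, the map [x₀, x₁, x₂] ↦ [F₀, F₁, F₂] is a morphism of the projective plane. -/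
/-- The three homogeneous quadratic forms of Example 1 of the paper, together
with `x₂²`, have no common zero in `ℂ³` other than the origin; that is, the
associated degree-two polynomial map is a morphism of the projective plane. -/
theorem example_P2_forms_no_common_zero :
    ∀ x₀ x₁ x₂ : ℂ,
      -38/45 * x₀ ^ 2 + 2 * x₀ * x₁ - 7/45 * x₀ * x₂ - 1/2 * x₁ ^ 2 - 1/2 * x₁ * x₂ + x₂ ^ 2 = 0 →
      -67/90 * x₀ ^ 2 + 2 * x₀ * x₁ + 157/90 * x₀ * x₂ - x₁ * x₂ = 0 →
      x₂ ^ 2 = 0 →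
      x₀ = 0 ∧ x₁ = 0 ∧ x₂ = 0 := by
  intro x₀ x₁ x₂ h0 h1 h2
  have hx2 : x₂ = 0 := pow_eq_zero_iff (two_ne_zero) |>.mp h2
  subst hx2
  have h3 : x₀ * (2 * x₁ - 67/90 * x₀) = 0 := by linear_combination h1
  rcases mul_eq_zero.mp h3 with h | h
  · subst h
    have h4 : x₁ ^ 2 = 0 := by linear_combination (-2) * h0
    exact ⟨rfl, pow_eq_zero_iff (two_ne_zero) |>.mp h4, rfl⟩
  · have hx1 : x₁ = 67/180 * x₀ := by linear_combination (1/2) * h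
    subst hx1
    have h4 : x₀ ^ 2 = 0 := by linear_combination (-64800/10969) * h0
    have h5 : x₀ = 0 := pow_eq_zero_iff (two_ne_zero) |>.mp h4
    subst h5
    simp
end

section
/- For the map f : ℚ⁴ → ℚ⁴ defined by f(x₀, x₁, x₂, x₃) = (-38/45·x₀² + (2·x₁ - 7/45)·x₀ - 1/2·x₁² - 1/2·x₁ + 1, -67/90·x₀² + (2·x₁ + 157/90)·x₀ - x₁, (-x₃ - 1)·x₂ - 13/30·x₃² + 13/30·x₃ + 1, -1/2·x₂² + (-x₃ + 3/2)·x₂ - 1/3·x₃² + 4/3·x₃), the point (0, 0, 0, 0) is periodic with minimal period exactly 72. -/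
/-- The first planar factor, with a 9-cycle through the origin. -/
def mapNine (p : ℚ × ℚ) : ℚ × ℚ :=
  (-38/45 * p.1 ^ 2 + (2 * p.2 - 7/45) * p.1 - 1/2 * p.2 ^ 2 - 1/2 * p.2 + 1,
   -67/90 * p.1 ^ 2 + (2 * p.2 + 157/90) * p.1 - p.2)

/-- The second planar factor, with an 8-cycle through the origin. -/
def mapEight (p : ℚ × ℚ) : ℚ × ℚ :=
  ((-p.2 - 1) * p.1 - 13/30 * p.2 ^ 2 + 13/30 * p.2 + 1,
   -1/2 * p.1 ^ 2 + (-p.2 + 3/2) * p.1 - 1/3 * p.2 ^ 2 + 4/3 * p.2)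

theorem minimalPeriod_mapNine : Function.minimalPeriod mapNine (0, 0) = 3 ^ (1 + 1) := by
  have h0 : mapNine (0, 0) = (1, 0) := by norm_num [mapNine]
  have h1 : mapNine (1, 0) = (0, 1) := by norm_num [mapNine]
  have h2 : mapNine (0, 1) = (0, -1) := by norm_num [mapNine]
  have h3 : mapNine (0, -1) = (1, 1) := by norm_num [mapNine]
  have h4 : mapNine (1, 1) = (1, 2) := by norm_num [mapNine]
  have h5 : mapNine (1, 2) = (1, 3) := by norm_num [mapNine]
  have h6 : mapNine (1, 3) = (0, 4) := by norm_num [mapNine]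
  have h7 : mapNine (0, 4) = (-9, -4) := by norm_num [mapNine]
  have h8 : mapNine (-9, -4) = (0, 0) := by norm_num [mapNine]
  have : Fact (Nat.Prime 3) := ⟨by norm_num⟩
  apply Function.minimalPeriod_eq_prime_pow
  · change ¬ mapNine^[3] (0, 0) = (0, 0)
    simp only [Function.iterate_succ_apply, Function.iterate_zero_apply, h0, h1, h2]
    norm_num
  · change mapNine^[9] (0, 0) = (0, 0)
    simp only [Function.iterate_succ_apply, Function.iterate_zero_apply,
      h0, h1, h2, h3, h4, h5, h6, h7, h8]

theorem minimalPeriod_mapEight : Function.minimalPeriod mapEight (0, 0) = 2 ^ (2 + 1) := by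
  have h0 : mapEight (0, 0) = (1, 0) := by norm_num [mapEight]
  have h1 : mapEight (1, 0) = (0, 1) := by norm_num [mapEight]
  have h2 : mapEight (0, 1) = (1, 1) := by norm_num [mapEight]
  have h3 : mapEight (1, 1) = (-1, 1) := by norm_num [mapEight]
  have h4 : mapEight (-1, 1) = (3, 0) := by norm_num [mapEight]
  have h5 : mapEight (3, 0) = (-2, 0) := by norm_num [mapEight]
  have h6 : mapEight (-2, 0) = (3, -5) := by norm_num [mapEight]
  have h7 : mapEight (3, -5) = (0, 0) := by norm_num [mapEight]
  have : Fact (Nat.Prime 2) := ⟨by norm_num⟩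
  apply Function.minimalPeriod_eq_prime_pow
  · change ¬ mapEight^[4] (0, 0) = (0, 0)
    simp only [Function.iterate_succ_apply, Function.iterate_zero_apply, h0, h1, h2, h3]
    norm_num
  · change mapEight^[8] (0, 0) = (0, 0)
    simp only [Function.iterate_succ_apply, Function.iterate_zero_apply,
      h0, h1, h2, h3, h4, h5, h6, h7]

/-- For the quadratic map on `ℚ⁴` from Example 3 of the paper, the point
`(0,0,0,0)` is periodic with minimal period exactly `72`. -/
theorem minimalPeriod_P4_example_seventytwo :
    Function.minimalPeriod
      (fun p : ℚ × ℚ × ℚ × ℚ =>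
        (-38/45 * p.1 ^ 2 + (2 * p.2.1 - 7/45) * p.1 - 1/2 * p.2.1 ^ 2 - 1/2 * p.2.1 + 1,
         -67/90 * p.1 ^ 2 + (2 * p.2.1 + 157/90) * p.1 - p.2.1,
         (-p.2.2.2 - 1) * p.2.2.1 - 13/30 * p.2.2.2 ^ 2 + 13/30 * p.2.2.2 + 1,
         -1/2 * p.2.2.1 ^ 2 + (-p.2.2.2 + 3/2) * p.2.2.1 - 1/3 * p.2.2.2 ^ 2 + 4/3 * p.2.2.2))
      (0, 0, 0, 0) = 72 := by
  set f := (fun p : ℚ × ℚ × ℚ × ℚ =>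
        (-38/45 * p.1 ^ 2 + (2 * p.2.1 - 7/45) * p.1 - 1/2 * p.2.1 ^ 2 - 1/2 * p.2.1 + 1,
         -67/90 * p.1 ^ 2 + (2 * p.2.1 + 157/90) * p.1 - p.2.1,
         (-p.2.2.2 - 1) * p.2.2.1 - 13/30 * p.2.2.2 ^ 2 + 13/30 * p.2.2.2 + 1,
         -1/2 * p.2.2.1 ^ 2 + (-p.2.2.2 + 3/2) * p.2.2.1 - 1/3 * p.2.2.2 ^ 2 + 4/3 * p.2.2.2))
    with hf
  let e : (ℚ × ℚ) × (ℚ × ℚ) → ℚ × ℚ × ℚ × ℚ := fun q => (q.1.1, q.1.2, q.2.1, q.2.2)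
  have he : Function.Injective e := by
    rintro ⟨⟨a, b⟩, c, d⟩ ⟨⟨a2, b2⟩, c2, d2⟩ h
    simpa [e, and_assoc] using h
  have hs : Function.Semiconj e (Prod.map mapNine mapEight) f := fun q => rfl
  have key : Function.minimalPeriod f (e ((0, 0), (0, 0))) =
      Function.minimalPeriod (Prod.map mapNine mapEight) ((0, 0), (0, 0)) := by
    rw [Function.minimalPeriod_eq_minimalPeriod_iff]
    intro n
    unfold Function.IsPeriodicPt Function.IsFixedPt
    rw [← (hs.iterate_right n).eq, he.eq_iff]
  change Function.minimalPeriod f (e ((0, 0), (0, 0))) = 72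
  rw [key, Function.minimalPeriod_prodMap, minimalPeriod_mapNine, minimalPeriod_mapEight]
  norm_num
end

section
/- For every natural number N ≥ 1, there exists a quadratic map f on ℚ^N such that the point 0 = (0,…,0) is periodic for f with minimal period exactly (N+1)(N+2)/2 (the number of coefficients of a quadratic form in N+1 variables). -/
/-- The interpolation points, indexed by unordered pairs of homogeneous coordinates. -/
def latticePt (N : ℕ) : Sym2 (Option (Fin N)) → (Fin N → ℚ) :=
  Sym2.lift ⟨fun c d i => (if c = some i then 1 else 0) + (if d = some i then 1 else 0),
    fun c d => by funext i; exact add_comm _ _⟩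

/-- The homogeneous coordinates, the one at `none` being `2 - ∑ X i`. -/
noncomputable def homCoord (N : ℕ) : Option (Fin N) → MvPolynomial (Fin N) ℚ
  | none => MvPolynomial.C 2 - ∑ i, MvPolynomial.X i
  | some i => MvPolynomial.X i

theorem homCoord_degree (N : ℕ) (a : Option (Fin N)) : (homCoord N a).totalDegree ≤ 1 := by
  cases a with
  | none =>
    refine (MvPolynomial.totalDegree_sub _ _).trans (max_le (by simp) ?_)
    refine MvPolynomial.totalDegree_finsetSum_le fun i _ => ?_
    simp
  | some i => simp [homCoord]

theorem homCoord_eval (N : ℕ) (a c d : Option (Fin N)) :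
    MvPolynomial.eval (latticePt N s(c, d)) (homCoord N a)
      = (if a = c then 1 else 0) + (if a = d then 1 else 0) := by
  cases a with
  | none =>
    cases c <;> cases d <;> simp [homCoord, latticePt, Finset.sum_add_distrib] <;> norm_num
  | some i => simp [homCoord, latticePt, eq_comm]

theorem exists_lagrange (N : ℕ) (t : Sym2 (Option (Fin N))) :
    ∃ L : MvPolynomial (Fin N) ℚ, L.totalDegree ≤ 2 ∧
      ∀ s, MvPolynomial.eval (latticePt N s) L = if s = t then 1 else 0 := by
  induction t using Sym2.ind with
  | _ a b =>
  by_cases hab : a = b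
  · subst hab
    refine ⟨MvPolynomial.C (1 / 2) * (homCoord N a * (homCoord N a - MvPolynomial.C 1)), ?_, ?_⟩
    · refine (MvPolynomial.totalDegree_mul _ _).trans ?_
      have h1 := MvPolynomial.totalDegree_mul (homCoord N a) (homCoord N a - MvPolynomial.C 1)
      have h2 := MvPolynomial.totalDegree_sub (homCoord N a) (MvPolynomial.C 1)
      have h3 := homCoord_degree N a
      rw [MvPolynomial.totalDegree_C] at h2 ⊢
      have h4 := h2.trans (max_le h3 (Nat.zero_le 1))
      omega
    · intro s
      induction s using Sym2.ind with
      | _ c d =>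
      simp only [map_mul, map_sub, MvPolynomial.eval_C, homCoord_eval, Sym2.eq_iff]
      by_cases h1 : a = c <;> by_cases h2 : a = d <;> simp [h1, h2, eq_comm] <;> grind
  · refine ⟨homCoord N a * homCoord N b, ?_, ?_⟩
    · have h1 := MvPolynomial.totalDegree_mul (homCoord N a) (homCoord N b)
      have h2 := homCoord_degree N a
      have h3 := homCoord_degree N b
      omega
    · intro s
      induction s using Sym2.ind with
      | _ c d =>
      simp only [map_mul, homCoord_eval, Sym2.eq_iff]
      grind

/-- For every natural number `N ≥ 1`, there exists a quadratic map `f` on `ℚ^N`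
such that the point `0` is periodic for `f` with minimal period exactly
`(N+1)(N+2)/2`, the number of coefficients of a quadratic form in `N+1` variables. -/
theorem exists_quadratic_map_with_trivial_period (N : ℕ) (hN : 1 ≤ N) :
    ∃ f : (Fin N → ℚ) → (Fin N → ℚ),
      (∀ i : Fin N, ∃ p : MvPolynomial (Fin N) ℚ,
        p.totalDegree ≤ 2 ∧ ∀ x : Fin N → ℚ, f x i = MvPolynomial.eval x p) ∧
      Function.minimalPeriod f (fun _ => 0) = (N + 1) * (N + 2) / 2 := by
  choose L hdeg hL using exists_lagrange N
  have hcard : Fintype.card (Sym2 (Option (Fin N))) = (N + 1) * (N + 2) / 2 := by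
    rw [Sym2.card, Nat.choose_two_right]
    simp [mul_comm]
  obtain ⟨M, hM⟩ : ∃ M, M = (N + 1) * (N + 2) / 2 := ⟨_, rfl⟩
  rw [← hM] at hcard ⊢
  have hMpos : M ≠ 0 := by
    rw [← hcard]
    have : Nonempty (Sym2 (Option (Fin N))) := ⟨s(none, none)⟩
    exact Fintype.card_ne_zero
  have : NeZero M := ⟨hMpos⟩
  let e₀ : Sym2 (Option (Fin N)) ≃ ZMod M :=
    Fintype.equivOfCardEq (by rw [hcard, ZMod.card])
  let e : Sym2 (Option (Fin N)) ≃ ZMod M := e₀.trans (Equiv.subRight (e₀ s(none, none)))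
  have he : e.symm 0 = s(none, none) := by
    rw [Equiv.symm_apply_eq]; simp [e]
  have hinj : Function.Injective (latticePt N) := by
    intro s t h
    have h1 := hL t s
    rw [h, hL t t] at h1
    by_contra hne
    simp [hne] at h1
  let P : Fin N → MvPolynomial (Fin N) ℚ := fun i =>
    ∑ t, MvPolynomial.C (latticePt N (e.symm (1 + e t)) i) * L t
  let f : (Fin N → ℚ) → (Fin N → ℚ) := fun x i => MvPolynomial.eval x (P i)
  refine ⟨f, fun i => ⟨P i, ?_, fun x => rfl⟩, ?_⟩
  · refine MvPolynomial.totalDegree_finsetSum_le fun t _ => ?_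
    refine (MvPolynomial.totalDegree_mul _ _).trans ?_
    rw [MvPolynomial.totalDegree_C, zero_add]
    exact hdeg t
  · let q : ZMod M → (Fin N → ℚ) := fun k => latticePt N (e.symm k)
    have hq : Function.Injective q := hinj.comp e.symm.injective
    have hsemi : Function.Semiconj q (fun k => 1 + k) f := by
      intro k
      funext i
      simp [f, P, q, hL]
    have hq0 : q 0 = fun _ => 0 := by
      funext i
      simp [q, he, latticePt]
    rw [← hq0]
    refine Eq.trans ?_ (ZMod.addOrderOf_one M)
    refine Function.minimalPeriod_eq_minimalPeriod_iff.2 fun n => ?_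
    have h := (hsemi.iterate_right n) 0
    unfold Function.IsPeriodicPt Function.IsFixedPt
    rw [← h]
    exact hq.eq_iff
end

section
/- The five homogeneous quadratic forms over ℂ in variables x₀, x₁, x₂, x₃, x₄ given by F₀ = -38/45·x₀² + (2·x₁ - 7/45·x₄)·x₀ - 1/2·x₁² - 1/2·x₄·x₁ + x₄², F₁ = -67/90·x₀² + (2·x₁ + 157/90·x₄)·x₀ - x₄·x₁, F₂ = (-x₃ - x₄)·x₂ - 13/30·x₃² + 13/30·x₄·x₃ + x₄², F₃ = -1/2·x₂² + (-x₃ + 3/2·x₄)·x₂ - 1/3·x₃² + 4/3·x₄·x₃, and F₄ = x₄² have no common zero in ℂ⁵ other than the origin; that is, the map [x₀, …, x₄] ↦ [F₀, …, F₄] is a morphism of projective 4-space. -/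
/-- The five homogeneous quadratic forms of Example 3 of the paper have no
common zero in `ℂ⁵` other than the origin; that is, the associated degree-two
polynomial map is a morphism of projective 4-space. -/
theorem example_P4_forms_no_common_zero :
    ∀ x₀ x₁ x₂ x₃ x₄ : ℂ,
      -38/45 * x₀ ^ 2 + (2 * x₁ - 7/45 * x₄) * x₀ - 1/2 * x₁ ^ 2 - 1/2 * x₄ * x₁ + x₄ ^ 2 = 0 →
      -67/90 * x₀ ^ 2 + (2 * x₁ + 157/90 * x₄) * x₀ - x₄ * x₁ = 0 →
      (-x₃ - x₄) * x₂ - 13/30 * x₃ ^ 2 + 13/30 * x₄ * x₃ + x₄ ^ 2 = 0 →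
      -1/2 * x₂ ^ 2 + (-x₃ + 3/2 * x₄) * x₂ - 1/3 * x₃ ^ 2 + 4/3 * x₄ * x₃ = 0 →
      x₄ ^ 2 = 0 →
      x₀ = 0 ∧ x₁ = 0 ∧ x₂ = 0 ∧ x₃ = 0 ∧ x₄ = 0 := by
  intro x₀ x₁ x₂ x₃ x₄ h0 h1 h2 h3 h4
  have e4 : x₄ = 0 := pow_eq_zero_iff (two_ne_zero) |>.mp h4
  subst e4
  have a : x₀ = 0 := by
    have h : x₀ * (x₁ - 67/180 * x₀) = 0 := by linear_combination (1/2) * h1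
    rcases mul_eq_zero.mp h with h | h
    · exact h
    · have e : x₁ = 67/180 * x₀ := by linear_combination h
      subst e
      have : x₀ ^ 2 = 0 := by
        linear_combination (1 / (-38/45 + 67/90 - 1/2 * (67/180)^2)) * h0
      exact pow_eq_zero_iff (two_ne_zero) |>.mp this
  have c : x₃ = 0 := by
    have h : x₃ * (x₂ + 13/30 * x₃) = 0 := by linear_combination (-1) * h2
    rcases mul_eq_zero.mp h with h | h
    · exact h
    · have e : x₂ = -13/30 * x₃ := by linear_combination h
      subst e
      have : x₃ ^ 2 = 0 := by
        linear_combination (1800/11) * h3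
      exact pow_eq_zero_iff (two_ne_zero) |>.mp this
  subst a c
  have b : x₁ ^ 2 = 0 := by linear_combination (-2) * h0
  have d : x₂ ^ 2 = 0 := by linear_combination (-2) * h3
  exact ⟨rfl, pow_eq_zero_iff (two_ne_zero) |>.mp b, pow_eq_zero_iff (two_ne_zero) |>.mp d, rfl, rfl⟩
end
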